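/- arXiv:2011.10641 — 4 statements merged into one kernel-verified Lean document; each statement's English description precedes it below -/
import Mathlib

section
/- Let G be a bicyclic graph of order n ≥ 7 that has a cut vertex (i.e., G is not 2-connected). Then S_k(G) ≤ S_k(B_n) for every k ≥ 1. -/
open SimpleGraph

/-- `S_k(G)`: the number of connected sets of `G` of cardinality `k`. -/
noncomputable def connCount {V : Type} (G : SimpleGraph V) (k : ℕ) : ℕ :=
  Nat.card {S : Finset V // S.card = k ∧ (G.induce (S : Set V)).Connected}

/-- `B_n`: on `{0,…,n−1}`, vertex `0` is adjacent to each of `1,…,n−2`, vertices `1` and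
`2` are adjacent, vertex `n−1` is adjacent to vertices `0` and `1`. -/
def Bgraph (n : ℕ) : SimpleGraph (Fin n) :=
  SimpleGraph.fromRel (fun a b =>
    a.val = 0 ∨ (a.val = 1 ∧ b.val = 2) ∨ (a.val = n - 1 ∧ b.val = 1))


namespace BC
open Finset
open scoped Classical

variable {V : Type} {G : SimpleGraph V}

def Cn (G : SimpleGraph V) (S : Finset V) : Prop :=
  S.Nonempty ∧ ∀ T, T ⊆ S → T.Nonempty → (∀ a ∈ T, ∀ b ∈ S, G.Adj a b → b ∈ T) → T = S

def NA (G : SimpleGraph V) (X Y : Finset V) : Prop := ∀ a ∈ X, ∀ b ∈ Y, ¬ G.Adj a b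

noncomputable def sc (G : SimpleGraph V) (A : Finset V) (k : ℕ) : ℕ :=
  ((A.powersetCard k).filter (fun S => Cn G S)).card

noncomputable def bd (G : SimpleGraph V) (r : V) (X : Finset V) (j : ℕ) : ℕ :=
  ((X.powersetCard j).filter (fun J => ¬ Cn G (insert r J))).card

noncomputable def dg (G : SimpleGraph V) (X : Finset V) (x : V) : ℕ :=
  (X.filter (fun y => G.Adj x y)).card

noncomputable def D (G : SimpleGraph V) (X : Finset V) : ℕ := ∑ x ∈ X, dg G X x

theorem NA.symm {X Y : Finset V} (h : NA G X Y) : NA G Y X :=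
  fun a ha b hb hab => h b hb a ha hab.symm

theorem Cn_iff (S : Finset V) : (G.induce (S : Set V)).Connected ↔ Cn G S := by
  constructor
  · intro h
    refine ⟨?_, ?_⟩
    · obtain ⟨x⟩ := h.nonempty
      exact ⟨x.1, x.2⟩
    · intro T hT ⟨t, ht⟩ hcl
      apply Finset.Subset.antisymm hT
      intro b hb
      have hr := h.preconnected ⟨t, hT ht⟩ ⟨b, hb⟩
      rw [SimpleGraph.reachable_iff_reflTransGen] at hr
      have : ∀ y : (S : Set V), Relation.ReflTransGen (G.induce (S : Set V)).Adj ⟨t, hT ht⟩ y → y.1 ∈ T := by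
        intro y hy
        induction hy with
        | refl => exact ht
        | tail _ h2 ih => exact hcl _ ih _ (Subtype.property _) h2
      exact this _ hr
  · rintro ⟨⟨x, hx⟩, h⟩
    have : Nonempty (S : Set V) := ⟨⟨x, hx⟩⟩
    refine SimpleGraph.Connected.mk ?_
    intro a b
    let T : Finset V := S.filter (fun y => ∃ hy : y ∈ S, (G.induce (S : Set V)).Reachable a ⟨y, hy⟩)
    have hT : T = S := by
      apply h T (Finset.filter_subset _ _)
      · exact ⟨a.1, Finset.mem_filter.2 ⟨a.2, a.2, SimpleGraph.Reachable.refl _⟩⟩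
      · intro u hu w hw huw
        obtain ⟨hu1, hu2, hu3⟩ := Finset.mem_filter.1 hu
        refine Finset.mem_filter.2 ⟨hw, hw, hu3.trans ?_⟩
        apply SimpleGraph.Adj.reachable
        exact huw
    have hb : b.1 ∈ T := by rw [hT]; exact b.2
    obtain ⟨_, _, h3⟩ := Finset.mem_filter.1 hb
    exact h3

theorem split {S : Finset V} (hS : S.Nonempty) (h : ¬ Cn G S) :
    ∃ X Y : Finset V, X.Nonempty ∧ Y.Nonempty ∧ Disjoint X Y ∧ X ∪ Y = S ∧ NA G X Y := by
  unfold Cn at h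
  push Not at h
  obtain ⟨T, hT, hne, hcl, hneq⟩ := h hS
  refine ⟨T, S \ T, hne, ?_, Finset.disjoint_sdiff, Finset.union_sdiff_of_subset hT, ?_⟩
  · rw [Finset.sdiff_nonempty]
    intro h'
    exact hneq (Finset.Subset.antisymm hT h')
  · intro a ha b hb hab
    rw [Finset.mem_sdiff] at hb
    exact hb.2 (hcl a ha b hb.1 hab)

theorem Cn_left {r : V} {X Y : Finset V} (hX : r ∉ X) (hY : r ∉ Y)
    (hna : NA G X Y) (h : Cn G (insert r (X ∪ Y))) : Cn G (insert r X) := by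
  refine ⟨by simp, ?_⟩
  intro T hT hne hcl
  by_cases hr : r ∈ T
  · have := h.2 (T ∪ Y) (by grind) ⟨r, by grind⟩ (by
      intro a ha b hb hab
      by_cases hbY : b ∈ Y
      · grind
      have : b ∈ insert r X := by grind
      rcases Finset.mem_union.1 ha with h1 | h1
      · grind
      · have := hna b
        have := hab.symm
        grind)
    apply Finset.Subset.antisymm hT
    intro b hb
    have hb' : b ∈ T ∪ Y := by rw [this]; grind
    rcases Finset.mem_union.1 hb' with h1 | h1
    · exact h1
    · rcases Finset.mem_insert.1 hb with h2 | h2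
      · grind
      · -- b in X and Y: b reachable in X? use disjointness-free argument
        by_contra hbT
        have h3 := h.2 {b} (by grind) (by simp) (by
          intro a ha c hc hac
          have : a = b := by simpa using ha
          subst this
          have := hna a h2 c
          have := hna c
          have := hac.symm
          have : c = r := by grind
          subst this
          exact absurd (hcl c hr a hb hac.symm) hbT)
        have : r ∈ ({b} : Finset V) := by rw [h3]; simp
        have : r = b := by simpa using this
        grind
  · have := h.2 T (by grind) hne (by
      intro a ha b hb hab
      have haX : a ∈ X := by grind
      have := hna a haX b
      have : b ∈ insert r X := by grind
      exact hcl a ha b this hab)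
    have : r ∈ T := by rw [this]; simp
    contradiction

theorem exists_nbr {r : V} {X Y : Finset V} (hX : r ∉ X)
    (hna : NA G X Y) (hne : X.Nonempty) (h : Cn G (insert r (X ∪ Y))) : ∃ x ∈ X, G.Adj r x := by
  by_contra hcon
  push Not at hcon
  have := h.2 X (by grind) hne (by
    intro a ha b hb hab
    have := hna a ha b
    have := hcon a ha
    have := hab.symm
    grind)
  have : r ∈ X := by rw [this]; simp
  contradiction

theorem D_insert {r : V} {X : Finset V} (hr : r ∉ X) :
    D G (insert r X) = D G X + 2 * dg G X r := by
  unfold D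
  rw [Finset.sum_insert hr]
  have h1 : dg G (insert r X) r = dg G X r := by
    unfold dg
    rw [Finset.filter_insert]
    simp
  have h2 : ∀ x ∈ X, dg G (insert r X) x = dg G X x + if G.Adj r x then 1 else 0 := by
    intro x hx
    unfold dg
    rw [Finset.filter_insert]
    by_cases h : G.Adj r x
    · rw [if_pos h.symm, if_pos h, Finset.card_insert_of_notMem (by simp [hr])]
    · rw [if_neg (fun h' => h h'.symm), if_neg h]; rfl
  rw [h1, Finset.sum_congr rfl h2, Finset.sum_add_distrib, ← Finset.card_filter]
  unfold dg
  ring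

theorem dg_union_left {X Y : Finset V} (hna : NA G X Y) {x : V} (hx : x ∈ X) :
    dg G (X ∪ Y) x = dg G X x := by
  unfold dg
  congr 1
  ext y
  have := hna x hx y
  grind

theorem D_union {X Y : Finset V} (hd : Disjoint X Y) (hna : NA G X Y) :
    D G (X ∪ Y) = D G X + D G Y := by
  unfold D
  rw [Finset.sum_union hd]
  congr 1
  · exact Finset.sum_congr rfl (fun x hx => dg_union_left hna hx)
  · refine Finset.sum_congr rfl (fun x hx => ?_)
    rw [Finset.union_comm]
    exact dg_union_left hna.symm hx

theorem dg_union {X Y : Finset V} (hd : Disjoint X Y) (r : V) :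
    dg G (X ∪ Y) r = dg G X r + dg G Y r := by
  unfold dg
  rw [Finset.filter_union, Finset.card_union_of_disjoint]
  exact Finset.disjoint_filter_filter hd

theorem D_insert_union {r : V} {X Y : Finset V} (hX : r ∉ X) (hY : r ∉ Y) (hd : Disjoint X Y)
    (hna : NA G X Y) : D G (insert r (X ∪ Y)) = D G (insert r X) + D G (insert r Y) := by
  rw [D_insert (by grind), D_insert hX, D_insert hY, D_union hd hna, dg_union hd]
  ring

theorem dg_pos {r : V} {X : Finset V} (hX : r ∉ X) (hne : X.Nonempty)
    (h : Cn G (insert r X)) : 1 ≤ dg G X r := by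
  obtain ⟨x, hx, hxr⟩ := exists_nbr (Y := ∅) hX (by intro a _ b hb; simp at hb) hne (by simpa using h)
  exact Finset.card_pos.2 ⟨x, by simp [hx, hxr]⟩

theorem EB : ∀ (N : ℕ) (r : V) (X : Finset V), X.card = N → r ∉ X → Cn G (insert r X) →
    2 * X.card ≤ D G (insert r X) := by
  intro N
  induction N using Nat.strong_induction_on with
  | _ N ih =>
  intro r X hN hr hc
  by_cases hne : X.Nonempty
  swap
  · rw [Finset.not_nonempty_iff_eq_empty] at hne
    simp [hne]
  by_cases hcX : Cn G X
  · obtain ⟨p, hp⟩ := hne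
    have h1 : insert p (X.erase p) = X := Finset.insert_erase hp
    have h2 : (X.erase p).card + 1 = X.card := Finset.card_erase_add_one hp
    have := ih (X.erase p).card (by omega) p (X.erase p) rfl (by simp) (by rwa [h1])
    rw [h1] at this
    rw [D_insert hr]
    have := dg_pos hr ⟨p, hp⟩ hc
    omega
  · obtain ⟨A, B, hA, hB, hd, hAB, hna⟩ := split hne hcX
    subst hAB
    have hrA : r ∉ A := by grind
    have hrB : r ∉ B := by grind
    have hcA := Cn_left hrA hrB hna hc
    have hcB := Cn_left hrB hrA hna.symm (by rwa [Finset.union_comm])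
    have hcard := Finset.card_union_of_disjoint hd
    have := hA.card_pos
    have := hB.card_pos
    have := ih A.card (by omega) r A rfl hrA hcA
    have := ih B.card (by omega) r B rfl hrB hcB
    rw [D_insert_union hrA hrB hd hna]
    omega

theorem EB' {X : Finset V} (h : Cn G X) : 2 * X.card ≤ D G X + 2 := by
  obtain ⟨p, hp⟩ := h.1
  have h1 : insert p (X.erase p) = X := Finset.insert_erase hp
  have h2 : (X.erase p).card + 1 = X.card := Finset.card_erase_add_one hp
  have := EB _ p (X.erase p) rfl (by simp) (by rwa [h1])
  rw [h1] at this
  omega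

theorem sc_insert {r : V} {X : Finset V} (hr : r ∉ X) (k : ℕ) :
    sc G (insert r X) (k+1) + bd G r X k = sc G X (k+1) + X.card.choose k := by
  have h : sc G (insert r X) (k+1) = sc G X (k+1) +
      ((X.powersetCard k).filter (fun J => Cn G (insert r J))).card := by
    unfold sc
    rw [Finset.powersetCard_succ_insert hr, Finset.filter_union, Finset.card_union_of_disjoint]
    · congr 1
      rw [Finset.filter_image, Finset.card_image_of_injOn]
      intro A hA B hB hAB
      have hA' : r ∉ A := by
        have := (Finset.mem_powersetCard.1 (Finset.mem_filter.1 hA).1).1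
        grind
      have hB' : r ∉ B := by
        have := (Finset.mem_powersetCard.1 (Finset.mem_filter.1 hB).1).1
        grind
      have hAB' : insert r A = insert r B := hAB
      rw [← Finset.erase_insert hA', hAB', Finset.erase_insert hB']
    · rw [Finset.disjoint_left]
      intro A hA hB
      have := (Finset.mem_powersetCard.1 (Finset.mem_filter.1 hA).1).1
      obtain ⟨J, hJ, rfl⟩ := Finset.mem_image.1 (Finset.mem_filter.1 hB).1
      grind
  rw [h]
  unfold bd
  rw [← Finset.card_powersetCard k X,
    ← Finset.card_filter_add_card_filter_not (s := X.powersetCard k) (fun J => Cn G (insert r J))]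
  ring

theorem sc_union {X Y : Finset V} (hna : NA G X Y) (k : ℕ) :
    sc G (X ∪ Y) k ≤ sc G X k + sc G Y k := by
  unfold sc
  refine le_trans (Finset.card_le_card ?_) (Finset.card_union_le _ _)
  intro S hS
  obtain ⟨hS1, hS2⟩ := Finset.mem_filter.1 hS
  obtain ⟨hS3, hS4⟩ := Finset.mem_powersetCard.1 hS1
  by_cases h : (S ∩ X).Nonempty
  · have := hS2.2 (S ∩ X) (by grind) h (by
      intro a ha b hb hab
      have := hna a (by grind) b
      grind)
    apply Finset.mem_union_left
    simp only [Finset.mem_filter, Finset.mem_powersetCard]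
    grind
  · apply Finset.mem_union_right
    simp only [Finset.mem_filter, Finset.mem_powersetCard]
    refine ⟨⟨?_, hS4⟩, hS2⟩
    intro a ha
    rw [Finset.not_nonempty_iff_eq_empty, Finset.eq_empty_iff_forall_notMem] at h
    have := h a
    grind

theorem Cn_singleton (r : V) : Cn G {r} := by
  refine ⟨by simp, ?_⟩
  intro T hT hne _
  exact (Finset.subset_singleton_iff.1 hT).resolve_left hne.ne_empty

theorem Cn_pair {r x : V} (h : G.Adj r x) : Cn G {r, x} := by
  refine ⟨by simp, ?_⟩
  intro T hT ⟨t, ht⟩ hcl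
  apply Finset.Subset.antisymm hT
  have h1 := hcl r
  have h2 := hcl x
  have h3 := h.symm
  have := hT ht
  intro a ha
  grind

end BC
namespace BC
open Finset
open scoped Classical

variable {V : Type} {G : SimpleGraph V}

noncomputable def fam (F W : Finset V) (s : ℕ) : Finset (Finset V) :=
  (W.powersetCard s).image (fun J => F ∪ J)

theorem mem_fam {F W J : Finset V} {s : ℕ} :
    J ∈ fam F W s ↔ ∃ K, K ⊆ W ∧ K.card = s ∧ F ∪ K = J := by
  simp [fam, Finset.mem_powersetCard, and_assoc]

theorem card_fam {F W : Finset V} (h : Disjoint F W) (s : ℕ) :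
    (fam F W s).card = W.card.choose s := by
  unfold fam
  rw [Finset.card_image_of_injOn, Finset.card_powersetCard]
  intro A hA B hB hAB
  have hA := (Finset.mem_powersetCard.1 hA).1
  have hB := (Finset.mem_powersetCard.1 hB).1
  have hAB : F ∪ A = F ∪ B := hAB
  rw [Finset.disjoint_left] at h
  ext x
  have : x ∈ F ∪ A ↔ x ∈ F ∪ B := by rw [hAB]
  have := @h x
  grind

theorem fam_sub_powersetCard {F W X : Finset V} {s j : ℕ} (h : Disjoint F W) (hF : F ⊆ X) (hW : W ⊆ X)
    (hj : F.card + s = j) {J : Finset V} (hJ : J ∈ fam F W s) : J ∈ X.powersetCard j := by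
  obtain ⟨K, hK, hKs, rfl⟩ := mem_fam.1 hJ
  rw [Finset.mem_powersetCard]
  refine ⟨Finset.union_subset hF (hK.trans hW), ?_⟩
  rw [Finset.card_union_of_disjoint (Finset.disjoint_of_subset_right hK h)]
  omega

theorem sc_le_choose (X : Finset V) (k : ℕ) : sc G X k ≤ X.card.choose k := by
  unfold sc
  rw [← Finset.card_powersetCard k X]
  exact Finset.card_filter_le _ _

theorem sc_zero {X : Finset V} {k : ℕ} (h : X.card < k) : sc G X k = 0 := by
  have := sc_le_choose (G := G) X k
  rw [Nat.choose_eq_zero_of_lt h] at this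
  omega

theorem bd_le_choose (r : V) (X : Finset V) (k : ℕ) : bd G r X k ≤ X.card.choose k := by
  unfold bd
  rw [← Finset.card_powersetCard k X]
  exact Finset.card_filter_le _ _

/-- closed proper subset gives not connected -/
theorem not_Cn {S : Finset V} (T : Finset V) (hT : T ⊆ S) (hne : T.Nonempty)
    (hcl : ∀ a ∈ T, ∀ b ∈ S, G.Adj a b → b ∈ T) (x : V) (hx : x ∈ S) (hxT : x ∉ T) : ¬ Cn G S := by
  intro h
  exact hxT (by rw [h.2 T hT hne hcl]; exact hx)

/-- the sets missing the neighbourhood -/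
theorem bad_miss {r : V} {X J : Finset V} (hr : r ∉ X)
    (hJ : J ⊆ X.filter (fun y => ¬ G.Adj r y)) (hne : J.Nonempty) : ¬ Cn G (insert r J) := by
  obtain ⟨x, hx⟩ := hne
  apply not_Cn {r} (by simp) (by simp) _ x (by simp [hx])
  · have := hJ hx
    simp only [Finset.mem_filter] at this
    rw [Finset.mem_singleton]
    rintro rfl
    exact hr this.1
  · intro a ha b hb hab
    have : a = r := by simpa using ha
    subst this
    rcases Finset.mem_insert.1 hb with rfl | h
    · exact ha
    · have := hJ h
      simp only [Finset.mem_filter] at this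
      exact absurd hab this.2

/-- the sets having an isolated non-neighbour `f` of `r` -/
theorem bad_iso {r f : V} {J : Finset V} (hf : f ∈ J) (hrf : r ≠ f) (hadj : ¬ G.Adj r f)
    (hJ : ∀ b ∈ J, ¬ G.Adj f b) : ¬ Cn G (insert r J) := by
  apply not_Cn {f} (by simp [hf]) (by simp) _ r (by simp) (by simpa using hrf)
  intro a ha b hb hab
  have : a = f := by simpa using ha
  subst this
  rcases Finset.mem_insert.1 hb with rfl | h
  · exact absurd hab.symm hadj
  · exact absurd hab (hJ b h)

theorem card_miss (X : Finset V) (r : V) :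
    (X.filter (fun y => ¬ G.Adj r y)).card = X.card - dg G X r := by
  have := Finset.card_filter_add_card_filter_not (s := X) (fun y => G.Adj r y)
  unfold dg
  omega

theorem bd_b0 {r : V} {X : Finset V} (hr : r ∉ X) (j : ℕ) :
    (X.card - dg G X r).choose (j+1) ≤ bd G r X (j+1) := by
  rw [← card_miss, ← Finset.card_powersetCard]
  apply Finset.card_le_card
  intro J hJ
  obtain ⟨h1, h2⟩ := Finset.mem_powersetCard.1 hJ
  rw [Finset.mem_filter, Finset.mem_powersetCard]
  refine ⟨⟨h1.trans (Finset.filter_subset _ _), h2⟩, bad_miss hr h1 ?_⟩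
  rw [← Finset.card_pos]; omega

theorem bd_zero (r : V) (X : Finset V) : bd G r X 0 = 0 := by
  unfold bd
  rw [Finset.card_eq_zero, Finset.filter_eq_empty_iff]
  intro J hJ
  have : J = ∅ := by simpa using hJ
  subst this
  have := Cn_singleton (G := G) r
  simpa using this

theorem bd_union {r x0 : V} {X Y : Finset V} (hX : r ∉ X) (hY : r ∉ Y) (hd : Disjoint X Y)
    (hna : NA G X Y) (hx0 : x0 ∈ X) (hrx : G.Adj r x0) (m : ℕ) :
    (∑ i ∈ range (m+2), bd G r X i * Y.card.choose (m+1-i)) + bd G r Y (m+1) + bd G r Y m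
      ≤ bd G r (X ∪ Y) (m+1) := by
  have hd' := Finset.disjoint_left.1 hd
  let Bx : ℕ → Finset (Finset V) := fun i => (X.powersetCard i).filter (fun J => ¬ Cn G (insert r J))
  let By : ℕ → Finset (Finset V) := fun i => (Y.powersetCard i).filter (fun J => ¬ Cn G (insert r J))
  have hBx : ∀ i J, J ∈ Bx i ↔ (J ⊆ X ∧ J.card = i) ∧ ¬ Cn G (insert r J) := by
    intro i J; simp only [Bx, Finset.mem_filter, Finset.mem_powersetCard]
  have hBy : ∀ i J, J ∈ By i ↔ (J ⊆ Y ∧ J.card = i) ∧ ¬ Cn G (insert r J) := by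
    intro i J; simp only [By, Finset.mem_filter, Finset.mem_powersetCard]
  let A : ℕ → Finset (Finset V) := fun i =>
    ((Bx i) ×ˢ (Y.powersetCard (m+1-i))).image (fun p => p.1 ∪ p.2)
  have hA : ∀ i K, K ∈ A i → K ∩ X ∈ Bx i ∧ K ∩ Y ⊆ Y ∧ (K ∩ Y).card = m+1-i ∧ K ⊆ X ∪ Y := by
    intro i K hK
    obtain ⟨⟨J, M⟩, hJM, rfl⟩ := Finset.mem_image.1 hK
    obtain ⟨hJ, hM⟩ := Finset.mem_product.1 hJM
    obtain ⟨hM1, hM2⟩ := Finset.mem_powersetCard.1 hM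
    have hJ1 := ((hBx _ _).1 hJ).1.1
    simp only at hJ1 hM1 hM2 hJ
    have e1 : (J ∪ M) ∩ X = J := by
      ext x; have := @hd' x; grind
    have e2 : (J ∪ M) ∩ Y = M := by
      ext x; have := @hd' x; grind
    simp only
    rw [e1, e2]
    exact ⟨hJ, hM1, hM2, Finset.union_subset_union hJ1 hM1⟩
  have hAcard : ∀ i, (A i).card = bd G r X i * Y.card.choose (m+1-i) := by
    intro i
    rw [Finset.card_image_of_injOn, Finset.card_product, Finset.card_powersetCard]
    · rfl
    · rintro ⟨J, M⟩ hJM ⟨J', M'⟩ hJM' heq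
      obtain ⟨hJ, hM⟩ := Finset.mem_product.1 hJM
      obtain ⟨hJ', hM'⟩ := Finset.mem_product.1 hJM'
      have hM1 := (Finset.mem_powersetCard.1 hM).1
      have hM1' := (Finset.mem_powersetCard.1 hM').1
      have hJ1 := ((hBx _ _).1 hJ).1.1
      have hJ1' := ((hBx _ _).1 hJ').1.1
      simp only at hM1 hM1' hJ1 hJ1' heq
      have hx : ∀ x, x ∈ J ∪ M ↔ x ∈ J' ∪ M' := by intro x; rw [heq]
      ext x
      · have := @hd' x; have := hx x; grind
      · have := @hd' x; have := hx x; grind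
  have hAdisj : Set.PairwiseDisjoint (↑(range (m+2))) A := by
    intro i _ j _ hij
    rw [Function.onFun, Finset.disjoint_left]
    intro K hK hK'
    have h1 := ((hBx _ _).1 (hA i K hK).1).1.2
    have h2 := ((hBx _ _).1 (hA j K hK').1).1.2
    omega
  let B3 := (By m).image (fun J => insert x0 J)
  have hB3card : B3.card = bd G r Y m := by
    rw [Finset.card_image_of_injOn]
    · rfl
    · intro J hJ J' hJ' heq
      have h1 := ((hBy _ _).1 hJ).1.1
      have h2 := ((hBy _ _).1 hJ').1.1
      have heq : insert x0 J = insert x0 J' := heq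
      have : x0 ∉ Y := hd' hx0
      rw [← Finset.erase_insert (show x0 ∉ J by grind), heq, Finset.erase_insert (by grind)]
  have hc0 : Cn G (insert r ∅) := by simpa using Cn_singleton (G := G) r
  have hcx : Cn G (insert r {x0}) := Cn_pair hrx
  have hB3 : ∀ K ∈ B3, K ∩ X = {x0} := by
    intro K hK
    obtain ⟨J, hJ, rfl⟩ := Finset.mem_image.1 hK
    have h1 := ((hBy _ _).1 hJ).1.1
    ext x; have := @hd' x; grind
  have hB2 : ∀ K ∈ By (m+1), K ∩ X = ∅ := by
    intro K hK
    have h1 := ((hBy _ _).1 hK).1.1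
    ext x; have := @hd' x; grind
  have hU : ∀ K ∈ (range (m+2)).biUnion A, ¬ Cn G (insert r (K ∩ X)) := by
    intro K hK
    obtain ⟨i, _, hi⟩ := Finset.mem_biUnion.1 hK
    exact ((hBx _ _).1 (hA i K hi).1).2
  have hd1 : Disjoint ((range (m+2)).biUnion A) (By (m+1)) := by
    rw [Finset.disjoint_left]
    intro K h1 h2
    have := hU K h1
    rw [hB2 K h2] at this
    exact this hc0
  have hd2 : Disjoint ((range (m+2)).biUnion A ∪ By (m+1)) B3 := by
    rw [Finset.disjoint_left]
    intro K h1 h2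
    rcases Finset.mem_union.1 h1 with h1 | h1
    · have := hU K h1
      rw [hB3 K h2] at this
      exact this hcx
    · have e1 := hB2 K h1
      rw [hB3 K h2] at e1
      simp at e1
  have key : ((range (m+2)).biUnion A ∪ By (m+1) ∪ B3) ⊆
      ((X ∪ Y).powersetCard (m+1)).filter (fun J => ¬ Cn G (insert r J)) := by
    intro K hK
    rw [Finset.mem_filter, Finset.mem_powersetCard]
    rcases Finset.mem_union.1 hK with hK | hK
    · rcases Finset.mem_union.1 hK with hK | hK
      · obtain ⟨i, hi0, hi⟩ := Finset.mem_biUnion.1 hK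
        obtain ⟨h1, h2, h3, h4⟩ := hA i K hi
        obtain ⟨⟨h5, h6⟩, h7⟩ := (hBx _ _).1 h1
        have hK' : K = (K ∩ X) ∪ (K ∩ Y) := by
          rw [← Finset.inter_union_distrib_left]
          exact (Finset.inter_eq_left.2 h4).symm
        refine ⟨⟨h4, ?_⟩, ?_⟩
        · rw [hK', Finset.card_union_of_disjoint, h6, h3]
          · have := Finset.mem_range.1 hi0; omega
          · exact Finset.disjoint_of_subset_left h5 (Finset.disjoint_of_subset_right h2 hd)
        · intro hcon
          rw [hK'] at hcon
          exact h7 (Cn_left (by grind) (by grind)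
            (fun a ha b hb => hna a (h5 ha) b (h2 hb)) hcon)
      · obtain ⟨⟨h5, h6⟩, h7⟩ := (hBy _ _).1 hK
        exact ⟨⟨by grind, h6⟩, h7⟩
    · obtain ⟨J, hJ, rfl⟩ := Finset.mem_image.1 hK
      obtain ⟨⟨h5, h6⟩, h7⟩ := (hBy _ _).1 hJ
      have hx0Y : x0 ∉ Y := hd' hx0
      refine ⟨⟨by grind, ?_⟩, ?_⟩
      · rw [Finset.card_insert_of_notMem (by grind), h6]
      · intro hcon
        apply h7
        have : insert x0 J = J ∪ {x0} := by ext; simp [or_comm]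
        rw [this] at hcon
        refine Cn_left (by grind) (by grind) (fun a ha b hb => ?_) hcon
        have : b = x0 := by simpa using hb
        subst this
        exact hna.symm a (h5 ha) b hx0
  have := Finset.card_le_card key
  rw [Finset.card_union_of_disjoint hd2, Finset.card_union_of_disjoint hd1,
    Finset.card_biUnion hAdisj, Finset.sum_congr rfl (fun i _ => hAcard i), hB3card] at this
  exact this

def K (G : SimpleGraph V) (r : V) (X : Finset V) (m : ℕ) : Prop :=
  sc G X (m+3) ≤ bd G r X (m+2) + bd G r X (m+1)

/-- assembly, general version -/
theorem assemble {r : V} {X Y : Finset V} (hX : r ∉ X) (hY : r ∉ Y) (hd : Disjoint X Y)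
    (hna : NA G X Y) (hc : Cn G (insert r (X ∪ Y))) (hXne : X.Nonempty)
    (m e : ℕ) (hKX : sc G X (m+3) ≤ (∑ i ∈ range (m+3), bd G r X i * Y.card.choose (m+2-i)) + e)
    (hKY : K G r Y m) : sc G (insert r (X ∪ Y)) (m+3) ≤ (X.card + Y.card).choose (m+2) + e := by
  obtain ⟨x0, hx0, hrx⟩ := exists_nbr hX hna hXne hc
  have h1 := bd_union hX hY hd hna hx0 hrx (m+1)
  have h2 := sc_insert (G := G) (r := r) (X := X ∪ Y) (by grind) (m+2)
  have h3 := sc_union hna (m+3)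
  rw [Finset.card_union_of_disjoint hd] at h2
  unfold K at hKY
  simp only [show m+1+2 = m+3 from rfl, show m+1+1 = m+2 from rfl, show m+2+1 = m+3 from rfl] at *
  omega

theorem K_sum {r : V} {X Y : Finset V} {m : ℕ} (hY : Y.Nonempty) (h : K G r X m) :
    sc G X (m+3) ≤ (∑ i ∈ range (m+3), bd G r X i * Y.card.choose (m+2-i)) := by
  rw [Finset.sum_range_succ, Finset.sum_range_succ]
  have h1 : m+2-(m+2) = 0 := by omega
  have h2 : m+2-(m+1) = 1 := by omega
  rw [h1, h2, Nat.choose_zero_right, Nat.choose_one_right]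
  have : bd G r X (m+1) * 1 ≤ bd G r X (m+1) * Y.card := Nat.mul_le_mul_left _ hY.card_pos
  unfold K at h
  omega

theorem K_union {r : V} {X Y : Finset V} {m : ℕ} (hX : r ∉ X) (hY : r ∉ Y) (hd : Disjoint X Y)
    (hna : NA G X Y) (hc : Cn G (insert r (X ∪ Y))) (hXne : X.Nonempty)
    (h1 : K G r X m) (h2 : K G r Y m) : K G r (X ∪ Y) m := by
  obtain ⟨x0, hx0, hrx⟩ := exists_nbr hX hna hXne hc
  have h3 := bd_union hX hY hd hna hx0 hrx (m+1)
  have h4 := bd_union hX hY hd hna hx0 hrx m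
  have h5 := sc_union hna (m+3)
  rw [Finset.sum_range_succ] at h3 h4
  simp only [show m+1+2 = m+3 from rfl, show m+1+1 = m+2 from rfl, Nat.sub_self,
    Nat.choose_zero_right, mul_one] at *
  unfold K at *
  omega

end BC

namespace BC
open Finset
open scoped Classical

variable {V : Type} {G : SimpleGraph V}

theorem dg_erase (X : Finset V) (y : V) : dg G (X.erase y) y = dg G X y := by
  unfold dg
  congr 1
  ext z
  have := G.loopless
  simp only [Finset.mem_filter, Finset.mem_erase]
  constructor
  · rintro ⟨⟨_, h⟩, h2⟩; exact ⟨h, h2⟩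
  · rintro ⟨h, h2⟩; exact ⟨⟨h2.ne', h⟩, h2⟩

theorem dg_erase_of_not {X : Finset V} {y r : V} (h : ¬ G.Adj r y) : dg G (X.erase y) r = dg G X r := by
  unfold dg
  congr 1
  ext z
  simp only [Finset.mem_filter, Finset.mem_erase]
  constructor
  · rintro ⟨⟨_, h⟩, h2⟩; exact ⟨h, h2⟩
  · rintro ⟨h1, h2⟩; exact ⟨⟨by rintro rfl; exact h h2, h1⟩, h2⟩

theorem dg_erase_of_adj {X : Finset V} {y r : V} (hy : y ∈ X) (h : G.Adj r y) :
    dg G (X.erase y) r + 1 = dg G X r := by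
  unfold dg
  rw [Finset.filter_erase, Finset.card_erase_add_one (by simp [hy, h])]

theorem dg_pos' {X : Finset V} {y : V} (hy : y ∈ X) (hc : Cn G X) (h2 : 2 ≤ X.card) :
    1 ≤ dg G X y := by
  rw [← dg_erase]
  apply dg_pos (by simp)
  · rw [← Finset.card_pos, Finset.card_erase_of_mem hy]; omega
  · rwa [Finset.insert_erase hy]

theorem dg_one {X : Finset V} {x y : V} (h : dg G X x = 1) (hy : y ∈ X) (ha : G.Adj x y) :
    ∀ z ∈ X, G.Adj x z → z = y := by
  intro z hz hxz
  exact Finset.card_le_one.1 (le_of_eq h) z (by simp [hz, hxz]) y (by simp [hy, ha])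

theorem dg_one_ex {X : Finset V} {x : V} (h : 1 ≤ dg G X x) : ∃ y ∈ X, G.Adj x y := by
  obtain ⟨y, hy⟩ := Finset.card_pos.1 h
  exact ⟨y, by simpa using hy⟩

theorem dg_two {X : Finset V} {x y z : V} (h : dg G X x = 2) (hy : y ∈ X) (ha : G.Adj x y)
    (hz : z ∈ X) (hb : G.Adj x z) (hyz : y ≠ z) : ∀ w ∈ X, G.Adj x w → w = y ∨ w = z := by
  intro w hw hxw
  have h1 : ({y, z} : Finset V) = X.filter (fun y => G.Adj x y) := by
    apply Finset.eq_of_subset_of_card_le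
    · intro a ha'
      grind
    · rw [Finset.card_pair hyz]; exact le_of_eq h
  have : w ∈ X.filter (fun y => G.Adj x y) := by simp [hw, hxw]
  rw [← h1] at this
  simpa using this

theorem leaf_Cn {y : V} {X : Finset V} (hy : y ∉ X) (hne : X.Nonempty) (h1 : dg G X y ≤ 1)
    (hc : Cn G (insert y X)) : Cn G X := by
  by_contra hcon
  obtain ⟨A, B, hA, hB, hd, hAB, hna⟩ := split hne hcon
  subst hAB
  have hyA : y ∉ A := by grind
  have hyB : y ∉ B := by grind
  have := dg_pos hyA hA (Cn_left hyA hyB hna hc)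
  have := dg_pos hyB hB (Cn_left hyB hyA hna.symm (by rwa [Finset.union_comm]))
  have := dg_union (G := G) hd y
  omega

theorem exists_leaf {X : Finset V} (hc : Cn G X) (h2 : 2 ≤ X.card) (hD : D G X + 2 = 2 * X.card) :
    ∃ y ∈ X, dg G X y = 1 := by
  by_contra hcon
  push Not at hcon
  have : X.card * 2 ≤ D G X := by
    unfold D
    rw [← smul_eq_mul]
    apply Finset.card_nsmul_le_sum
    intro x hx
    have := dg_pos' hx hc h2
    have := hcon x hx
    omega
  omega

theorem D_erase {X : Finset V} {y : V} (hy : y ∈ X) : D G (X.erase y) + 2 * dg G X y = D G X := by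
  have := D_insert (G := G) (r := y) (X := X.erase y) (by simp)
  rw [Finset.insert_erase hy, dg_erase] at this
  omega

theorem leaf_facts {X : Finset V} {y : V} (hy : y ∈ X) (hc : Cn G X) (h2 : 2 ≤ X.card)
    (hD : D G X + 2 = 2 * X.card) (h1 : dg G X y = 1) :
    Cn G (X.erase y) ∧ D G (X.erase y) + 2 = 2 * (X.erase y).card := by
  have hcard := Finset.card_erase_of_mem hy
  constructor
  · apply leaf_Cn (y := y) (by simp)
    · rw [← Finset.card_pos]; omega
    · rw [dg_erase]; omega
    · rwa [Finset.insert_erase hy]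
  · have := D_erase (G := G) hy
    omega

theorem leaf_sc {y : V} {X : Finset V} (hy : y ∉ X) (h1 : dg G X y = 1) (N k : ℕ) (hN : X.card = N+1) :
    sc G (insert y X) (k+2) ≤ sc G X (k+2) + N.choose k := by
  have e1 := sc_insert (G := G) hy (k+1)
  have e2 := bd_b0 (G := G) hy k
  rw [h1, hN, Nat.add_sub_cancel] at e2
  rw [hN, Nat.choose_succ_succ] at e1
  simp only [Nat.succ_eq_add_one, show k+1+1 = k+2 from rfl] at *
  omega

theorem TL : ∀ (N : ℕ) (X : Finset V), X.card = N+1 → Cn G X → D G X + 2 = 2 * X.card →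
    ∀ k, sc G X (k+2) ≤ N.choose (k+1) := by
  intro N
  induction N with
  | zero =>
    intro X hX _ _ k
    rw [sc_zero (by omega)]; omega
  | succ N ih =>
    intro X hX hc hD k
    obtain ⟨y, hy, h1⟩ := exists_leaf hc (by omega) hD
    obtain ⟨hc', hD'⟩ := leaf_facts hy hc (by omega) hD h1
    have hcard := Finset.card_erase_of_mem hy
    have e1 := ih (X.erase y) (by omega) hc' hD' k
    have e2 := leaf_sc (G := G) (y := y) (X := X.erase y) (by simp) (by rw [dg_erase, h1]) N k (by omega)
    rw [Finset.insert_erase hy] at e2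
    rw [Nat.choose_succ_succ]
    simp only [Nat.succ_eq_add_one]
    omega

theorem KX (m : ℕ) : ∀ (N : ℕ) (r : V) (X : Finset V), X.card = N → r ∉ X → Cn G (insert r X) →
    D G (insert r X) ≤ 2 * X.card + 2 → K G r X m := by
  intro N
  induction N using Nat.strong_induction_on with
  | _ N ih =>
  intro r X hN hr hc hD
  by_cases hne : X.Nonempty
  swap
  · rw [Finset.not_nonempty_iff_eq_empty] at hne
    unfold K
    rw [sc_zero (by simp [hne])]
    omega
  by_cases hcX : Cn G X
  · have h1 := dg_pos hr hne hc
    have h2 := EB' hcX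
    have h3 := D_insert (G := G) hr
    have hdle : dg G X r ≤ X.card := Finset.card_filter_le _ _
    have b1 := bd_b0 (G := G) hr m
    have b2 := bd_b0 (G := G) hr (m+1)
    have hd2 : dg G X r = 1 ∨ dg G X r = 2 := by omega
    rcases hd2 with hd | hd
    · obtain ⟨p, hp⟩ := hne
      have e1 : insert p (X.erase p) = X := Finset.insert_erase hp
      have e2 : (X.erase p).card + 1 = X.card := Finset.card_erase_add_one hp
      have e3 := ih (X.erase p).card (by omega) p (X.erase p) rfl (by simp) (by rwa [e1])
        (by rw [e1]; omega)
      have e4 := sc_insert (G := G) (r := p) (X := X.erase p) (by simp) (m+2)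
      have e5 := bd_le_choose (G := G) p (X.erase p) (m+1)
      rw [e1] at e4
      rw [hd, ← e2, Nat.add_sub_cancel] at b1 b2
      unfold K at *
      simp only [show m+1+1 = m+2 from rfl, show m+2+1 = m+3 from rfl] at *
      omega
    · obtain ⟨b, hb⟩ : ∃ b, X.card = b + 2 := ⟨X.card - 2, by omega⟩
      have e1 := TL (G := G) (b+1) X hb hcX (by omega) (m+1)
      rw [Nat.choose_succ_succ] at e1
      rw [hd, hb, Nat.add_sub_cancel] at b1 b2
      unfold K
      simp only [Nat.succ_eq_add_one, show m+1+1 = m+2 from rfl, show m+1+2 = m+3 from rfl] at *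
      omega
  · obtain ⟨A, B, hA, hB, hd, hAB, hna⟩ := split hne hcX
    subst hAB
    have hrA : r ∉ A := by grind
    have hrB : r ∉ B := by grind
    have hcA := Cn_left hrA hrB hna hc
    have hcB := Cn_left hrB hrA hna.symm (by rwa [Finset.union_comm])
    have hcard := Finset.card_union_of_disjoint hd
    have := hA.card_pos
    have := hB.card_pos
    have := EB A.card r A rfl hrA hcA
    have := EB B.card r B rfl hrB hcB
    rw [D_insert_union hrA hrB hd hna] at hD
    exact K_union hrA hrB hd hna hc hA (ih A.card (by omega) r A rfl hrA hcA (by omega))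
      (ih B.card (by omega) r B rfl hrB hcB (by omega))

theorem UL {r : V} {X : Finset V} (m N : ℕ) (hr : r ∈ X) (hN : X.card = N + 1) (hc : Cn G X)
    (hD : D G X ≤ 2 * X.card) (hcut : ¬ Cn G (X.erase r)) : sc G X (m+3) ≤ N.choose (m+2) := by
  have e2 : (X.erase r).card + 1 = X.card := Finset.card_erase_add_one hr
  by_cases hne : (X.erase r).Nonempty
  swap
  · rw [Finset.not_nonempty_iff_eq_empty] at hne
    rw [hne] at e2
    rw [sc_zero (by simp at e2; omega)]
    omega
  obtain ⟨A, B, hA, hB, hd, hAB, hna⟩ := split hne hcut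
  have hX : insert r (A ∪ B) = X := by rw [hAB, Finset.insert_erase hr]
  have hrA : r ∉ A := by intro h; have : r ∈ X.erase r := by { rw [← hAB]; grind }
                         simp at this
  have hrB : r ∉ B := by intro h; have : r ∈ X.erase r := by { rw [← hAB]; grind }
                         simp at this
  have hDD := D_insert_union hrA hrB hd hna
  rw [hX] at hDD
  rw [← hX] at hc
  have hcA := Cn_left hrA hrB hna hc
  have hcB := Cn_left hrB hrA hna.symm (by rwa [Finset.union_comm])
  have hcard := Finset.card_union_of_disjoint hd
  have := EB A.card r A rfl hrA hcA
  have := EB B.card r B rfl hrB hcB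
  rw [hAB] at hcard
  have := assemble hrA hrB hd hna hc hA m 0
    (by have := K_sum (Y := B) hB (KX m A.card r A rfl hrA hcA (by omega)); omega)
    (KX m B.card r B rfl hrB hcB (by omega))
  rw [hX] at this
  rw [show N = A.card + B.card by omega]
  exact this

theorem LD {e f : V} {Z : Finset V} (he : e ∉ insert f Z) (hf : f ∉ Z) (hef : G.Adj e f)
    (h1 : dg G (insert f Z) e = 1) (h2 : dg G Z f = 1) (N m : ℕ) (hN : Z.card = N + 1) :
    sc G (insert e (insert f Z)) (m+3) ≤ sc G (insert f Z) (m+3) + N.choose m := by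
  have e1 := sc_insert (G := G) he (m+2)
  have hZ : ∀ z ∈ Z, ¬ G.Adj e z := by
    intro z hz hez
    have := dg_one h1 (by simp) hef z (by simp [hz]) hez
    exact hf (this ▸ hz)
  have hdisj : Disjoint {f} (Z.filter (fun y => ¬ G.Adj f y)) := by
    rw [Finset.disjoint_singleton_left]; simp [hf]
  have key : (N+1).choose (m+2) + N.choose (m+1) ≤ bd G e (insert f Z) (m+2) := by
    have c1 : (fam {f} (Z.filter (fun y => ¬ G.Adj f y)) (m+1)).card = N.choose (m+1) := by
      rw [card_fam hdisj, card_miss, h2, hN, Nat.add_sub_cancel]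
    have c2 : (Z.powersetCard (m+2)).card = (N+1).choose (m+2) := by
      rw [Finset.card_powersetCard, hN]
    rw [← c1, ← c2, ← Finset.card_union_of_disjoint]
    · apply Finset.card_le_card
      intro J hJ
      rw [Finset.mem_filter]
      rcases Finset.mem_union.1 hJ with hJ | hJ
      · obtain ⟨hJ1, hJ2⟩ := Finset.mem_powersetCard.1 hJ
        refine ⟨Finset.mem_powersetCard.2 ⟨hJ1.trans (Finset.subset_insert _ _), hJ2⟩, ?_⟩
        apply bad_miss (X := Z) (by grind)
        · intro z hz
          simp [hJ1 hz, hZ z (hJ1 hz)]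
        · rw [← Finset.card_pos]; omega
      · refine ⟨fam_sub_powersetCard hdisj (by simp)
          ((Finset.filter_subset _ _).trans (Finset.subset_insert _ _)) (by simp; omega) hJ, ?_⟩
        obtain ⟨L, hL, hLc, rfl⟩ := mem_fam.1 hJ
        obtain ⟨x, hx⟩ : L.Nonempty := by rw [← Finset.card_pos]; omega
        have hL' : ∀ z ∈ L, z ∈ Z ∧ ¬ G.Adj f z := fun z hz => by simpa using hL hz
        apply not_Cn {e, f} (by grind) (by simp) _ x (by grind) (by grind)
        intro a ha b hb hab
        rcases Finset.mem_insert.1 ha with rfl | ha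
        · grind
        · have : a = f := by simpa using ha
          subst this
          grind
    · rw [Finset.disjoint_left]
      intro J hJ hJ'
      obtain ⟨L, hL, hLc, rfl⟩ := mem_fam.1 hJ'
      have := (Finset.mem_powersetCard.1 hJ).1
      grind
  rw [Finset.card_insert_of_notMem hf, hN] at e1
  have i1 : (N+1+1).choose (m+2) = (N+1).choose (m+1) + (N+1).choose (m+2) := Nat.choose_succ_succ _ _
  have i2 : (N+1).choose (m+1) = N.choose m + N.choose (m+1) := Nat.choose_succ_succ _ _
  simp only [show m+2+1 = m+3 from rfl] at *
  omega

theorem K3a {r e f : V} {Z : Finset V} (he : e ∉ insert f Z) (hf : f ∉ Z) (hef : G.Adj e f)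
    (hr : r ∉ insert e (insert f Z))
    (h1 : dg G (insert f Z) e = 1) (h2 : dg G Z f = 1) (a m : ℕ) (hN : Z.card = a + 2)
    (hrf : ¬ G.Adj r f) (h3 : dg G (insert e (insert f Z)) r = 3)
    (hc : Cn G (insert f Z)) (hD : D G (insert f Z) + 2 = 2 * (insert f Z).card) :
    K G r (insert e (insert f Z)) m := by
  have hcardf : (insert f Z).card = a + 3 := by rw [Finset.card_insert_of_notMem hf, hN]
  have hcarde : (insert e (insert f Z)).card = a + 4 := by
    rw [Finset.card_insert_of_notMem he, hcardf]
  have s1 := LD he hf hef h1 h2 (a+1) m hN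
  have s2 := TL (G := G) (a+2) (insert f Z) hcardf hc hD (m+1)
  have hdisj : Disjoint {f} (Z.filter (fun y => ¬ G.Adj f y)) := by
    rw [Finset.disjoint_singleton_left]; simp [hf]
  have hZ : ∀ z ∈ Z, ¬ G.Adj e z := by
    intro z hz hez
    have := dg_one h1 (by simp) hef z (by simp [hz]) hez
    exact hf (this ▸ hz)
  have key : ∀ j, (a+2).choose (j+1) ≤ bd G r (insert e (insert f Z)) (j+1) + a.choose j := by
    intro j
    set X := insert e (insert f Z) with hXdef
    set M := X.filter (fun y => ¬ G.Adj r y) with hM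
    have hMc : M.card = a + 1 := by rw [hM, card_miss, h3, hcarde]; omega
    have hfM : f ∈ M := by simp [hM, hXdef, hrf]
    have c1 : (fam {f} (Z.filter (fun y => ¬ G.Adj f y)) j).card = (a+1).choose j := by
      rw [card_fam hdisj, card_miss, h2, hN]; rfl
    have c2 : (M.powersetCard (j+1)).card = (a+1).choose (j+1) := by
      rw [Finset.card_powersetCard, hMc]
    have hd3 : Disjoint {f} (M.erase f) := by simp
    have c3 : (fam {f} (M.erase f) j).card = a.choose j := by
      rw [card_fam hd3, Finset.card_erase_of_mem hfM, hMc]; rfl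
    have c4 := Finset.card_union_add_card_inter (M.powersetCard (j+1))
      (fam {f} (Z.filter (fun y => ¬ G.Adj f y)) j)
    have c5 : ((M.powersetCard (j+1)) ∩ (fam {f} (Z.filter (fun y => ¬ G.Adj f y)) j)).card
        ≤ a.choose j := by
      rw [← c3]
      apply Finset.card_le_card
      intro J hJ
      obtain ⟨hJ1, hJ2⟩ := Finset.mem_inter.1 hJ
      obtain ⟨hJ3, hJ4⟩ := Finset.mem_powersetCard.1 hJ1
      obtain ⟨L, hL, hLc, rfl⟩ := mem_fam.1 hJ2
      refine mem_fam.2 ⟨L, ?_, hLc, rfl⟩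
      intro x hx
      have := hL hx
      simp only [Finset.mem_filter] at this
      rw [Finset.mem_erase]
      exact ⟨by rintro rfl; exact hf this.1, hJ3 (Finset.mem_union_right _ hx)⟩
    have c6 : ((M.powersetCard (j+1)) ∪ (fam {f} (Z.filter (fun y => ¬ G.Adj f y)) j)).card
        ≤ bd G r X (j+1) := by
      apply Finset.card_le_card
      intro J hJ
      rw [Finset.mem_filter]
      rcases Finset.mem_union.1 hJ with hJ | hJ
      · obtain ⟨hJ1, hJ2⟩ := Finset.mem_powersetCard.1 hJ
        refine ⟨Finset.mem_powersetCard.2 ⟨hJ1.trans (Finset.filter_subset _ _), hJ2⟩, ?_⟩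
        apply bad_miss (X := X) hr hJ1
        rw [← Finset.card_pos]; omega
      · refine ⟨fam_sub_powersetCard hdisj (by simp [hXdef])
          ((Finset.filter_subset _ _).trans (by grind)) (by simp; omega) hJ, ?_⟩
        obtain ⟨L, hL, hLc, rfl⟩ := mem_fam.1 hJ
        have hL' : ∀ z ∈ L, z ∈ Z ∧ ¬ G.Adj f z := fun z hz => by simpa using hL hz
        apply bad_iso (f := f) (by simp) (by grind) hrf
        intro b hb
        rcases Finset.mem_union.1 hb with hb | hb
        · have : b = f := by simpa using hb
          subst this
          exact G.irrefl
        · exact (hL' b hb).2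
    have i1 : (a+2).choose (j+1) = (a+1).choose j + (a+1).choose (j+1) := Nat.choose_succ_succ _ _
    omega
  have k1 := key m
  have k2 := key (m+1)
  have i1 : (a+2).choose (m+2) = (a+1).choose (m+1) + (a+1).choose (m+2) := Nat.choose_succ_succ _ _
  have i2 : (a+2).choose (m+1) = (a+1).choose m + (a+1).choose (m+1) := Nat.choose_succ_succ _ _
  have i3 : (a+1).choose (m+1) = a.choose m + a.choose (m+1) := Nat.choose_succ_succ _ _
  unfold K
  simp only [show m+1+1 = m+2 from rfl, show m+1+2 = m+3 from rfl] at *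
  omega

end BC

namespace BC
open Finset
open scoped Classical

variable {V : Type} {G : SimpleGraph V}

/-- existence of a good leaf in a tree all of whose leaves are among three attachment vertices -/
theorem good_leaf {r : V} {X : Finset V} (hc : Cn G X) (h5 : 5 ≤ X.card)
    (hD : D G X + 2 = 2 * X.card) (h3 : dg G X r = 3)
    (hL : ∀ y ∈ X, dg G X y = 1 → G.Adj r y) :
    ∃ e ∈ X, ∃ f ∈ X, G.Adj e f ∧ dg G X e = 1 ∧ dg G X f = 2 ∧ ¬ G.Adj r f := by
  by_contra hcon
  push Not at hcon
  set P := X.filter (fun y => G.Adj r y) with hP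
  have hPc : P.card = 3 := h3
  set L := X.filter (fun y => dg G X y = 1) with hLdef
  have hLX : L ⊆ X := Finset.filter_subset _ _
  have hLP : L ⊆ P := by
    intro y hy
    have := Finset.mem_filter.1 hy
    exact Finset.mem_filter.2 ⟨this.1, hL y this.1 this.2⟩
  have hL3 : L.card ≤ 3 := hPc ▸ Finset.card_le_card hLP
  have hsum : ∑ x ∈ X \ L, dg G X x + L.card = D G X := by
    unfold D
    rw [← Finset.sum_sdiff hLX]
    congr 1
    rw [Finset.card_eq_sum_ones]
    exact Finset.sum_congr rfl (fun x hx => (Finset.mem_filter.1 hx).2.symm)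
  have hcs := Finset.card_sdiff_add_card_eq_card hLX
  have hM : ∀ x ∈ X \ L, 2 ≤ dg G X x := by
    intro x hx
    rw [Finset.mem_sdiff] at hx
    have := dg_pos' hx.1 hc (by omega)
    have : dg G X x ≠ 1 := fun h => hx.2 (Finset.mem_filter.2 ⟨hx.1, h⟩)
    omega
  have hsub : ∀ Q, Q ⊆ X \ L → ∑ x ∈ Q, dg G X x + 2 * ((X \ L).card - Q.card) + L.card ≤ D G X := by
    intro Q hQ
    rw [← hsum, ← Finset.sum_sdiff hQ]
    have h1 : ((X \ L) \ Q).card * 2 ≤ ∑ x ∈ (X \ L) \ Q, dg G X x := by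
      rw [← smul_eq_mul]
      exact Finset.card_nsmul_le_sum _ _ _ (fun x hx => hM x (Finset.sdiff_subset hx))
    have h2 := Finset.card_sdiff_add_card_eq_card hQ
    omega
  have hL2 : 2 ≤ L.card := by
    have := hsub ∅ (by simp)
    simp at this
    omega
  -- neighbours of leaves
  have hnb : ∀ e ∈ L, ∃ f ∈ X \ L, G.Adj e f ∧ (dg G X f = 2 → G.Adj r f) := by
    intro e he
    have he' := Finset.mem_filter.1 he
    obtain ⟨f, hf, hef⟩ := dg_one_ex (G := G) (X := X) (x := e) (by omega)
    refine ⟨f, ?_, hef, fun h2 => hcon e he'.1 f hf hef he'.2 h2⟩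
    rw [Finset.mem_sdiff]
    refine ⟨hf, fun hfL => ?_⟩
    have hf' := Finset.mem_filter.1 hfL
    have := hc.2 {e, f} (by grind) (by simp) (by
      intro a ha b hb hab
      rcases Finset.mem_insert.1 ha with rfl | ha
      · have := dg_one he'.2 hf hef b hb hab
        simp [this]
      · have : a = f := by simpa using ha
        subst this
        have := dg_one hf'.2 he'.1 hef.symm b hb hab
        simp [this])
    have h2 : ({e, f} : Finset V).card ≤ 2 := Finset.card_le_two
    rw [this] at h2
    omega
  have main : ∃ u ∈ X \ L, dg G X u = L.card ∧ ∀ e ∈ L, G.Adj e u := by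
    obtain ⟨e0, he0⟩ : L.Nonempty := by rw [← Finset.card_pos]; omega
    obtain ⟨u, hu, hadj, hdg⟩ := hnb e0 he0
    refine ⟨u, hu, ?_⟩
    have huM := hM u hu
    have hs1 := hsub {u} (by simpa using hu)
    have hcp : 1 ≤ (X \ L).card := Finset.card_pos.2 ⟨u, hu⟩
    simp only [Finset.sum_singleton, Finset.card_singleton] at hs1
    have hpair : ∀ f ∈ X \ L, f ≠ u → dg G X u + dg G X f ≤ L.card + 2 := by
      intro f hf hfu
      have hs2 := hsub {u, f} (by grind)
      have : 2 ≤ (X \ L).card := by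
        rw [← Finset.card_pair hfu.symm]; exact Finset.card_le_card (by grind)
      rw [Finset.sum_pair hfu.symm, Finset.card_pair hfu.symm] at hs2
      omega
    have hcase : L.card = 2 ∨ L.card = 3 := by omega
    rcases hcase with h | h
    · have hdu : dg G X u = 2 := by omega
      refine ⟨by omega, fun e he => ?_⟩
      obtain ⟨f, hf, hef, hfr⟩ := hnb e he
      have hfM := hM f hf
      by_cases hfu : f = u
      · exact hfu ▸ hef
      · exfalso
        have := hpair f hf hfu
        have hdf : dg G X f = 2 := by omega
        have h1 := hfr hdf
        have h2 := hdg hdu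
        rw [Finset.mem_sdiff] at hf hu
        have h4 : insert f (insert u L) ⊆ P := by
          intro x hx
          rcases Finset.mem_insert.1 hx with rfl | hx
          · exact Finset.mem_filter.2 ⟨hf.1, h1⟩
          rcases Finset.mem_insert.1 hx with rfl | hx
          · exact Finset.mem_filter.2 ⟨hu.1, h2⟩
          exact hLP hx
        have := Finset.card_le_card h4
        rw [Finset.card_insert_of_notMem (by grind), Finset.card_insert_of_notMem hu.2] at this
        omega
    · have hLeq : L = P := Finset.eq_of_subset_of_card_le hLP (by omega)
      have h3' : ∀ f ∈ X \ L, (dg G X f = 2 → G.Adj r f) → 3 ≤ dg G X f := by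
        intro f hf hfr
        have := hM f hf
        by_contra hlt
        have h1 := hfr (by omega)
        rw [Finset.mem_sdiff] at hf
        exact hf.2 (hLeq ▸ Finset.mem_filter.2 ⟨hf.1, h1⟩)
      have := h3' u hu hdg
      refine ⟨by omega, fun e he => ?_⟩
      obtain ⟨f, hf, hef, hfr⟩ := hnb e he
      by_cases hfu : f = u
      · exact hfu ▸ hef
      · have := hpair f hf hfu
        have := h3' f hf hfr
        omega
  obtain ⟨u, hu, hdu, hall⟩ := main
  rw [Finset.mem_sdiff] at hu
  have hNu : L = X.filter (fun y => G.Adj u y) := by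
    apply Finset.eq_of_subset_of_card_le
    · intro e he
      exact Finset.mem_filter.2 ⟨hLX he, (hall e he).symm⟩
    · exact le_of_eq hdu
  have := hc.2 (insert u L) (by grind) (by simp) (by
    intro a ha b hb hab
    rcases Finset.mem_insert.1 ha with rfl | ha
    · apply Finset.mem_insert_of_mem
      rw [hNu]
      exact Finset.mem_filter.2 ⟨hb, hab⟩
    · have := dg_one (Finset.mem_filter.1 ha).2 hu.1 (hall a ha) b hb hab
      simp [this])
  have hcc := Finset.card_insert_of_notMem hu.2
  rw [this] at hcc
  omega

/-- bad sets gained by adding a leaf not adjacent to `r` -/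
theorem leaf_bd {r y : V} {X : Finset V} (hy : y ∉ X) (hry : r ≠ y) (hr : ¬ G.Adj r y)
    (h1 : dg G X y = 1) (N j : ℕ) (hN : X.card = N + 1) :
    bd G r X (j+1) + N.choose j ≤ bd G r (insert y X) (j+1) := by
  have hdisj : Disjoint {y} (X.filter (fun z => ¬ G.Adj y z)) := by
    rw [Finset.disjoint_singleton_left]; simp [hy]
  have c1 : (fam {y} (X.filter (fun z => ¬ G.Adj y z)) j).card = N.choose j := by
    rw [card_fam hdisj, card_miss, h1, hN, Nat.add_sub_cancel]
  rw [← c1]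
  unfold bd
  rw [← Finset.card_union_of_disjoint]
  · apply Finset.card_le_card
    intro J hJ
    rw [Finset.mem_filter]
    rcases Finset.mem_union.1 hJ with hJ | hJ
    · obtain ⟨hJ1, hJ2⟩ := Finset.mem_filter.1 hJ
      obtain ⟨hJ3, hJ4⟩ := Finset.mem_powersetCard.1 hJ1
      exact ⟨Finset.mem_powersetCard.2 ⟨hJ3.trans (Finset.subset_insert _ _), hJ4⟩, hJ2⟩
    · refine ⟨fam_sub_powersetCard hdisj (by simp)
          ((Finset.filter_subset _ _).trans (by grind)) (by simp; omega) hJ, ?_⟩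
      obtain ⟨L, hL, hLc, rfl⟩ := mem_fam.1 hJ
      have hL' : ∀ z ∈ L, z ∈ X ∧ ¬ G.Adj y z := fun z hz => by simpa using hL hz
      apply bad_iso (f := y) (by simp) hry hr
      intro b hb
      rcases Finset.mem_union.1 hb with hb | hb
      · have : b = y := by simpa using hb
        subst this
        exact G.irrefl
      · exact (hL' b hb).2
  · rw [Finset.disjoint_left]
    intro J hJ hJ'
    obtain ⟨L, hL, hLc, rfl⟩ := mem_fam.1 hJ'
    have := (Finset.mem_powersetCard.1 (Finset.mem_filter.1 hJ).1).1
    grind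

/-- the five-vertex case with k = 3 -/
theorem five {r y : V} {X : Finset V} (hX : X.card = 4) (hy : y ∉ X) (hry : r ≠ y) (hrX : r ∉ X)
    (hr : ¬ G.Adj r y) (h1 : dg G X y = 1) (hc : Cn G X) (hD : D G X = 6) (h3 : dg G X r = 3) :
    K G r (insert y X) 0 := by
  have hrX' : r ∉ insert y X := by grind
  have hcard : (insert y X).card = 5 := by rw [Finset.card_insert_of_notMem hy, hX]
  have h3' : dg G (insert y X) r = 3 := by
    have := dg_erase_of_not (X := insert y X) hr
    rw [Finset.erase_insert hy] at this
    omega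
  have b1 : 2 ≤ bd G r (insert y X) 1 := by
    have := bd_b0 (G := G) hrX' 0
    rw [hcard, h3'] at this
    simpa using this
  have s1 := TL (G := G) 3 X hX hc (by omega) 1
  have s2 := leaf_sc (G := G) hy h1 3 1 hX
  have b2 := leaf_bd hy hry hr h1 3 1 hX
  simp only [show Nat.choose 3 2 = 3 by decide, show Nat.choose 3 1 = 3 by decide, Nat.reduceAdd] at *
  unfold K
  simp only [Nat.reduceAdd]
  obtain ⟨w, hw⟩ : (X.filter (fun z => ¬ G.Adj r z)).Nonempty := by
    rw [← Finset.card_pos, card_miss]; omega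
  rw [Finset.mem_filter] at hw
  obtain ⟨hwX, hwr⟩ := hw
  by_cases hdw : dg G X w ≤ 2
  · -- an isolated pair
    have : ∃ x ∈ X, x ≠ w ∧ ¬ G.Adj w x := by
      by_contra hcon
      push Not at hcon
      have : X.erase w ⊆ X.filter (fun z => G.Adj w z) := by
        intro x hx
        rw [Finset.mem_erase] at hx
        exact Finset.mem_filter.2 ⟨hx.2, hcon x hx.2 hx.1⟩
      have := Finset.card_le_card this
      rw [Finset.card_erase_of_mem hwX] at this
      unfold dg at hdw
      omega
    obtain ⟨x, hx, hxw, hwx⟩ := this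
    have : 1 ≤ bd G r X 2 := by
      apply Finset.card_pos.2
      refine ⟨{w, x}, ?_⟩
      rw [Finset.mem_filter, Finset.mem_powersetCard]
      refine ⟨⟨by grind, Finset.card_pair hxw.symm⟩, ?_⟩
      apply bad_iso (f := w) (by simp) (by grind) hwr
      intro b hb
      rcases Finset.mem_insert.1 hb with rfl | hb
      · exact G.irrefl
      · have : b = x := by simpa using hb
        subst this
        exact hwx
    omega
  · by_cases hyw : G.Adj y w
    · have : 4 ≤ bd G r (insert y X) 2 := by
        have hy1 := dg_one h1 hwX hyw
        have hsub : insert {y, w} ((X.erase w).image (fun z => ({y, z} : Finset V))) ⊆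
            ((insert y X).powersetCard 2).filter (fun J => ¬ Cn G (insert r J)) := by
          intro J hJ
          rw [Finset.mem_filter, Finset.mem_powersetCard]
          rcases Finset.mem_insert.1 hJ with rfl | hJ
          · refine ⟨⟨by grind, Finset.card_pair (by grind)⟩, ?_⟩
            apply bad_miss hrX' _ (by simp)
            intro z hz
            rw [Finset.mem_filter]
            rcases Finset.mem_insert.1 hz with rfl | hz
            · exact ⟨by simp, hr⟩
            · have : z = w := by simpa using hz
              subst this
              exact ⟨by simp [hwX], hwr⟩
          · obtain ⟨z, hz, rfl⟩ := Finset.mem_image.1 hJ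
            rw [Finset.mem_erase] at hz
            refine ⟨⟨by grind, Finset.card_pair (by grind)⟩, ?_⟩
            apply bad_iso (f := y) (by simp) hry hr
            intro b hb
            rcases Finset.mem_insert.1 hb with rfl | hb
            · exact G.irrefl
            · have : b = z := by simpa using hb
              subst this
              intro h
              exact hz.1 (hy1 b hz.2 h)
        have := Finset.card_le_card hsub
        rw [Finset.card_insert_of_notMem, Finset.card_image_of_injOn, Finset.card_erase_of_mem hwX, hX] at this
        · exact this
        · intro z hz z' hz' h
          have hz := Finset.mem_erase.1 hz
          have h : ({y, z} : Finset V) = {y, z'} := h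
          have : z ∈ ({y, z'} : Finset V) := by rw [← h]; simp
          grind
        · intro h
          obtain ⟨z, hz, h⟩ := Finset.mem_image.1 h
          rw [Finset.mem_erase] at hz
          have : z ∈ ({y, w} : Finset V) := by rw [← h]; simp
          grind
      omega
    · obtain ⟨z, hz, hyz⟩ := dg_one_ex (G := G) (X := X) (x := y) (by omega)
      have hzw : z ≠ w := by rintro rfl; exact hyw hyz
      have hz1 : dg G X z = 1 := by
        have q1 := dg_pos' hz hc (by omega)
        have q2 : D G X = dg G X w + (dg G X z + ∑ x ∈ (X.erase w).erase z, dg G X x) := by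
          unfold D
          rw [← Finset.add_sum_erase X _ hwX, ← Finset.add_sum_erase (X.erase w) _ (a := z) (by grind)]
        have q3 : ((X.erase w).erase z).card * 1 ≤ ∑ x ∈ (X.erase w).erase z, dg G X x := by
          rw [← smul_eq_mul]
          apply Finset.card_nsmul_le_sum
          intro x hx
          exact dg_pos' (Finset.mem_of_mem_erase (Finset.mem_of_mem_erase hx)) hc (by omega)
        rw [Finset.card_erase_of_mem (by grind), Finset.card_erase_of_mem hwX] at q3
        omega
      have hins : insert z (X.erase z) = X := Finset.insert_erase hz
      have := LD (G := G) (e := y) (f := z) (Z := X.erase z) (by rwa [hins]) (by simp) hyz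
        (by rwa [hins]) (by rw [dg_erase, hz1]) 2 0 (by rw [Finset.card_erase_of_mem hz, hX])
      rw [hins] at this
      simp only [Nat.choose_zero_right, Nat.reduceAdd] at this
      omega

theorem K3 (m : ℕ) : ∀ (N : ℕ) (r : V) (X : Finset V), X.card = N + 5 → r ∉ X → Cn G X →
    D G X + 2 = 2 * X.card → dg G X r = 3 → K G r X m := by
  intro N
  induction N with
  | zero =>
    intro r X hN hr hc hD h3
    by_cases hL : ∀ y ∈ X, dg G X y = 1 → G.Adj r y
    · obtain ⟨e, he, f, hf, hef, he1, hf2, hrf⟩ := good_leaf hc (by omega) hD h3 hL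
      obtain ⟨hc', hD'⟩ := leaf_facts he hc (by omega) hD he1
      have hfe : f ∈ X.erase e := Finset.mem_erase.2 ⟨hef.ne', hf⟩
      have i1 : insert f ((X.erase e).erase f) = X.erase e := Finset.insert_erase hfe
      have i2 : insert e (X.erase e) = X := Finset.insert_erase he
      have := K3a (G := G) (r := r) (e := e) (f := f) (Z := (X.erase e).erase f) (by simp [i1]) (by simp)
        hef (by rwa [i1, i2]) (by rw [i1, dg_erase, he1])
        (by rw [dg_erase]; have := dg_erase_of_adj he hef.symm; omega) 1 m
        (by rw [Finset.card_erase_of_mem hfe, Finset.card_erase_of_mem he]; omega) hrf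
        (by rw [i1, i2, h3]) (by rwa [i1]) (by rwa [i1])
      rwa [i1, i2] at this
    · push Not at hL
      obtain ⟨y, hy, hy1, hry⟩ := hL
      obtain ⟨hc', hD'⟩ := leaf_facts hy hc (by omega) hD hy1
      have i2 : insert y (X.erase y) = X := Finset.insert_erase hy
      have hcard := Finset.card_erase_of_mem hy
      have hne : r ≠ y := by rintro rfl; exact hr hy
      have hdr := dg_erase_of_not (X := X) hry
      match m with
      | 0 =>
        have := five (G := G) (r := r) (y := y) (X := X.erase y) (by omega) (by simp) hne
          (by simp [hr]) hry (by rw [dg_erase, hy1]) hc' (by omega) (by omega)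
        rwa [i2] at this
      | 1 =>
        have s1 := TL (G := G) 3 (X.erase y) (by omega) hc' (by omega) 2
        have s2 := leaf_sc (G := G) (y := y) (X := X.erase y) (by simp) (by rw [dg_erase, hy1]) 3 2 (by omega)
        have b1 := leaf_bd (G := G) (r := r) (y := y) (X := X.erase y) (by simp) hne hry (by rw [dg_erase, hy1]) 3 1 (by omega)
        have b2 := leaf_bd (G := G) (r := r) (y := y) (X := X.erase y) (by simp) hne hry (by rw [dg_erase, hy1]) 3 2 (by omega)
        rw [i2] at s2 b1 b2
        unfold K
        simp only [show Nat.choose 3 3 = 1 by decide, show Nat.choose 3 2 = 3 by decide,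
          show Nat.choose 3 1 = 3 by decide, Nat.reduceAdd] at *
        omega
      | 2 =>
        have s1 := TL (G := G) 3 (X.erase y) (by omega) hc' (by omega) 3
        have s2 := leaf_sc (G := G) (y := y) (X := X.erase y) (by simp) (by rw [dg_erase, hy1]) 3 3 (by omega)
        have b2 := leaf_bd (G := G) (r := r) (y := y) (X := X.erase y) (by simp) hne hry (by rw [dg_erase, hy1]) 3 3 (by omega)
        rw [i2] at s2 b2
        unfold K
        simp only [show Nat.choose 3 3 = 1 by decide, show Nat.choose 3 4 = 0 by decide,
          Nat.reduceAdd] at *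
        omega
      | m+3 =>
        unfold K
        rw [sc_zero (by omega)]
        omega
  | succ N ih =>
    intro r X hN hr hc hD h3
    by_cases hL : ∀ y ∈ X, dg G X y = 1 → G.Adj r y
    · obtain ⟨e, he, f, hf, hef, he1, hf2, hrf⟩ := good_leaf hc (by omega) hD h3 hL
      obtain ⟨hc', hD'⟩ := leaf_facts he hc (by omega) hD he1
      have hfe : f ∈ X.erase e := Finset.mem_erase.2 ⟨hef.ne', hf⟩
      have i1 : insert f ((X.erase e).erase f) = X.erase e := Finset.insert_erase hfe
      have i2 : insert e (X.erase e) = X := Finset.insert_erase he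
      have := K3a (G := G) (r := r) (e := e) (f := f) (Z := (X.erase e).erase f) (by simp [i1]) (by simp)
        hef (by rwa [i1, i2]) (by rw [i1, dg_erase, he1])
        (by rw [dg_erase]; have := dg_erase_of_adj he hef.symm; omega) (N+2) m
        (by rw [Finset.card_erase_of_mem hfe, Finset.card_erase_of_mem he]; omega) hrf
        (by rw [i1, i2, h3]) (by rwa [i1]) (by rwa [i1])
      rwa [i1, i2] at this
    · push Not at hL
      obtain ⟨y, hy, hy1, hry⟩ := hL
      obtain ⟨hc', hD'⟩ := leaf_facts hy hc (by omega) hD hy1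
      have i2 : insert y (X.erase y) = X := Finset.insert_erase hy
      have hcard := Finset.card_erase_of_mem hy
      have hne : r ≠ y := by rintro rfl; exact hr hy
      have hdr := dg_erase_of_not (X := X) hry
      have k := ih r (X.erase y) (by omega) (by simp [hr]) hc' hD' (by omega)
      have s2 := leaf_sc (G := G) (y := y) (X := X.erase y) (by simp) (by rw [dg_erase, hy1]) (N+4) (m+1) (by omega)
      have b1 := leaf_bd (G := G) (r := r) (y := y) (X := X.erase y) (by simp) hne hry (by rw [dg_erase, hy1]) (N+4) m (by omega)
      have b2 := leaf_bd (G := G) (r := r) (y := y) (X := X.erase y) (by simp) hne hry (by rw [dg_erase, hy1]) (N+4) (m+1) (by omega)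
      rw [i2] at s2 b1 b2
      unfold K at *
      simp only [show m+1+1 = m+2 from rfl, show m+1+2 = m+3 from rfl] at *
      omega

end BC

namespace BC
open Finset
open scoped Classical

variable {V : Type} {G : SimpleGraph V}

theorem all_two {X : Finset V} (hc : Cn G X) (h2 : 2 ≤ X.card) (hD : D G X = 2 * X.card)
    (hcyc : ∀ x ∈ X, Cn G (X.erase x)) : ∀ x ∈ X, dg G X x = 2 := by
  have hle : ∀ x ∈ X, dg G X x ≤ 2 := by
    intro x hx
    have h1 := EB' (hcyc x hx)
    have h3 := D_erase (G := G) hx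
    have h4 := Finset.card_erase_add_one hx
    omega
  have hs : ∑ x ∈ X, dg G X x = ∑ x ∈ X, 2 := by
    rw [Finset.sum_const, smul_eq_mul, mul_comm, ← hD]; rfl
  exact (Finset.sum_eq_sum_iff_of_le hle).1 hs

theorem KC_bd {r f q g h : V} {X : Finset V} (a m : ℕ) (hX : X.card = a + 5) (hr : r ∉ X)
    (h2 : dg G X r = 2) (hf : f ∈ X) (hq : q ∈ X) (hg : g ∈ X) (hh : h ∈ X) (hrf : ¬ G.Adj r f)
    (hrq : G.Adj r q) (hfq : ¬ G.Adj f q) (hfg : G.Adj f g) (hfh : G.Adj f h) (hgh : g ≠ h)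
    (hN : ∀ w ∈ X, G.Adj f w → w = g ∨ w = h) :
    (a+3).choose (m+2) + (a+1).choose m ≤ bd G r X (m+2) := by
  set M := X.filter (fun y => ¬ G.Adj r y) with hM
  have hMc : M.card = a + 3 := by rw [hM, card_miss]; omega
  have hqf : q ≠ f := by rintro rfl; exact hrf hrq
  have hgf : g ≠ f := hfg.ne'
  have hhf : h ≠ f := hfh.ne'
  have hqg : q ≠ g := by rintro rfl; exact hfq hfg
  have hqh : q ≠ h := by rintro rfl; exact hfq hfh
  have hrne : r ≠ f := by rintro rfl; exact hr hf
  set W := X \ {f, q, g, h} with hW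
  have hWc : W.card = a + 1 := by
    rw [hW, Finset.card_sdiff_of_subset (by grind)]
    have : ({f, q, g, h} : Finset V).card = 4 := by
      rw [Finset.card_insert_of_notMem (by grind), Finset.card_insert_of_notMem (by grind),
        Finset.card_pair hgh]
    omega
  have hFc : ({f, q} : Finset V).card = 2 := Finset.card_pair hqf.symm
  have hdFW : Disjoint {f, q} W := by
    rw [Finset.disjoint_left]; intro x hx hxW; grind
  have hdisj : Disjoint (M.powersetCard (m+2)) (fam {f, q} W m) := by
    rw [Finset.disjoint_left]
    intro J hJ hJ'
    obtain ⟨K, hK, hKs, rfl⟩ := mem_fam.1 hJ'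
    have : q ∈ M := (Finset.mem_powersetCard.1 hJ).1 (by simp)
    exact (Finset.mem_filter.1 this).2 hrq
  rw [← hMc, ← hWc, ← card_fam hdFW, ← Finset.card_powersetCard, ← Finset.card_union_of_disjoint hdisj]
  apply Finset.card_le_card
  intro J hJ
  rw [Finset.mem_filter]
  rcases Finset.mem_union.1 hJ with hJ | hJ
  · obtain ⟨h1, h2⟩ := Finset.mem_powersetCard.1 hJ
    rw [Finset.mem_powersetCard]
    refine ⟨⟨h1.trans (Finset.filter_subset _ _), h2⟩, bad_miss hr h1 ?_⟩
    rw [← Finset.card_pos]; omega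
  · refine ⟨fam_sub_powersetCard hdFW (by grind) (by grind) (by omega) hJ, ?_⟩
    obtain ⟨K, hK, hKs, rfl⟩ := mem_fam.1 hJ
    apply bad_iso (f := f) (by simp) hrne hrf
    intro b hb hfb
    rcases Finset.mem_union.1 hb with hb | hb
    · rcases Finset.mem_insert.1 hb with rfl | hb
      · exact G.irrefl hfb
      · have : b = q := by simpa using hb
        exact hfq (this ▸ hfb)
    · have hbW := hK hb
      have := hN b (by grind) hfb
      grind

theorem KC {r : V} {X : Finset V} (a m : ℕ) (hX : X.card = a + 5) (hr : r ∉ X) (hc : Cn G X)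
    (hD : D G X = 2 * X.card) (hcyc : ∀ x ∈ X, Cn G (X.erase x)) (h2 : dg G X r = 2) :
    K G r X m := by
  have hall := all_two hc (by omega) hD hcyc
  have hMc : (X.filter (fun y => ¬ G.Adj r y)).card = a + 3 := by rw [card_miss]; omega
  obtain ⟨f, hf, q, hq, hrf, hrq, hfq⟩ : ∃ f ∈ X, ∃ q ∈ X, ¬ G.Adj r f ∧ G.Adj r q ∧ ¬ G.Adj f q := by
    by_contra hcon
    push Not at hcon
    obtain ⟨p, hp, hrp⟩ := dg_one_ex (G := G) (X := X) (x := r) (by omega)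
    have : (X.filter (fun y => ¬ G.Adj r y)).card ≤ dg G X p := by
      apply Finset.card_le_card
      intro y hy
      rw [Finset.mem_filter] at hy ⊢
      exact ⟨hy.1, (hcon y hy.1 p hp hy.2 hrp).symm⟩
    have := hall p hp
    omega
  obtain ⟨g, h, hgh, hgh'⟩ := Finset.card_eq_two.1 (hall f hf)
  have hg : g ∈ X ∧ G.Adj f g := by
    have : g ∈ X.filter (fun y => G.Adj f y) := by rw [hgh']; simp
    simpa using this
  have hh : h ∈ X ∧ G.Adj f h := by
    have : h ∈ X.filter (fun y => G.Adj f y) := by rw [hgh']; simp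
    simpa using this
  have hN := dg_two (hall f hf) hg.1 hg.2 hh.1 hh.2 hgh
  have b1 := KC_bd a m hX hr h2 hf hq hg.1 hh.1 hrf hrq hfq hg.2 hh.2 hgh hN
  have b2 := bd_b0 (G := G) hr m
  rw [h2, show X.card - 2 = a + 3 by omega] at b2
  have hcard := Finset.card_erase_add_one hf
  have hDe := D_erase (G := G) hf
  have hf2 := hall f hf
  have c1 := hcyc f hf
  have hDX' : D G (X.erase f) + 2 = 2 * (X.erase f).card := by omega
  have s1 := sc_insert (G := G) (r := f) (X := X.erase f) (by simp) (m+2)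
  have s2 := bd_b0 (G := G) (r := f) (X := X.erase f) (by simp) (m+1)
  rw [Finset.insert_erase hf] at s1
  rw [dg_erase, hf2, show (X.erase f).card - 2 = a+2 by omega] at s2
  rw [show (X.erase f).card = a+4 by omega] at s1
  have hgX' : g ∈ X.erase f := Finset.mem_erase.2 ⟨hg.2.ne', hg.1⟩
  have hg1 : dg G (X.erase f) g = 1 := by
    have := dg_erase_of_adj hf hg.2.symm
    have := hall g hg.1
    omega
  obtain ⟨g', hg'X', hgg'⟩ := dg_one_ex (G := G) (X := X.erase f) (x := g) (by omega)
  have hg'X := Finset.mem_of_mem_erase hg'X'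
  have hg'f : ¬ G.Adj g' f := by
    intro hadj
    have e1 := dg_two (hall f hf) hg.1 hg.2 hg'X hadj.symm hgg'.ne
    have e2 := dg_two (hall g hg.1) hf hg.2.symm hg'X hgg' hadj.ne'
    have e3 := dg_two (hall g' hg'X) hf hadj hg.1 hgg'.symm hg.2.ne
    have := hc.2 {f, g, g'} (by grind) (by simp) (by
      intro a ha b hb hab
      simp only [Finset.mem_insert, Finset.mem_singleton] at ha ⊢
      rcases ha with rfl | rfl | rfl
      · have := e1 b hb hab; tauto
      · have := e2 b hb hab; tauto
      · have := e3 b hb hab; tauto)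
    have h3 := Finset.card_le_three (a := f) (b := g) (c := g')
    rw [this] at h3
    omega
  have hg'2 : dg G (X.erase f) g' = 2 := by rw [dg_erase_of_not hg'f]; exact hall g' hg'X
  obtain ⟨c2, hD2⟩ := leaf_facts hgX' c1 (by omega) hDX' hg1
  have hcard2 := Finset.card_erase_add_one hgX'
  have hg'X2 : g' ∈ (X.erase f).erase g := Finset.mem_erase.2 ⟨hgg'.ne', hg'X'⟩
  have hcard3 := Finset.card_erase_add_one hg'X2
  have i1 : insert g' (((X.erase f).erase g).erase g') = (X.erase f).erase g := Finset.insert_erase hg'X2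
  have i2 : insert g ((X.erase f).erase g) = X.erase f := Finset.insert_erase hgX'
  have l1 := LD (G := G) (e := g) (f := g') (Z := ((X.erase f).erase g).erase g') (by simp [i1]) (by simp)
    hgg' (by rw [i1, dg_erase, hg1])
    (by rw [dg_erase]; have := dg_erase_of_adj hgX' hgg'.symm; omega) (a+1) m (by omega)
  rw [i1, i2] at l1
  have t1 := TL (a+2) _ (by omega) c2 hD2 (m+1)
  have p1 : (a+4).choose (m+2) = (a+3).choose (m+1) + (a+3).choose (m+2) := Nat.choose_succ_succ _ _
  unfold K
  simp only [show m+1+1 = m+2 from rfl, show m+1+2 = m+3 from rfl, show m+2+1 = m+3 from rfl] at *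
  omega

end BC

namespace BC
open Finset
open scoped Classical

variable {V : Type} {G : SimpleGraph V}

theorem D_even (X : Finset V) : ∃ c, D G X = 2 * c := by
  induction X using Finset.induction_on with
  | empty => exact ⟨0, by simp [D]⟩
  | insert a s ha ih =>
    obtain ⟨c, hc⟩ := ih
    rw [D_insert ha, hc]
    exact ⟨c + dg G s a, by ring⟩

theorem MX2 {v : V} {X Y : Finset V} (m : ℕ) (hv : v ∉ X) (hYne : Y.Nonempty) (hc : Cn G X)
    (hD : D G X = 2 * X.card) (h2 : dg G X v = 2) :
    sc G X (m+3) ≤ (∑ i ∈ range (m+3), bd G v X i * Y.card.choose (m+2-i)) +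
      (if m = 0 then 1 else 0) := by
  have hcd : 2 ≤ X.card := by
    rw [← h2]; exact Finset.card_le_card (Finset.filter_subset _ _)
  obtain ⟨a, ha⟩ : ∃ a, X.card = a + 2 := ⟨X.card - 2, by omega⟩
  have b1 := bd_b0 (G := G) hv (m+1)
  have b2 := bd_b0 (G := G) hv m
  rw [h2, show X.card - 2 = a by omega] at b1 b2
  have p1 : (a+1).choose (m+2) = a.choose (m+1) + a.choose (m+2) := Nat.choose_succ_succ _ _
  have key : ∀ e, sc G X (m+3) ≤ (a+1).choose (m+2) + e →
      sc G X (m+3) ≤ (∑ i ∈ range (m+3), bd G v X i * Y.card.choose (m+2-i)) + e := by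
    intro e he
    rw [Finset.sum_range_succ, Finset.sum_range_succ]
    have h1 : m+2-(m+2) = 0 := by omega
    have h2 : m+2-(m+1) = 1 := by omega
    rw [h1, h2, Nat.choose_zero_right, Nat.choose_one_right]
    have : bd G v X (m+1) * 1 ≤ bd G v X (m+1) * Y.card := Nat.mul_le_mul_left _ hYne.card_pos
    simp only [show m+1+1 = m+2 from rfl] at *
    omega
  by_cases hcyc : ∀ x ∈ X, Cn G (X.erase x)
  · by_cases h5 : 5 ≤ X.card
    · have := K_sum hYne (KC (X.card - 5) m (by omega) hv hc hD hcyc h2)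
      omega
    · apply key
      have hs := sc_le_choose (G := G) X (m+3)
      refine hs.trans ?_
      rw [ha]
      have : a ≤ 2 := by omega
      match m with
      | 0 => interval_cases a <;> decide
      | 1 => interval_cases a <;> decide
      | m+2 => rw [Nat.choose_eq_zero_of_lt (by omega)]; omega
  · push Not at hcyc
    obtain ⟨x, hx, hcx⟩ := hcyc
    have := UL m (a+1) hx (by omega) hc (by omega) hcx
    apply key
    omega

theorem MX3 {v : V} {X Y : Finset V} (m : ℕ) (hv : v ∉ X) (hYne : Y.Nonempty) (hc : Cn G X)
    (hD : D G X + 2 = 2 * X.card) (h2 : dg G X v = 3) (h6 : 6 ≤ X.card + Y.card) :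
    sc G X (m+3) ≤ (∑ i ∈ range (m+3), bd G v X i * Y.card.choose (m+2-i)) +
      (if m = 0 then 1 else 0) := by
  have hcd : 3 ≤ X.card := by
    rw [← h2]; exact Finset.card_le_card (Finset.filter_subset _ _)
  by_cases h5 : 5 ≤ X.card
  · have := K_sum hYne (K3 m (X.card - 5) v X (by omega) hv hc hD h2)
    omega
  have hs := sc_le_choose (G := G) X (m+3)
  by_cases h3 : X.card = 3
  · match m with
    | 0 => rw [h3] at hs; exact hs.trans (Nat.le_add_left _ _)
    | m+1 => rw [h3, Nat.choose_eq_zero_of_lt (by omega)] at hs; omega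
  have h4 : X.card = 4 := by omega
  have b := bd_b0 (G := G) hv 0
  rw [h2, h4] at b
  have b : 1 ≤ bd G v X 1 := b
  have hsum : bd G v X 1 * Y.card.choose (m+1) ≤ ∑ i ∈ range (m+3), bd G v X i * Y.card.choose (m+2-i) := by
    have := Finset.single_le_sum (f := fun i => bd G v X i * Y.card.choose (m+2-i)) (s := range (m+3))
      (fun i _ => Nat.zero_le _) (a := 1) (by simp)
    simpa using this
  have hsum2 : Y.card.choose (m+1) ≤ bd G v X 1 * Y.card.choose (m+1) := Nat.le_mul_of_pos_left _ b
  have t := TL (G := G) 3 X h4 hc hD (m+1)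
  match m with
  | 0 => simp at hsum hsum2 t ⊢; have : Nat.choose 3 2 = 3 := rfl; omega
  | 1 =>
    have : 0 < Y.card.choose 2 := Nat.choose_pos (by omega)
    simp at hsum hsum2 t ⊢
    omega
  | m+2 => rw [h4, Nat.choose_eq_zero_of_lt (by omega)] at hs; omega

theorem MB (m : ℕ) : ∀ (N : ℕ) (v : V) (X Y : Finset V), X.card = N → v ∉ X → v ∉ Y → Disjoint X Y →
    NA G X Y → Cn G (insert v (X ∪ Y)) → X.Nonempty → Y.Nonempty → 6 ≤ X.card + Y.card →
    D G (insert v X) = 2 * X.card + 4 → D G (insert v Y) = 2 * Y.card →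
    sc G (insert v (X ∪ Y)) (m+3) ≤ (X.card + Y.card).choose (m+2) + (if m = 0 then 1 else 0) := by
  intro N
  induction N using Nat.strong_induction_on with
  | _ N ih =>
  intro v X Y hN hX hY hd hna hc hXne hYne h6 hDX hDY
  have hcY : Cn G (insert v Y) := Cn_left hY hX hna.symm (by rwa [Finset.union_comm])
  have hcX : Cn G (insert v X) := Cn_left hX hY hna hc
  by_cases hCX : Cn G X
  · have e1 := EB' hCX
    have e2 := D_insert (G := G) hX
    have e3 := dg_pos hX hXne hcX
    have hKY := KX m Y.card v Y rfl hY hcY (by omega)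
    rcases (by omega : dg G X v = 1 ∨ dg G X v = 2 ∨ dg G X v = 3) with h1 | h2 | h3
    · obtain ⟨p, hp, hvp⟩ := dg_one_ex e3
      have hu := dg_one h1 hp hvp
      have hpY : p ∉ Y := Finset.disjoint_left.1 hd hp
      have hvp' : p ≠ v := hvp.ne'
      have hcard := Finset.card_erase_add_one hp
      have hset : insert p (X.erase p ∪ insert v Y) = insert v (X ∪ Y) := by
        ext x; simp only [Finset.mem_insert, Finset.mem_union, Finset.mem_erase]
        by_cases hxp : x = p
        · subst hxp; simp [hp]
        · simp [hxp]; tauto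
      have hne : (X.erase p).Nonempty := by
        rw [Finset.nonempty_iff_ne_empty]
        intro h
        have hXp : X = {p} := by rw [← Finset.insert_erase hp, h]; rfl
        rw [hXp] at e2 hDX h1
        rw [hDX, h1] at e2
        simp [D, dg] at e2
        have := Finset.card_filter_le {p} (fun y => G.Adj p y)
        rw [e2] at this
        simp at this
      have hna' : NA G (X.erase p) (insert v Y) := by
        intro a ha b hb hab
        rw [Finset.mem_erase] at ha
        rcases Finset.mem_insert.1 hb with rfl | hb
        · exact ha.1 (hu a ha.2 hab.symm)
        · exact hna a ha.2 b hb hab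
      have hd' : Disjoint (X.erase p) (insert v Y) := by
        rw [Finset.disjoint_left] at hd ⊢
        intro a ha
        have := @hd a
        grind
      have hcv := Finset.card_insert_of_notMem hY
      have hpY' : p ∉ insert v Y := by grind
      have q1 := D_insert_union (by simp) hpY' hd' hna'
      have q2 := D_insert_union hX hY hd hna
      rw [hset, q2, Finset.insert_erase hp] at q1
      have := ih (X.erase p).card (by omega) p (X.erase p) (insert v Y) rfl (by simp) hpY' hd' hna'
        (by rwa [hset]) hne (by simp) (by omega) (by rw [Finset.insert_erase hp]; omega) (by omega)
      rw [hset] at this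
      rwa [show (X.erase p).card + (insert v Y).card = X.card + Y.card by omega] at this
    · exact assemble hX hY hd hna hc hXne m _ (MX2 m hX hYne hCX (by omega) h2) hKY
    · exact assemble hX hY hd hna hc hXne m _ (MX3 m hX hYne hCX (by omega) h3 h6) hKY
  · obtain ⟨A, B, hA, hB, hAB, rfl, hnaAB⟩ := split hXne hCX
    have hvA : v ∉ A := by grind
    have hvB : v ∉ B := by grind
    have hcA := Cn_left hvA hvB hnaAB hcX
    have hcB : Cn G (insert v B) := Cn_left hvB hvA hnaAB.symm (by rwa [Finset.union_comm])
    have hcard := Finset.card_union_of_disjoint hAB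
    have hdis := Finset.disjoint_union_left.1 hd
    have hnaA : NA G A Y := fun a ha b hb => hna a (by simp [ha]) b hb
    have hnaB : NA G B Y := fun a ha b hb => hna a (by simp [ha]) b hb
    have f1 := EB _ v A rfl hvA hcA
    have f2 := EB _ v B rfl hvB hcB
    have f3 := D_insert_union hvA hvB hAB hnaAB
    obtain ⟨c1, g1⟩ := D_even (G := G) (insert v A)
    obtain ⟨c2, g2⟩ := D_even (G := G) (insert v B)
    have hAp := hA.card_pos
    have hBp := hB.card_pos
    have hset1 : A ∪ B ∪ Y = A ∪ (B ∪ Y) := Finset.union_assoc _ _ _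
    have hset2 : A ∪ B ∪ Y = B ∪ (A ∪ Y) := by rw [← Finset.union_assoc, Finset.union_comm A B]
    have dBY := D_insert_union hvB hY hdis.2 hnaB
    have dAY := D_insert_union hvA hY hdis.1 hnaA
    have cBY := Finset.card_union_of_disjoint hdis.2
    have cAY := Finset.card_union_of_disjoint hdis.1
    have nA : NA G A (B ∪ Y) := by
      intro a ha b hb
      rcases Finset.mem_union.1 hb with hb | hb
      · exact hnaAB a ha b hb
      · exact hnaA a ha b hb
    have nB : NA G B (A ∪ Y) := by
      intro a ha b hb
      rcases Finset.mem_union.1 hb with hb | hb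
      · exact hnaAB.symm a ha b hb
      · exact hnaB a ha b hb
    have dA : Disjoint A (B ∪ Y) := Finset.disjoint_union_right.2 ⟨hAB, hdis.1⟩
    have dB : Disjoint B (A ∪ Y) := Finset.disjoint_union_right.2 ⟨hAB.symm, hdis.2⟩
    have vBY : v ∉ B ∪ Y := by grind
    have vAY : v ∉ A ∪ Y := by grind
    rcases (by omega : D G (insert v A) = 2 * A.card + 4 ∨ D G (insert v B) = 2 * B.card + 4 ∨
      (D G (insert v A) = 2 * A.card + 2 ∧ D G (insert v B) = 2 * B.card + 2)) with h | h | h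
    · have := ih A.card (by omega) v A (B ∪ Y) rfl hvA vBY dA nA (by rwa [← hset1]) hA
        (hB.mono Finset.subset_union_left) (by omega) h (by omega)
      rw [← hset1] at this
      rwa [show (A ∪ B).card + Y.card = A.card + (B ∪ Y).card by omega]
    · have := ih B.card (by omega) v B (A ∪ Y) rfl hvB vAY dB nB (by rwa [← hset2]) hB
        (hA.mono Finset.subset_union_left) (by omega) h (by omega)
      rw [← hset2] at this
      rwa [show (A ∪ B).card + Y.card = B.card + (A ∪ Y).card by omega]
    · rw [hset1] at hc ⊢
      have hcBY : Cn G (insert v (B ∪ Y)) := Cn_left vBY hvA nA.symm (by rwa [Finset.union_comm])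
      have k1 := K_sum (Y := B ∪ Y) (hB.mono Finset.subset_union_left)
        (KX m A.card v A rfl hvA hcA (by omega))
      have := assemble hvA vBY dA nA hc hA m 0 k1 (KX m _ v (B ∪ Y) rfl vBY hcBY (by omega))
      rw [show (A ∪ B).card + Y.card = A.card + (B ∪ Y).card by omega]
      omega

theorem MB' (m : ℕ) (v : V) (X Y : Finset V) (hX : v ∉ X) (hY : v ∉ Y) (hd : Disjoint X Y)
    (hna : NA G X Y) (hc : Cn G (insert v (X ∪ Y))) (hXne : X.Nonempty) (hYne : Y.Nonempty)
    (h6 : 6 ≤ X.card + Y.card) (hD : D G (insert v (X ∪ Y)) = 2 * (X.card + Y.card) + 4) :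
    sc G (insert v (X ∪ Y)) (m+3) ≤ (X.card + Y.card).choose (m+2) + (if m = 0 then 1 else 0) := by
  have hcY : Cn G (insert v Y) := Cn_left hY hX hna.symm (by rwa [Finset.union_comm])
  have hcX : Cn G (insert v X) := Cn_left hX hY hna hc
  have f1 := EB _ v X rfl hX hcX
  have f2 := EB _ v Y rfl hY hcY
  have f3 := D_insert_union hX hY hd hna
  obtain ⟨c1, g1⟩ := D_even (G := G) (insert v X)
  obtain ⟨c2, g2⟩ := D_even (G := G) (insert v Y)
  rcases (by omega : D G (insert v X) = 2 * X.card + 4 ∨ D G (insert v Y) = 2 * Y.card + 4 ∨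
      (D G (insert v X) = 2 * X.card + 2 ∧ D G (insert v Y) = 2 * Y.card + 2)) with h | h | h
  · exact MB m _ v X Y rfl hX hY hd hna hc hXne hYne h6 h (by omega)
  · rw [Finset.union_comm] at hc ⊢
    rw [Nat.add_comm X.card]
    exact MB m _ v Y X rfl hY hX hd.symm hna.symm hc hYne hXne (by omega) h (by omega)
  · have k1 := K_sum hYne (KX m X.card v X rfl hX hcX (by omega))
    have := assemble hX hY hd hna hc hXne m 0 k1 (KX m _ v Y rfl hY hcY (by omega))
    omega

end BC

namespace BC
open Finset
open scoped Classical

variable {V : Type} {G : SimpleGraph V}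

theorem connCount_eq [Fintype V] (k : ℕ) : connCount G k = sc G univ k := by
  unfold connCount sc
  rw [Nat.card_eq_fintype_card, Fintype.card_subtype]
  congr 1
  ext S
  simp [Finset.mem_powersetCard]
  exact fun _ => Cn_iff S

theorem D_univ [Fintype V] : D G univ = 2 * G.edgeSet.ncard := by
  have h := G.sum_degrees_eq_twice_card_edges
  rw [← SimpleGraph.coe_edgeFinset, Set.ncard_coe_finset, ← h]
  apply Finset.sum_congr rfl
  intro x _
  unfold dg
  rw [← SimpleGraph.card_neighborFinset_eq_degree, SimpleGraph.neighborFinset_eq_filter]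

theorem sc_two [Fintype V] : sc G univ 2 ≤ G.edgeSet.ncard := by
  rw [← SimpleGraph.coe_edgeFinset, Set.ncard_coe_finset]
  refine le_trans (Finset.card_le_card ?_) (Finset.card_image_le (s := G.edgeFinset) (f := Sym2.toFinset))
  intro S hS
  rw [Finset.mem_filter, Finset.mem_powersetCard] at hS
  obtain ⟨⟨_, h2⟩, hc⟩ := hS
  obtain ⟨a, b, hab, rfl⟩ := Finset.card_eq_two.1 h2
  have hadj : G.Adj a b := by
    obtain ⟨y, hy, hay⟩ := dg_one_ex (dg_pos' (y := a) (by simp) hc (by omega))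
    have : y = b := by
      have := hay.ne'
      simp at hy; tauto
    exact this ▸ hay
  rw [Finset.mem_image]
  refine ⟨s(a, b), by simpa using hadj, ?_⟩
  ext x; simp

theorem star_Cn {r : V} {J : Finset V} (h : ∀ x ∈ J, G.Adj r x) : Cn G (insert r J) := by
  refine ⟨by simp, ?_⟩
  intro T hT hne hcl
  have hr : r ∈ T := by
    obtain ⟨x, hx⟩ := hne
    rcases Finset.mem_insert.1 (hT hx) with rfl | hxJ
    · exact hx
    · exact hcl x hx r (by simp) (h x hxJ).symm
  apply Finset.Subset.antisymm hT
  intro y hy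
  rcases Finset.mem_insert.1 hy with rfl | hyJ
  · exact hr
  · exact hcl r hr y hy (h y hyJ)

theorem lower [Fintype V] (r : V) (hr : ∀ x, x ≠ r → G.Adj r x) (k : ℕ) (E : Finset (Finset V))
    (hE : ∀ S ∈ E, r ∉ S ∧ S.card = k + 1 ∧ Cn G S) :
    (Fintype.card V - 1).choose k + E.card ≤ sc G univ (k+1) := by
  have hc : (univ.erase r).card = Fintype.card V - 1 := by
    rw [Finset.card_erase_of_mem (by simp), Finset.card_univ]
  have hdFW : Disjoint {r} (univ.erase r) := by simp
  have hdisj : Disjoint (fam {r} (univ.erase r) k) E := by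
    rw [Finset.disjoint_left]
    intro J hJ hJ'
    obtain ⟨K, hK, hKs, rfl⟩ := mem_fam.1 hJ
    exact (hE _ hJ').1 (by simp)
  rw [← hc, ← card_fam hdFW, ← Finset.card_union_of_disjoint hdisj]
  apply Finset.card_le_card
  intro J hJ
  rw [Finset.mem_filter]
  rcases Finset.mem_union.1 hJ with hJ | hJ
  · refine ⟨fam_sub_powersetCard hdFW (by simp) (by simp) (by simp; omega) hJ, ?_⟩
    obtain ⟨K, hK, hKs, rfl⟩ := mem_fam.1 hJ
    apply star_Cn
    intro x hx
    exact hr x (Finset.mem_erase.1 (hK hx)).1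
  · rw [Finset.mem_powersetCard]
    exact ⟨⟨by simp, (hE J hJ).2.1⟩, (hE J hJ).2.2⟩

theorem upper [Fintype V] {n : ℕ} (hV : Fintype.card V = n) (hn : 7 ≤ n) (G : SimpleGraph V)
    (hconn : G.Connected) (hedges : G.edgeSet.ncard = n + 1)
    (hcut : ∃ v : V, ¬ (G.induce {u : V | u ≠ v}).Connected) (m : ℕ) :
    sc G univ (m+3) ≤ (n-1).choose (m+2) + (if m = 0 then 1 else 0) := by
  obtain ⟨v, hv⟩ := hcut
  have hset : {u : V | u ≠ v} = ((univ.erase v : Finset V) : Set V) := by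
    ext; simp
  rw [hset, Cn_iff] at hv
  have hcard : (univ.erase v : Finset V).card = n - 1 := by
    rw [Finset.card_erase_of_mem (by simp), Finset.card_univ, hV]
  obtain ⟨X, Y, hX, hY, hd, hU, hna⟩ := split (by rw [← Finset.card_pos]; omega) hv
  have hvX : v ∉ X := by
    intro h; have : v ∈ univ.erase v := hU ▸ Finset.mem_union_left _ h
    simp at this
  have hvY : v ∉ Y := by
    intro h; have : v ∈ univ.erase v := hU ▸ Finset.mem_union_right _ h
    simp at this
  have huniv : insert v (X ∪ Y) = univ := by rw [hU]; exact Finset.insert_erase (by simp)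
  have hc : Cn G univ := by
    rw [← Cn_iff, Finset.coe_univ]
    exact (SimpleGraph.induceUnivIso G).connected_iff.2 hconn
  have hXY := Finset.card_union_of_disjoint hd
  rw [hU, hcard] at hXY
  have hD := D_univ (G := G)
  have := MB' (G := G) m v X Y hvX hvY hd hna (by rwa [huniv]) hX hY (by omega)
    (by rw [huniv, hD]; omega)
  rwa [huniv, ← hXY] at this

theorem lower2 [Fintype V] (r a b c : V) (hr : ∀ x, x ≠ r → G.Adj r x) (hab : G.Adj a b)
    (hac : G.Adj a c) (hra : r ≠ a) (hrb : r ≠ b) (hrc : r ≠ c) (hbc : b ≠ c) :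
    Fintype.card V - 1 + 2 ≤ sc G univ 2 := by
  have := lower r hr 1 {{a, b}, {a, c}} (by
    intro S hS
    rw [Finset.mem_insert, Finset.mem_singleton] at hS
    rcases hS with rfl | rfl
    · exact ⟨by simp [*], Finset.card_pair hab.ne, Cn_pair hab⟩
    · exact ⟨by simp [*], Finset.card_pair hac.ne, Cn_pair hac⟩)
  rw [Finset.card_pair, Nat.choose_one_right] at this
  · exact this
  · intro h
    have : b ∈ ({a, c} : Finset V) := by rw [← h]; simp
    have h1 := hab.ne'
    simp [hbc, h1] at this

theorem lower3 [Fintype V] (r a b c : V) (hr : ∀ x, x ≠ r → G.Adj r x) (hab : G.Adj a b)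
    (hac : G.Adj a c) (hra : r ≠ a) (hrb : r ≠ b) (hrc : r ≠ c) (hbc : b ≠ c) :
    (Fintype.card V - 1).choose 2 + 1 ≤ sc G univ 3 := by
  have := lower r hr 2 {{a, b, c}} (by
    intro S hS
    rw [Finset.mem_singleton] at hS
    subst hS
    refine ⟨by simp [*], ?_, star_Cn ?_⟩
    · rw [Finset.card_insert_of_notMem, Finset.card_pair hbc]
      simp [hab.ne, hac.ne]
    · intro x hx
      rw [Finset.mem_insert, Finset.mem_singleton] at hx
      rcases hx with rfl | rfl
      · exact hab
      · exact hac)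
  rw [Finset.card_singleton] at this
  exact this

theorem Bg_zero {n : ℕ} (hn : 7 ≤ n) (x : Fin n) (hx : x ≠ ⟨0, by omega⟩) :
    (Bgraph n).Adj ⟨0, by omega⟩ x := by
  unfold Bgraph
  rw [SimpleGraph.fromRel_adj]
  exact ⟨hx.symm, Or.inl (Or.inl rfl)⟩

theorem Bg_12 {n : ℕ} (hn : 7 ≤ n) : (Bgraph n).Adj ⟨1, by omega⟩ ⟨2, by omega⟩ := by
  unfold Bgraph
  rw [SimpleGraph.fromRel_adj]
  exact ⟨by simp, Or.inl (Or.inr (Or.inl ⟨rfl, rfl⟩))⟩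

theorem Bg_1n {n : ℕ} (hn : 7 ≤ n) : (Bgraph n).Adj ⟨1, by omega⟩ ⟨n-1, by omega⟩ := by
  unfold Bgraph
  rw [SimpleGraph.fromRel_adj]
  refine ⟨by simp; omega, Or.inr (Or.inr (Or.inr ⟨rfl, rfl⟩))⟩

theorem final (n : ℕ) (hn : 7 ≤ n) (G : SimpleGraph (Fin n))
    (hconn : G.Connected) (hedges : G.edgeSet.ncard = n + 1)
    (hcut : ∃ v : Fin n, ¬ (G.induce {u : Fin n | u ≠ v}).Connected) (k : ℕ) (hk : 1 ≤ k) :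
    connCount G k ≤ connCount (Bgraph n) k := by
  rw [connCount_eq, connCount_eq]
  have hz := Bg_zero hn
  have h12 := Bg_12 hn
  have h1n := Bg_1n hn
  match k with
  | 1 =>
    refine (sc_le_choose _ _).trans ?_
    have : sc (Bgraph n) univ 1 = (univ : Finset (Fin n)).card.choose 1 := by
      unfold sc
      rw [Finset.filter_true_of_mem, Finset.card_powersetCard]
      intro S hS
      obtain ⟨x, rfl⟩ := Finset.card_eq_one.1 (Finset.mem_powersetCard.1 hS).2
      exact Cn_singleton x
    exact this.ge
  | 2 =>
    have h := sc_two (G := G)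
    have := lower2 _ _ _ _ hz h12 h1n (by simp) (by simp) (by simp; omega) (by simp; omega)
    rw [Fintype.card_fin] at this
    omega
  | 3 =>
    have h := upper (Fintype.card_fin n) hn G hconn hedges hcut 0
    have := lower3 _ _ _ _ hz h12 h1n (by simp) (by simp) (by simp; omega) (by simp; omega)
    rw [Fintype.card_fin] at this
    simp only [if_true] at h
    exact h.trans this
  | m+4 =>
    have h := upper (Fintype.card_fin n) hn G hconn hedges hcut (m+1)
    have := lower _ hz (m+3) ∅ (by simp)
    rw [Finset.card_empty, Fintype.card_fin] at this
    simp only [Nat.succ_ne_zero, if_false] at h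
    exact h.trans this

end BC

/-- If `G` is a bicyclic graph of order `n ≥ 7` having a cut vertex (a vertex whose
removal disconnects `G`), then `S_k(G) ≤ S_k(B_n)` for every `k ≥ 1`. -/
theorem connCount_le_Bgraph_of_cutVertex (n : ℕ) (hn : 7 ≤ n) (G : SimpleGraph (Fin n))
    (hconn : G.Connected) (hedges : G.edgeSet.ncard = n + 1)
    (hcut : ∃ v : Fin n, ¬ (G.induce {u : Fin n | u ≠ v}).Connected) :
    ∀ k, 1 ≤ k → connCount G k ≤ connCount (Bgraph n) k := by
  exact fun k hk => BC.final n hn G hconn hedges hcut k hk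
end

section
/- Let G be a bicyclic graph of order n ≥ 8 with no cut vertex (i.e., G is 2-connected; equivalently G is a theta graph G_3(a,b,c) with a+b+c = n−2). Then S_k(G) ≤ S_k(B_n) for every k with k ≠ n−1, and S_{n−1}(G) ≤ S_{n−1}(B_n) + 1. -/
open SimpleGraph

section helpers
set_option linter.unusedSectionVars false
open Finset Relation
open scoped Classical

variable {V : Type} [Fintype V]

/-- neighbours -/
noncomputable def nb (G : SimpleGraph V) (z : V) : Finset V := univ.filter (G.Adj z)


theorem mem_nb {G : SimpleGraph V} {a b : V} : b ∈ nb G a ↔ G.Adj a b := by simp [nb]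

/-- connected finset -/
def Cn (G : SimpleGraph V) (S : Finset V) : Prop :=
  S.Nonempty ∧ ∀ a ∈ S, ∀ b ∈ S, ReflTransGen (fun p q => G.Adj p q ∧ p ∈ S ∧ q ∈ S) a b

theorem cn_iff (G : SimpleGraph V) (S : Finset V) :
    Cn G S ↔ (G.induce (S : Set V)).Connected := by
  constructor
  · rintro ⟨⟨s, hs⟩, h⟩
    rw [SimpleGraph.connected_iff]
    refine ⟨?_, ⟨⟨s, hs⟩⟩⟩
    have key : ∀ a b, ReflTransGen (fun p q => G.Adj p q ∧ p ∈ S ∧ q ∈ S) a b →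
        ∀ (ha : a ∈ S) (hb : b ∈ S),
        (G.induce (S : Set V)).Reachable ⟨a, ha⟩ ⟨b, hb⟩ := by
      intro a b hab
      induction hab with
      | refl => intro _ _; exact SimpleGraph.Reachable.refl _
      | tail _ h2 ih =>
        intro ha hb
        refine (ih ha h2.2.1).trans (SimpleGraph.Adj.reachable ?_)
        exact h2.1
    rintro ⟨a, ha⟩ ⟨b, hb⟩
    exact key a b (h a ha b hb) ha hb
  · intro h
    obtain ⟨⟨s, hs⟩⟩ := h.nonempty
    refine ⟨⟨s, hs⟩, fun a ha b hb => ?_⟩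
    have := (SimpleGraph.reachable_iff_reflTransGen _ _).1 (h.preconnected ⟨a, ha⟩ ⟨b, hb⟩)
    refine ReflTransGen.lift (fun z : (S : Set V) => (z : V)) ?_ _ _ this
    rintro ⟨p, hp⟩ ⟨q, hq⟩ hpq
    exact ⟨hpq, hp, hq⟩

theorem cn_map {G H : SimpleGraph V} {S T : Finset V} (f : V → V)
    (hS : Cn G S) (hf : ∀ a ∈ S, f a ∈ T) (hsurj : ∀ b ∈ T, ∃ a ∈ S, f a = b)
    (hadj : ∀ a ∈ S, ∀ b ∈ S, G.Adj a b → f a = f b ∨ H.Adj (f a) (f b)) : Cn H T := by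
  obtain ⟨⟨s, hs⟩, h⟩ := hS
  refine ⟨⟨f s, hf s hs⟩, fun a ha b hb => ?_⟩
  obtain ⟨a, ha', rfl⟩ := hsurj a ha
  obtain ⟨b, hb', rfl⟩ := hsurj b hb
  refine ReflTransGen.lift' f ?_ _ _ (h a ha' b hb')
  rintro p q ⟨hpq, hp, hq⟩
  rcases hadj p hp q hq hpq with h | h
  · change ReflTransGen _ (f p) (f q)
    rw [h]
  · exact ReflTransGen.single ⟨h, hf p hp, hf q hq⟩

theorem cn_closed {G : SimpleGraph V} {S P : Finset V} (hS : Cn G S) {a b : V} (ha : a ∈ S)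
    (hb : b ∈ S) (haP : a ∈ P) (hP : ∀ p ∈ P, ∀ q ∈ S, G.Adj p q → q ∈ P) : b ∈ P := by
  have := hS.2 a ha b hb
  clear hb
  induction this with
  | refl => exact haP
  | tail _ h2 ih => exact hP _ ih _ h2.2.2 h2.1

theorem cn_edges {G : SimpleGraph V} {S : Finset V} (hS : Cn G S) :
    2 * S.card ≤ (∑ a ∈ S, (nb G a ∩ S).card) + 2 := by
  have hc := (cn_iff G S).1 hS
  have h1 := hc.card_vert_le_card_edgeSet_add_one
  have h2 := (G.induce (S : Set V)).sum_degrees_eq_twice_card_edges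
  have h3 : ∑ v, (G.induce (S : Set V)).degree v = ∑ a ∈ S, (nb G a ∩ S).card := by
    rw [← Finset.sum_coe_sort S]
    refine Finset.sum_congr rfl ?_
    rintro ⟨a, ha⟩ _
    rw [← SimpleGraph.card_neighborFinset_eq_degree]
    refine Finset.card_bij (fun z _ => (z : V)) ?_ ?_ ?_
    · rintro ⟨z, hz⟩ h
      simp at h
      simp [mem_nb, h]
      exact hz
    · intro a _ b _ h; exact Subtype.ext h
    · intro b hb
      simp [mem_nb] at hb
      exact ⟨⟨b, hb.2⟩, by simpa using hb.1, rfl⟩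
  rw [Nat.card_eq_fintype_card, Nat.card_eq_fintype_card] at h1
  rw [SimpleGraph.edgeFinset_card] at h2
  have h4 : Fintype.card (S : Set V) = S.card := by simp
  omega

theorem sum_nb_symm (G : SimpleGraph V) (S T : Finset V) :
    ∑ a ∈ S, (nb G a ∩ T).card = ∑ b ∈ T, (nb G b ∩ S).card := by
  have := Finset.sum_card_bipartiteAbove_eq_sum_card_bipartiteBelow (s := S) (t := T) G.Adj
  convert this using 2
  · congr 1; ext b; simp [mem_nb, Finset.mem_bipartiteAbove, and_comm]
  · congr 1; ext b; simp [mem_nb, Finset.mem_bipartiteBelow, and_comm, G.adj_comm]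

theorem sep_count {G : SimpleGraph V} {U T : Finset V} (hsupp : ∀ a b, G.Adj a b → b ∈ U)
    (hdeg : ∑ a ∈ U, (nb G a).card = 2 * U.card + 2) (hT : T ⊆ U) (hC : Cn G (U \ T)) :
    2 * ∑ b ∈ T, (nb G b).card ≤ (∑ b ∈ T, (nb G b ∩ T).card) + 2 * T.card + 4 := by
  have h1 := cn_edges hC
  have h2 := sum_nb_symm G (U \ T) T
  have hsplit : ∀ a, (nb G a).card = (nb G a ∩ (U \ T)).card + (nb G a ∩ T).card := by
    intro a
    rw [← Finset.card_union_of_disjoint]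
    · congr 1
      ext b
      simp only [mem_union, mem_inter, mem_sdiff, mem_nb]
      have := hsupp a b
      tauto
    · rw [Finset.disjoint_left]
      simp only [mem_inter, mem_sdiff]
      tauto
  have h3 := Finset.sum_sdiff (f := fun a => (nb G a).card) hT
  have h4 : ∑ a ∈ U \ T, (nb G a).card = _ := Finset.sum_congr rfl (fun a _ => hsplit a)
  have h5 : ∑ a ∈ T, (nb G a).card = _ := Finset.sum_congr rfl (fun a _ => hsplit a)
  rw [Finset.sum_add_distrib] at h4 h5
  have h6 := Finset.card_sdiff_add_card_eq_card hT
  omega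

/-- counting -/
noncomputable def cnt (G : SimpleGraph V) (U : Finset V) (k : ℕ) : ℕ :=
  ((U.powersetCard k).filter (Cn G)).card

structure Good (G : SimpleGraph V) (U : Finset V) (u v : V) : Prop where
  supp : ∀ a b, G.Adj a b → b ∈ U
  hu : u ∈ U
  hv : v ∈ U
  ne : u ≠ v
  du : (nb G u).card = 3
  dv : (nb G v).card = 3
  d2 : ∀ z ∈ U, z ≠ u → z ≠ v → (nb G z).card = 2
  conn : Cn G U

theorem Good.sum {G : SimpleGraph V} {U : Finset V} {u v : V} (h : Good G U u v) (f : ℕ → ℕ) :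
    ∑ a ∈ U, f (nb G a).card = (U.card - 2) * f 2 + 2 * f 3 ∧ 2 ≤ U.card := by
  have hsub : {u, v} ⊆ U := by
    intro z; simp only [mem_insert, mem_singleton]; rintro (rfl | rfl)
    exacts [h.hu, h.hv]
  have hc : ({u, v} : Finset V).card = 2 := Finset.card_pair h.ne
  have h1 := Finset.sum_sdiff (f := fun a => f (nb G a).card) hsub
  have h2 : ∑ a ∈ U \ {u, v}, f (nb G a).card = ∑ a ∈ U \ {u, v}, f 2 := by
    refine Finset.sum_congr rfl fun a ha => ?_
    simp only [mem_sdiff, mem_insert, mem_singleton, not_or] at ha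
    rw [h.d2 a ha.1 ha.2.1 ha.2.2]
  rw [Finset.sum_const, Finset.card_sdiff_of_subset hsub, hc, smul_eq_mul] at h2
  rw [h2, Finset.sum_pair h.ne, h.du, h.dv] at h1
  refine ⟨by omega, ?_⟩
  rw [← hc]; exact Finset.card_le_card hsub

/-- 3-sets with a centre -/
noncomputable def stars (G : SimpleGraph V) (U : Finset V) : Finset (Finset V) :=
  U.biUnion fun b => (powersetCard 2 (nb G b)).image (insert b)

theorem Good.stars_le {G : SimpleGraph V} {U : Finset V} {u v : V} (h : Good G U u v) :
    (stars G U).card ≤ U.card + 4 := by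
  refine Finset.card_biUnion_le.trans ?_
  have : ∑ b ∈ U, ((powersetCard 2 (nb G b)).image (insert b)).card
      ≤ ∑ b ∈ U, Nat.choose (nb G b).card 2 := by
    refine Finset.sum_le_sum fun b _ => Finset.card_image_le.trans ?_
    rw [Finset.card_powersetCard]
  refine this.trans ?_
  have := h.sum (fun d => Nat.choose d 2)
  simp [Nat.choose] at this
  omega

theorem mem_stars {G : SimpleGraph V} {U T : Finset V} (hTU : T ⊆ U) (hT : T.card = 3)
    (hs : 4 ≤ ∑ b ∈ T, (nb G b ∩ T).card) : T ∈ stars G U := by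
  have : ∃ b ∈ T, 2 ≤ (nb G b ∩ T).card := by
    by_contra hcon
    push Not at hcon
    have : ∑ b ∈ T, (nb G b ∩ T).card ≤ ∑ b ∈ T, 1 :=
      Finset.sum_le_sum fun b hb => by have := hcon b hb; omega
    simp at this
    omega
  obtain ⟨b, hb, h2⟩ := this
  simp only [stars, mem_biUnion, mem_image, mem_powersetCard]
  have hsub : nb G b ∩ T ⊆ T.erase b := by
    intro z hz
    simp only [mem_inter, mem_nb] at hz
    exact mem_erase.2 ⟨hz.1.ne', hz.2⟩
  have hcard : (T.erase b).card = 2 := by rw [Finset.card_erase_of_mem hb, hT]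
  have heq := Finset.eq_of_subset_of_card_le hsub (by omega)
  refine ⟨b, hTU hb, T.erase b, ⟨?_, hcard⟩, Finset.insert_erase hb⟩
  rw [← heq]; exact Finset.inter_subset_left

theorem Good.cnt3 {G : SimpleGraph V} {U : Finset V} {u v : V} (h : Good G U u v) :
    cnt G U 3 ≤ U.card + 4 := by
  refine (Finset.card_le_card ?_).trans h.stars_le
  intro S hS
  simp only [mem_filter, mem_powersetCard] at hS
  refine mem_stars hS.1.1 hS.1.2 ?_
  have := cn_edges hS.2
  omega

theorem Good.sep {G : SimpleGraph V} {U T : Finset V} {u v : V} (h : Good G U u v)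
    (hT : T ⊆ U) (hC : Cn G (U \ T)) (huv : u ∈ T ∨ v ∈ T) :
    2 * T.card ≤ (∑ b ∈ T, (nb G b ∩ T).card) + 2 := by
  have h1 := h.sum id
  simp only [id] at h1
  have h2 := sep_count h.supp (by omega) hT hC
  have h3 : ∑ b ∈ T, 2 < ∑ b ∈ T, (nb G b).card := by
    refine Finset.sum_lt_sum (fun b hb => ?_) ?_
    · by_cases hbu : b = u
      · subst hbu; rw [h.du]; omega
      by_cases hbv : b = v
      · subst hbv; rw [h.dv]; omega
      rw [h.d2 b (hT hb) hbu hbv]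
    · rcases huv with hh | hh
      · exact ⟨u, hh, by rw [h.du]; omega⟩
      · exact ⟨v, hh, by rw [h.dv]; omega⟩
  simp at h3
  omega

theorem Good.cnt_compl {G : SimpleGraph V} {U : Finset V} {u v : V} (h : Good G U u v) (k t : ℕ)
    (hk : k + t = U.card) (F : Finset (Finset V))
    (hF : ∀ T ⊆ U, T.card = t → (u ∈ T ∨ v ∈ T) → 2 * t ≤ (∑ b ∈ T, (nb G b ∩ T).card) + 2 → T ∈ F) :
    cnt G U k ≤ Nat.choose (U.card - 2) t + F.card := by
  have hsub : {u, v} ⊆ U := by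
    intro z; simp only [mem_insert, mem_singleton]; rintro (rfl | rfl)
    exacts [h.hu, h.hv]
  have hc : (U \ {u, v}).card = U.card - 2 := by
    rw [Finset.card_sdiff_of_subset hsub, Finset.card_pair h.ne]
  rw [← hc, ← Finset.card_powersetCard]
  refine le_trans ?_ (Finset.card_union_le _ _)
  refine Finset.card_le_card_of_injOn (fun S => U \ S) ?_ ?_
  · intro S hS
    simp only [coe_filter, mem_powersetCard, Set.mem_ofPred_eq] at hS
    have hT : (U \ S).card = t := by
      rw [Finset.card_sdiff_of_subset hS.1.1]; omega
    have hss : U \ (U \ S) = S := by rw [sdiff_sdiff_right_self]; exact inf_eq_right.2 hS.1.1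
    simp only [coe_union, Set.mem_union, mem_coe, mem_powersetCard]
    by_cases huv : u ∈ U \ S ∨ v ∈ U \ S
    · right
      refine hF _ Finset.sdiff_subset hT huv ?_
      have := h.sep (T := U \ S) Finset.sdiff_subset (by rw [hss]; exact hS.2) huv
      omega
    · left
      refine ⟨?_, hT⟩
      intro z hz
      push Not at huv
      refine mem_sdiff.2 ⟨(mem_sdiff.1 hz).1, ?_⟩
      simp only [mem_insert, mem_singleton]
      rintro (rfl | rfl)
      exacts [huv.1 hz, huv.2 hz]
  · intro S hS S' hS' heq
    simp only [coe_filter, mem_powersetCard, Set.mem_ofPred_eq] at hS hS'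
    have hss : U \ (U \ S) = S := by rw [sdiff_sdiff_right_self]; exact inf_eq_right.2 hS.1.1
    have hss' : U \ (U \ S') = S' := by rw [sdiff_sdiff_right_self]; exact inf_eq_right.2 hS'.1.1
    simp only at heq
    rw [← hss, heq, hss']

theorem Good.cnt_m3 {G : SimpleGraph V} {U : Finset V} {u v : V} (h : Good G U u v) (k : ℕ)
    (hk : k + 3 = U.card) : cnt G U k ≤ Nat.choose (U.card - 2) 3 + (U.card + 4) := by
  refine (h.cnt_compl k 3 hk (stars G U) ?_).trans (Nat.add_le_add_left h.stars_le _)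
  intro T hT hT3 _ hs
  exact mem_stars hT hT3 (by omega)

theorem Good.cnt_m2 {G : SimpleGraph V} {U : Finset V} {u v : V} (h : Good G U u v) (k : ℕ)
    (hk : k + 2 = U.card) : cnt G U k ≤ Nat.choose (U.card - 2) 2 + 6 := by
  refine (h.cnt_compl k 2 hk ((nb G u).image (fun x => {u, x}) ∪ (nb G v).image (fun x => {v, x}))
    ?_).trans (Nat.add_le_add_left ?_ _)
  · intro T hT hT2 huv hs
    have key : ∀ u ∈ T, T ∈ (nb G u).image (fun x => ({u, x} : Finset V)) := by
      intro u hu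
      obtain ⟨a, b, hab, rfl⟩ := Finset.card_eq_two.1 hT2
      have hadj : G.Adj a b := by
        by_contra hn
        have hn' : ¬ G.Adj b a := fun h => hn h.symm
        rw [Finset.sum_pair hab] at hs
        have h1 : nb G a ∩ {a, b} = ∅ := by
          ext z; simp only [mem_inter, mem_nb, mem_insert, mem_singleton]
          simp only [notMem_empty, iff_false]
          rintro ⟨h, rfl | rfl⟩
          exacts [G.loopless.irrefl _ h, hn h]
        have h2 : nb G b ∩ {a, b} = ∅ := by
          ext z; simp only [mem_inter, mem_nb, mem_insert, mem_singleton]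
          simp only [notMem_empty, iff_false]
          rintro ⟨h, rfl | rfl⟩
          exacts [hn' h, G.loopless.irrefl _ h]
        rw [h1, h2] at hs
        simp at hs
      simp only [mem_insert, mem_singleton] at hu
      simp only [mem_image, mem_nb]
      rcases hu with rfl | rfl
      · exact ⟨b, hadj, rfl⟩
      · exact ⟨a, hadj.symm, Finset.pair_comm _ _⟩
    rcases huv with hh | hh
    · exact mem_union_left _ (key u hh)
    · exact mem_union_right _ (key v hh)
  · refine (Finset.card_union_le _ _).trans ?_
    have h1 := Finset.card_image_le (s := nb G u) (f := fun x => ({u, x} : Finset V))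
    have h2 := Finset.card_image_le (s := nb G v) (f := fun x => ({v, x} : Finset V))
    rw [h.du] at h1
    rw [h.dv] at h2
    omega


theorem nb_pair {G : SimpleGraph V} {z : V} (h : (nb G z).card = 2) :
    ∃ x y, x ≠ y ∧ ∀ t, G.Adj z t ↔ t = x ∨ t = y := by
  obtain ⟨x, y, hxy, he⟩ := Finset.card_eq_two.1 h
  refine ⟨x, y, hxy, fun t => ?_⟩
  rw [← mem_nb, he]; simp

theorem Good.exists_w {G : SimpleGraph V} {U : Finset V} {u v : V} (h : Good G U u v)
    (hm : 8 ≤ U.card) : ∃ w ∈ U, w ≠ u ∧ w ≠ v ∧ ∃ x y, x ≠ y ∧ ¬ G.Adj x y ∧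
      ∀ t, G.Adj w t ↔ t = x ∨ t = y := by
  by_contra hcon
  have tri : ∀ z ∈ U, z ≠ u → z ≠ v → ∃ x y, x ≠ y ∧ G.Adj x y ∧
      ∀ t, G.Adj z t ↔ t = x ∨ t = y := by
    intro z hz hzu hzv
    obtain ⟨x, y, hxy, hh⟩ := nb_pair (h.d2 z hz hzu hzv)
    refine ⟨x, y, hxy, ?_, hh⟩
    by_contra hn
    exact hcon ⟨z, hz, hzu, hzv, x, y, hxy, hn, hh⟩
  have step1 : U \ {u, v} ⊆ nb G u ∪ nb G v := by
    intro z hz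
    simp only [mem_sdiff, mem_insert, mem_singleton, not_or] at hz
    obtain ⟨hz, hzu, hzv⟩ := hz
    obtain ⟨x, y, hxy, hadj, hh⟩ := tri z hz hzu hzv
    simp only [mem_union, mem_nb]
    by_contra hn
    push Not at hn
    have hzx : G.Adj z x := (hh x).2 (Or.inl rfl)
    have hzy : G.Adj z y := (hh y).2 (Or.inr rfl)
    have hxu : x ≠ u := by rintro rfl; exact hn.1 hzx.symm
    have hxv : x ≠ v := by rintro rfl; exact hn.2 hzx.symm
    have hyu : y ≠ u := by rintro rfl; exact hn.1 hzy.symm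
    have hyv : y ≠ v := by rintro rfl; exact hn.2 hzy.symm
    obtain ⟨x1, x2, hx12, _, hx⟩ := tri x (h.supp _ _ hzx) hxu hxv
    obtain ⟨y1, y2, hy12, _, hy⟩ := tri y (h.supp _ _ hzy) hyu hyv
    have hxz := (hx z).1 hzx.symm
    have hxy' := (hx y).1 hadj
    have hyz := (hy z).1 hzy.symm
    have hyx := (hy x).1 hadj.symm
    have hzx' := hzx.ne
    have hzy' := hzy.ne
    have : u ∈ ({x, y, z} : Finset V) := by
      refine cn_closed h.conn hz h.hu (by simp) ?_
      intro p hp q _ hpq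
      simp only [mem_insert, mem_singleton] at hp ⊢
      rcases hp with rfl | rfl | rfl
      · have := (hx q).1 hpq; grind
      · have := (hy q).1 hpq; grind
      · have := (hh q).1 hpq; tauto
    simp only [mem_insert, mem_singleton] at this
    rcases this with h' | h' | h'
    exacts [hxu h'.symm, hyu h'.symm, hzu h'.symm]
  have hsub : {u, v} ⊆ U := by
    intro z; simp only [mem_insert, mem_singleton]; rintro (rfl | rfl)
    exacts [h.hu, h.hv]
  have hc : (U \ {u, v}).card = U.card - 2 := by
    rw [Finset.card_sdiff_of_subset hsub, Finset.card_pair h.ne]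
  have hcu := Finset.card_union_add_card_inter (nb G u) (nb G v)
  have hle := Finset.card_le_card step1
  have hdu := h.du
  have hdv := h.dv
  have heq := Finset.eq_of_subset_of_card_le step1 (by omega)
  have hin : (nb G u ∩ nb G v).card = 0 := by omega
  have hvu : ¬ G.Adj u v := by
    intro hadj
    have : v ∈ U \ {u, v} := by rw [heq]; exact mem_union_left _ (mem_nb.2 hadj)
    simp at this
  have part : ∀ p, G.Adj u p → ∃ q, G.Adj u q ∧ q ≠ p ∧ ∀ t, G.Adj p t ↔ t = u ∨ t = q := by
    intro p hp
    have hpv : p ≠ v := by rintro rfl; exact hvu hp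
    obtain ⟨x, y, hxy, hadj, hh⟩ := tri p (h.supp _ _ hp) hp.ne' hpv
    rcases (hh u).1 hp.symm with rfl | rfl
    · exact ⟨y, hadj, ((hh y).2 (Or.inr rfl)).ne', hh⟩
    · exact ⟨x, hadj.symm, ((hh x).2 (Or.inl rfl)).ne', fun t => by rw [hh]; tauto⟩
  obtain ⟨p, q, r, hpq, hpr, hqr, he⟩ := Finset.card_eq_three.1 hdu
  have hN : ∀ t, G.Adj u t ↔ t = p ∨ t = q ∨ t = r := by
    intro t; rw [← mem_nb, he]; simp
  obtain ⟨p', hp1, hp2, hp3⟩ := part p ((hN p).2 (by simp))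
  obtain ⟨q', hq1, hq2, hq3⟩ := part q ((hN q).2 (by simp))
  obtain ⟨r', hr1, hr2, hr3⟩ := part r ((hN r).2 (by simp))
  have hpp := ((hp3 p').2 (Or.inr rfl)).symm
  have hqq := ((hq3 q').2 (Or.inr rfl)).symm
  have hrr := ((hr3 r').2 (Or.inr rfl)).symm
  have nup : p ≠ u := by rintro rfl; exact G.loopless.irrefl _ ((hN p).2 (by simp))
  have nuq : q ≠ u := by rintro rfl; exact G.loopless.irrefl _ ((hN q).2 (by simp))
  have nur : r ≠ u := by rintro rfl; exact G.loopless.irrefl _ ((hN r).2 (by simp))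
  have e1 := (hN p').1 hp1
  have e2 := (hN q').1 hq1
  have e3 := (hN r').1 hr1
  have f1 : ∀ t, G.Adj p t → t = u ∨ t = p' := fun t => (hp3 t).1
  have f2 : ∀ t, G.Adj q t → t = u ∨ t = q' := fun t => (hq3 t).1
  have f3 : ∀ t, G.Adj r t → t = u ∨ t = r' := fun t => (hr3 t).1
  clear hp3 hq3 hr3 hN part tri hcon
  rcases e1 with rfl | rfl | rfl <;> rcases e2 with rfl | rfl | rfl <;>
    rcases e3 with rfl | rfl | rfl <;> grind

/-- suppress -/
def supr (G : SimpleGraph V) (w x y : V) (hxy : x ≠ y) : SimpleGraph V where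
  Adj a b := (G.Adj a b ∧ a ≠ w ∧ b ≠ w) ∨ (a = x ∧ b = y) ∨ (a = y ∧ b = x)
  symm := ⟨by
    intro a b h
    rcases h with h | h | h
    · exact Or.inl ⟨h.1.symm, h.2.2, h.2.1⟩
    · exact Or.inr (Or.inr ⟨h.2, h.1⟩)
    · exact Or.inr (Or.inl ⟨h.2, h.1⟩)⟩
  loopless := ⟨by
    intro a h
    rcases h with h | h | h
    · exact h.1.ne rfl
    · exact hxy (h.1.symm.trans h.2)
    · exact hxy (h.2.symm.trans h.1)⟩

theorem supp_adj {G : SimpleGraph V} {w x y : V} {hxy : x ≠ y} {a b : V} :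
    (supr G w x y hxy).Adj a b ↔
      (G.Adj a b ∧ a ≠ w ∧ b ≠ w) ∨ (a = x ∧ b = y) ∨ (a = y ∧ b = x) := Iff.rfl

theorem supp_cn1 {G : SimpleGraph V} {w x y : V} {hxy : x ≠ y} {S : Finset V} (hS : Cn G S)
    (hw : w ∉ S) : Cn (supr G w x y hxy) S := by
  refine cn_map id hS (fun a ha => ha) (fun b hb => ⟨b, hb, rfl⟩) ?_
  intro a ha b hb hab
  refine Or.inr (Or.inl ⟨hab, ?_, ?_⟩)
  · rintro rfl; exact hw ha
  · rintro rfl; exact hw hb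

theorem supp_cn2 {G : SimpleGraph V} {w x y : V} {hxy : x ≠ y}
    (hN : ∀ t, G.Adj w t ↔ t = x ∨ t = y) {S : Finset V} (hS : Cn G S)
    (hw : w ∈ S) (h2 : 2 ≤ S.card) : Cn (supr G w x y hxy) (S.erase w) := by
  have hwx : x ≠ w := ((hN x).2 (Or.inl rfl)).ne'
  have hwy : y ≠ w := ((hN y).2 (Or.inr rfl)).ne'
  have hex : ∃ p ∈ S, p = x ∨ p = y := by
    by_contra hcon
    push Not at hcon
    obtain ⟨b, hb, hbw⟩ := Finset.exists_mem_ne (by omega : 1 < S.card) w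
    have : b ∈ ({w} : Finset V) := by
      refine cn_closed hS hw hb (by simp) ?_
      intro p hp q hq hpq
      rw [mem_singleton] at hp
      subst hp
      have := hcon q hq
      have := (hN q).1 hpq
      tauto
    exact hbw (mem_singleton.1 this)
  obtain ⟨p, hpS, hp⟩ := hex
  have hpw : p ≠ w := by rcases hp with rfl | rfl <;> assumption
  refine cn_map (fun a => if a = w then p else a) hS ?_ ?_ ?_
  · intro a ha
    by_cases h : a = w
    · simp [h, hpw, hpS]
    · simp [h, ha]
  · intro b hb
    rw [mem_erase] at hb
    exact ⟨b, hb.2, by simp [hb.1]⟩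
  · intro a ha b hb hab
    by_cases h : a = w
    · subst h
      have hb' := (hN b).1 hab
      have : b ≠ a := hab.ne'
      simp only [supp_adj, if_true, if_neg this]
      grind
    · by_cases h' : b = w
      · subst h'
        have ha' := (hN a).1 hab.symm
        simp only [supp_adj, if_true, if_neg h]
        grind
      · simp only [supp_adj, if_neg h, if_neg h']
        tauto

theorem supp_cnt {G : SimpleGraph V} {w x y : V} {hxy : x ≠ y}
    (hN : ∀ t, G.Adj w t ↔ t = x ∨ t = y) {U : Finset V} (k : ℕ) (hk : 1 ≤ k) :
    cnt G U (k + 1) ≤ cnt (supr G w x y hxy) (U.erase w) (k + 1) +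
      cnt (supr G w x y hxy) (U.erase w) k := by
  unfold cnt
  rw [← Finset.card_filter_add_card_filter_not (s := (U.powersetCard (k+1)).filter (Cn G))
    (fun S => w ∈ S), add_comm]
  refine Nat.add_le_add ?_ ?_
  · refine Finset.card_le_card ?_
    intro S hS
    simp only [mem_filter, mem_powersetCard] at hS ⊢
    refine ⟨⟨fun z hz => mem_erase.2 ⟨?_, hS.1.1.1 hz⟩, hS.1.1.2⟩, supp_cn1 hS.1.2 hS.2⟩
    rintro rfl; exact hS.2 hz
  · refine Finset.card_le_card_of_injOn (fun S => S.erase w) ?_ ?_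
    · intro S hS
      simp only [coe_filter, mem_filter, mem_powersetCard, Set.mem_ofPred_eq] at hS ⊢
      refine ⟨⟨Finset.erase_subset_erase _ hS.1.1.1, ?_⟩, supp_cn2 hN hS.1.2 hS.2 ?_⟩
      · rw [Finset.card_erase_of_mem hS.2]; omega
      · omega
    · intro S hS S' hS' heq
      simp only [coe_filter, mem_filter, mem_powersetCard, Set.mem_ofPred_eq] at hS hS'
      simp only at heq
      rw [← Finset.insert_erase hS.2, heq, Finset.insert_erase hS'.2]

theorem Good.supp_good {G : SimpleGraph V} {U : Finset V} {u v w x y : V} (h : Good G U u v)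
    (hw : w ∈ U) (hwu : w ≠ u) (hwv : w ≠ v) (hxy : x ≠ y) (hna : ¬ G.Adj x y)
    (hN : ∀ t, G.Adj w t ↔ t = x ∨ t = y) : Good (supr G w x y hxy) (U.erase w) u v := by
  have awx : G.Adj w x := (hN x).2 (Or.inl rfl)
  have awy : G.Adj w y := (hN y).2 (Or.inr rfl)
  have hdeg : ∀ z, z ≠ w → (nb (supr G w x y hxy) z).card = (nb G z).card := by
    intro z hz
    by_cases hzx : z = x
    · have : nb (supr G w x y hxy) z = insert y ((nb G z).erase w) := by
        ext t
        simp only [mem_nb, supp_adj, mem_insert, mem_erase]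
        grind
      rw [this, Finset.card_insert_of_notMem, Finset.card_erase_add_one]
      · rw [mem_nb, hzx]; exact awx.symm
      · rw [mem_erase, mem_nb, hzx]; tauto
    by_cases hzy : z = y
    · have : nb (supr G w x y hxy) z = insert x ((nb G z).erase w) := by
        ext t
        simp only [mem_nb, supp_adj, mem_insert, mem_erase]
        grind
      rw [this, Finset.card_insert_of_notMem, Finset.card_erase_add_one]
      · rw [mem_nb, hzy]; exact awy.symm
      · rw [mem_erase, mem_nb, hzy]
        intro hh
        exact hna hh.2.symm
    · congr 1
      ext t
      simp only [mem_nb, supp_adj]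
      have : G.Adj z t → t ≠ w := by
        rintro hh rfl
        have := (hN z).1 hh.symm
        tauto
      tauto
  have hU2 : 2 ≤ U.card := (h.sum id).2
  refine ⟨?_, mem_erase.2 ⟨hwu.symm, h.hu⟩, mem_erase.2 ⟨hwv.symm, h.hv⟩, h.ne, ?_, ?_, ?_,
    supp_cn2 hN h.conn hw hU2⟩
  · intro a b hab
    rw [mem_erase]
    rcases hab with hh | ⟨rfl, rfl⟩ | ⟨rfl, rfl⟩
    · exact ⟨hh.2.2, h.supp _ _ hh.1⟩
    · exact ⟨awy.ne', h.supp _ _ awy⟩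
    · exact ⟨awx.ne', h.supp _ _ awx⟩
  · rw [hdeg u hwu.symm, h.du]
  · rw [hdeg v hwv.symm, h.dv]
  · intro z hz
    rw [mem_erase] at hz
    rw [hdeg z hz.1]
    exact h.d2 z hz.2

theorem Good.reduce {G : SimpleGraph V} {U : Finset V} {u v : V} (h : Good G U u v)
    (hm : 8 ≤ U.card) : ∃ (H : SimpleGraph V) (U' : Finset V), Good H U' u v ∧
      U'.card + 1 = U.card ∧ ∀ k, 1 ≤ k → cnt G U (k + 1) ≤ cnt H U' (k + 1) + cnt H U' k := by
  obtain ⟨w, hw, hwu, hwv, x, y, hxy, hna, hN⟩ := h.exists_w hm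
  exact ⟨supr G w x y hxy, U.erase w, h.supp_good hw hwu hwv hxy hna hN,
    Finset.card_erase_add_one hw, fun k hk => supp_cnt hN k hk⟩

theorem choose_two_succ (n : ℕ) : (n + 1).choose 2 = n + n.choose 2 := by
  rw [Nat.choose_succ_succ' n 1, Nat.choose_one_right]

theorem good_main (m : ℕ) (hm : 8 ≤ m) : ∀ (G : SimpleGraph V) (U : Finset V) (u v : V),
    Good G U u v → U.card = m → ∀ k, 2 ≤ k → k + 3 ≤ m →
      cnt G U (k + 1) ≤ Nat.choose (m - 1) k := by
  have hk2 : ∀ m, 8 ≤ m → ∀ (G : SimpleGraph V) (U : Finset V) (u v : V),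
      Good G U u v → U.card = m → cnt G U 3 ≤ Nat.choose (m - 1) 2 := by
    intro m hm G U u v h hU
    refine h.cnt3.trans ?_
    obtain ⟨j, rfl⟩ := Nat.exists_eq_add_of_le hm
    have e : 8 + j - 1 = j + 4 + 1 + 1 + 1 := by omega
    rw [hU, e, choose_two_succ, choose_two_succ, choose_two_succ]
    omega
  have hkm : ∀ m, 8 ≤ m → ∀ (G : SimpleGraph V) (U : Finset V) (u v : V),
      Good G U u v → U.card = m → ∀ k, k + 3 = m → cnt G U (k + 1) ≤ Nat.choose (m - 1) k := by
    intro m hm G U u v h hU k hk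
    refine (h.cnt_m2 (k + 1) (by omega)).trans ?_
    have e : m - 1 = (m - 2) + 1 := by omega
    have e2 : (m - 1).choose k = (m - 1).choose 2 := by
      apply Nat.choose_symm_of_eq_add; omega
    rw [e2, hU, e, choose_two_succ]
    omega
  induction m, hm using Nat.le_induction with
  | base =>
    intro G U u v h hU k h2 h3
    have hk : k = 2 ∨ k = 3 ∨ k = 4 ∨ k = 5 := by omega
    rcases hk with rfl | rfl | rfl | rfl
    · exact hk2 8 le_rfl G U u v h hU
    · obtain ⟨H, U', hH, hU', hr⟩ := h.reduce (by omega)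
      refine (hr 3 (by omega)).trans ?_
      have e : U'.card = 7 := by omega
      have h1 := hH.cnt3
      have h2 := hH.cnt_m3 4 (by omega)
      rw [e] at h1 h2
      have : Nat.choose (7 - 2) 3 = 10 := by decide
      have : Nat.choose (8 - 1) 3 = 35 := by decide
      simp only [Nat.reduceAdd]
      omega
    · have := h.cnt_m3 5 (by omega)
      rw [hU] at this
      have : Nat.choose (8 - 2) 3 = 20 := by decide
      have : Nat.choose (8 - 1) 4 = 35 := by decide
      simp only [Nat.reduceAdd]
      omega
    · exact hkm 8 le_rfl G U u v h hU 5 rfl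
  | succ m hm ih =>
    intro G U u v h hU k h2 h3
    by_cases e2 : k = 2
    · subst e2; exact hk2 (m + 1) (by omega) G U u v h hU
    by_cases e3 : k + 3 = m + 1
    · exact hkm (m + 1) (by omega) G U u v h hU k e3
    obtain ⟨H, U', hH, hU', hr⟩ := h.reduce (by omega)
    refine (hr k (by omega)).trans ?_
    have a1 := ih H U' u v hH (by omega) k h2 (by omega)
    obtain ⟨j, rfl⟩ : ∃ j, k = j + 1 := ⟨k - 1, by omega⟩
    have a2 := ih H U' u v hH (by omega) j (by omega) (by omega)
    have e : m + 1 - 1 = (m - 1) + 1 := by omega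
    rw [e, Nat.choose_succ_succ' (m - 1) j]
    omega


theorem connCount_eq (G : SimpleGraph V) (k : ℕ) : connCount G k = cnt G univ k := by
  unfold connCount cnt
  rw [Nat.card_eq_fintype_card, Fintype.card_subtype]
  congr 1
  ext S
  simp [cn_iff, mem_powersetCard]

theorem cn_singleton (G : SimpleGraph V) (a : V) : Cn G {a} := by
  refine ⟨⟨a, by simp⟩, ?_⟩
  intro x hx y hy
  rw [mem_singleton] at hx hy
  subst hx; subst hy; exact ReflTransGen.refl

theorem cn_pair {G : SimpleGraph V} {a b : V} (h : G.Adj a b) : Cn G {a, b} := by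
  refine ⟨⟨a, by simp⟩, ?_⟩
  intro x hx y hy
  simp only [mem_insert, mem_singleton] at hx hy
  rcases hx with rfl | rfl <;> rcases hy with rfl | rfl
  · exact ReflTransGen.refl
  · exact ReflTransGen.single ⟨h, by simp, by simp⟩
  · exact ReflTransGen.single ⟨h.symm, by simp, by simp⟩
  · exact ReflTransGen.refl

theorem cn_dom {G : SimpleGraph V} {S : Finset V} {a : V} (ha : a ∈ S)
    (h : ∀ b, b ≠ a → G.Adj a b) : Cn G S := by
  refine ⟨⟨a, ha⟩, ?_⟩
  intro x hx y hy
  refine ReflTransGen.trans (b := a) ?_ ?_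
  · by_cases e : x = a
    · subst e; exact ReflTransGen.refl
    · exact ReflTransGen.single ⟨(h x e).symm, hx, ha⟩
  · by_cases e : y = a
    · subst e; exact ReflTransGen.refl
    · exact ReflTransGen.single ⟨h y e, ha, hy⟩

theorem dom_card (a : V) (k : ℕ) :
    ((powersetCard k (univ.erase a)).image (insert a)).card = (Fintype.card V - 1).choose k := by
  rw [Finset.card_image_of_injOn, Finset.card_powersetCard, Finset.card_erase_of_mem (mem_univ _),
    Finset.card_univ]
  intro S hS T hT hST
  simp only [mem_coe, mem_powersetCard] at hS hT
  have h1 : a ∉ S := fun h => by simpa using hS.1 h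
  have h2 : a ∉ T := fun h => by simpa using hT.1 h
  rw [← Finset.erase_insert h1, hST, Finset.erase_insert h2]

theorem dom_mem {a : V} {k : ℕ} {S : Finset V}
    (h : S ∈ (powersetCard k (univ.erase a)).image (insert a)) : a ∈ S ∧ S.card = k + 1 := by
  rw [mem_image] at h
  obtain ⟨T, hT, rfl⟩ := h
  rw [mem_powersetCard] at hT
  have h2 : a ∉ T := fun h => by simpa using hT.1 h
  exact ⟨by simp, by rw [Finset.card_insert_of_notMem h2, hT.2]⟩

theorem cnt_dom {G : SimpleGraph V} {a : V} (h : ∀ b, b ≠ a → G.Adj a b) (k : ℕ) :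
    (Fintype.card V - 1).choose k ≤ cnt G univ (k + 1) := by
  rw [← dom_card a k]
  refine Finset.card_le_card fun S hS => ?_
  have := dom_mem hS
  simp only [mem_filter, mem_powersetCard, subset_univ, true_and]
  exact ⟨this.2, cn_dom this.1 h⟩

theorem cnt_le_choose (G : SimpleGraph V) (k : ℕ) : cnt G univ k ≤ (Fintype.card V).choose k := by
  unfold cnt
  refine (Finset.card_filter_le _ _).trans ?_
  rw [Finset.card_powersetCard, Finset.card_univ]

theorem cnt_zero (G : SimpleGraph V) : cnt G univ 0 = 0 := by
  unfold cnt
  rw [Finset.card_eq_zero, Finset.filter_eq_empty_iff]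
  intro S hS
  rw [mem_powersetCard, Finset.card_eq_zero] at hS
  rintro ⟨h, -⟩
  rw [hS.2] at h
  simp at h

theorem cnt_one (G : SimpleGraph V) : cnt G univ 1 = Fintype.card V := by
  unfold cnt
  rw [Finset.filter_true_of_mem, Finset.card_powersetCard, Finset.card_univ, Nat.choose_one_right]
  intro S hS
  rw [mem_powersetCard, Finset.card_eq_one] at hS
  obtain ⟨-, a, rfl⟩ := hS
  exact cn_singleton G a

theorem cnt_two (G : SimpleGraph V) : cnt G univ 2 ≤ G.edgeSet.ncard := by
  rw [← SimpleGraph.coe_edgeFinset, Set.ncard_coe_finset]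
  refine le_trans ?_ (Finset.card_image_le (s := G.edgeFinset) (f := fun e => e.toFinset))
  refine Finset.card_le_card fun S hS => ?_
  simp only [mem_filter, mem_powersetCard, subset_univ, true_and] at hS
  obtain ⟨hS2, hC⟩ := hS
  obtain ⟨a, b, hab, rfl⟩ := Finset.card_eq_two.1 hS2
  have hadj : G.Adj a b := by
    by_contra hn
    have : b ∈ ({a} : Finset V) := by
      refine cn_closed hC (a := a) (by simp) (by simp) (by simp) ?_
      intro p hp q hq hpq
      simp only [mem_insert, mem_singleton] at hp hq ⊢
      subst hp
      rcases hq with rfl | rfl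
      · rfl
      · exact absurd hpq hn
    exact hab (mem_singleton.1 this).symm
  rw [mem_image]
  refine ⟨s(a, b), by simpa using hadj, ?_⟩
  ext z; simp

theorem good_of {G : SimpleGraph V} (hn : 8 ≤ Fintype.card V) (hconn : G.Connected)
    (hedges : G.edgeSet.ncard = Fintype.card V + 1)
    (hnocut : ∀ v : V, (G.induce {u : V | u ≠ v}).Connected) : ∃ u v, Good G univ u v := by
  rw [← SimpleGraph.coe_edgeFinset, Set.ncard_coe_finset] at hedges
  have hc : ∀ v, Cn G (univ \ {v}) := by
    intro v
    rw [cn_iff]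
    have : ((univ \ {v} : Finset V) : Set V) = {u : V | u ≠ v} := by ext z; simp
    rw [this]; exact hnocut v
  have hcu : Cn G univ := by
    refine ⟨?_, ?_⟩
    · obtain ⟨a⟩ := hconn.nonempty
      exact ⟨a, mem_univ _⟩
    · intro a _ b _
      have := (SimpleGraph.reachable_iff_reflTransGen _ _).1 (hconn.preconnected a b)
      refine ReflTransGen.mono ?_ _ _ this
      exact fun p q h => ⟨h, mem_univ _, mem_univ _⟩
  have hdeg : ∀ z, (nb G z).card = G.degree z := by
    intro z
    rw [← SimpleGraph.card_neighborFinset_eq_degree]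
    congr 1
    ext t; simp [mem_nb]
  have hsum : ∑ a ∈ (univ : Finset V), (nb G a).card = 2 * (univ : Finset V).card + 2 := by
    have := G.sum_degrees_eq_twice_card_edges
    rw [Finset.sum_congr rfl (fun a _ => hdeg a), this, hedges, Finset.card_univ]; ring
  have hle : ∀ z, (nb G z).card ≤ 3 := by
    intro z
    have := sep_count (fun a b _ => mem_univ b) hsum (subset_univ {z}) (hc z)
    have h0 : nb G z ∩ {z} = ∅ := by
      ext t; simp only [mem_inter, mem_nb, mem_singleton, notMem_empty, iff_false]
      rintro ⟨h, rfl⟩; exact h.ne rfl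
    rw [Finset.sum_singleton, Finset.sum_singleton, h0] at this
    simp at this
    omega
  have hge : ∀ z, 2 ≤ (nb G z).card := by
    intro z
    by_contra hlt
    have hy : ∃ y, y ≠ z ∧ nb G z ⊆ {y} := by
      rcases Finset.eq_empty_or_nonempty (nb G z) with h | ⟨y, hy⟩
      · obtain ⟨y, hy⟩ := Fintype.exists_ne_of_one_lt_card (by omega : 1 < Fintype.card V) z
        exact ⟨y, hy, by rw [h]; simp⟩
      · refine ⟨y, (mem_nb.1 hy).ne', ?_⟩
        intro t ht
        exact mem_singleton.2 (Finset.card_le_one.1 (by omega) t ht y hy)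
    obtain ⟨y, hyz, hsub⟩ := hy
    have : ∃ b, b ∉ ({y, z} : Finset V) := by
      by_contra hcon
      push Not at hcon
      have h1 : (univ : Finset V) ⊆ {y, z} := fun b _ => hcon b
      have h2 := Finset.card_le_card h1
      rw [Finset.card_univ, Finset.card_pair hyz] at h2
      omega
    obtain ⟨b, hb⟩ := this
    simp only [mem_insert, mem_singleton, not_or] at hb
    have : b ∈ ({z} : Finset V) := by
      refine cn_closed (hc y) (a := z) (by simp [hyz.symm]) (by simp [hb.1]) (by simp) ?_
      intro p hp q hq hpq
      rw [mem_singleton] at hp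
      subst hp
      have := hsub (mem_nb.2 hpq)
      simp at this hq
      exact absurd this hq
    exact hb.2 (mem_singleton.1 this)
  have hval : ∀ z, (nb G z).card = 2 + if (nb G z).card = 3 then 1 else 0 := by
    intro z
    have := hle z
    have := hge z
    split_ifs <;> omega
  have h3 : (univ.filter fun z => (nb G z).card = 3).card = 2 := by
    rw [Finset.sum_congr rfl (fun a _ => hval a), Finset.sum_add_distrib, Finset.sum_const,
      ← Finset.card_filter] at hsum
    simp only [smul_eq_mul] at hsum
    omega
  obtain ⟨u, v, huv, he⟩ := Finset.card_eq_two.1 h3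
  have hm : ∀ z, (nb G z).card = 3 ↔ z = u ∨ z = v := by
    intro z
    have : z ∈ (univ.filter fun z => (nb G z).card = 3) ↔ z ∈ ({u, v} : Finset V) := by rw [he]
    simpa using this
  refine ⟨u, v, fun _ b _ => mem_univ b, mem_univ _, mem_univ _, huv, (hm u).2 (Or.inl rfl),
    (hm v).2 (Or.inr rfl), ?_, hcu⟩
  intro z _ hzu hzv
  have := hle z
  have := hge z
  have : (nb G z).card ≠ 3 := fun h => by rcases (hm z).1 h with h | h <;> tauto
  omega

theorem B_dom (n : ℕ) (hn : 8 ≤ n) (b : Fin n) (hb : b ≠ ⟨0, by omega⟩) :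
    (Bgraph n).Adj ⟨0, by omega⟩ b := by
  simp [Bgraph, SimpleGraph.fromRel_adj, hb.symm]

theorem two_lower {G : SimpleGraph V} {o i j l : V} (hdom : ∀ b, b ≠ o → G.Adj o b)
    (hij : G.Adj i j) (hil : G.Adj i l) (hjl : j ≠ l) (hoi : o ≠ i) (hoj : o ≠ j) (hol : o ≠ l) :
    Fintype.card V - 1 + 2 ≤ cnt G univ 2 := by
  have hF := dom_card o 1
  rw [Nat.choose_one_right] at hF
  have h1 : ({i, l} : Finset V) ∉ (powersetCard 1 (univ.erase o)).image (insert o) := by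
    intro h
    have := (dom_mem h).1
    simp [hoi, hol] at this
  have h2 : ({i, j} : Finset V) ∉ insert ({i, l} : Finset V)
      ((powersetCard 1 (univ.erase o)).image (insert o)) := by
    rw [mem_insert, not_or]
    constructor
    · intro h
      have : j ∈ ({i, l} : Finset V) := by rw [← h]; simp
      simp [hij.ne', hjl] at this
    · intro h
      have := (dom_mem h).1
      simp [hoi, hoj] at this
  have : (insert ({i, j} : Finset V) (insert ({i, l} : Finset V)
      ((powersetCard 1 (univ.erase o)).image (insert o)))).card = Fintype.card V - 1 + 2 := by
    rw [Finset.card_insert_of_notMem h2, Finset.card_insert_of_notMem h1, hF]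
  rw [← this]
  refine Finset.card_le_card ?_
  intro S hS
  rw [mem_insert, mem_insert] at hS
  simp only [mem_filter, mem_powersetCard, subset_univ, true_and]
  rcases hS with rfl | rfl | hS
  · exact ⟨Finset.card_pair hij.ne, cn_pair hij⟩
  · exact ⟨Finset.card_pair hil.ne, cn_pair hil⟩
  · have := dom_mem hS
    exact ⟨this.2, cn_dom this.1 hdom⟩

theorem B_two (n : ℕ) (hn : 8 ≤ n) : n + 1 ≤ cnt (Bgraph n) univ 2 := by
  have hij : (Bgraph n).Adj ⟨1, by omega⟩ ⟨2, by omega⟩ := by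
    simp [Bgraph, SimpleGraph.fromRel_adj]
  have hil : (Bgraph n).Adj ⟨1, by omega⟩ ⟨n - 1, by omega⟩ := by
    simp only [Bgraph, SimpleGraph.fromRel_adj]
    refine ⟨?_, by simp⟩
    simp; omega
  have := two_lower (fun b hb => B_dom n hn b hb) hij hil (by simp; omega) (by simp) (by simp)
    (by simp; omega)
  rw [Fintype.card_fin] at this
  omega

theorem final_aux (n : ℕ) (hn : 8 ≤ n) (G : SimpleGraph (Fin n))
    (hconn : G.Connected) (hedges : G.edgeSet.ncard = n + 1)
    (hnocut : ∀ v : Fin n, (G.induce {u : Fin n | u ≠ v}).Connected) :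
    (∀ k, k ≠ n - 1 → connCount G k ≤ connCount (Bgraph n) k) ∧
      connCount G (n - 1) ≤ connCount (Bgraph n) (n - 1) + 1 := by
  obtain ⟨u, v, hgood⟩ := good_of (G := G) (by simpa using hn) hconn (by simpa using hedges) hnocut
  have hB : ∀ k, (n - 1).choose k ≤ cnt (Bgraph n) univ (k + 1) := by
    intro k
    have := cnt_dom (G := Bgraph n) (a := ⟨0, by omega⟩) (fun b hb => B_dom n hn b hb) k
    rwa [Fintype.card_fin] at this
  have hle : ∀ k, cnt G univ k ≤ n.choose k := by
    intro k
    have := cnt_le_choose G k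
    rwa [Fintype.card_fin] at this
  simp only [connCount_eq]
  constructor
  · intro k hk
    rcases k with _ | k
    · rw [cnt_zero]; exact Nat.zero_le _
    by_cases k0 : k = 0
    · subst k0; rw [zero_add, cnt_one, cnt_one]
    by_cases k1 : k = 1
    · subst k1
      refine (cnt_two G).trans ?_
      rw [hedges]; exact B_two n hn
    refine le_trans ?_ (hB k)
    by_cases k2 : k + 3 ≤ n
    · exact good_main n hn G univ u v hgood (by simp) k (by omega) k2
    · refine (hle _).trans ?_
      by_cases k3 : k + 1 = n
      · subst k3; simp
      · rw [Nat.choose_eq_zero_of_lt (by omega)]; exact Nat.zero_le _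
  · have h1 := hle (n - 1)
    have h2 := hB (n - 2)
    obtain ⟨j, rfl⟩ : ∃ j, n = j + 2 := ⟨n - 2, by omega⟩
    have e1 : (j + 2).choose (j + 2 - 1) = j + 2 := by
      have := Nat.choose_succ_self_right (j + 1)
      simpa using this
    have e2 : (j + 2 - 1).choose (j + 2 - 2) = j + 1 := by
      have := Nat.choose_succ_self_right j
      simpa using this
    rw [e1] at h1
    rw [e2] at h2
    have e3 : j + 2 - 2 + 1 = j + 2 - 1 := by omega
    rw [e3] at h2
    omega

end helpers

theorem connCount_theta_le_Bgraph (n : ℕ) (hn : 8 ≤ n) (G : SimpleGraph (Fin n))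
    (hconn : G.Connected) (hedges : G.edgeSet.ncard = n + 1)
    (hnocut : ∀ v : Fin n, (G.induce {u : Fin n | u ≠ v}).Connected) :
    (∀ k, k ≠ n - 1 → connCount G k ≤ connCount (Bgraph n) k) ∧
      connCount G (n - 1) ≤ connCount (Bgraph n) (n - 1) + 1 := by
  exact final_aux n hn G hconn hedges hnocut
end

section
/- There is no uniformly most reliable bicyclic graph with respect to node reliability: for every n ≥ 8, there is no bicyclic graph H of order n such that NRel(G,p) ≤ NRel(H,p) holds for every bicyclic graph G of order n and every p ∈ [0,1]. -/
open SimpleGraph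

/-- The node reliability `NRel(G,p) = Σ_{k=1}^n S_k(G) p^k (1-p)^{n-k}`. -/
noncomputable def NRel {V : Type} (G : SimpleGraph V) (p : ℝ) : ℝ :=
  ∑ k ∈ Finset.Icc 1 (Nat.card V),
    (connCount G k : ℝ) * p ^ k * (1 - p) ^ (Nat.card V - k)

open Finset in
lemma low_coeff (n j : ℕ) (a : ℕ → ℝ) (hj : j ≤ n) (h0 : ∀ k < j, a k = 0)
    (hp : ∀ p : ℝ, 0 ≤ p → p ≤ 1 → 0 ≤ ∑ k ∈ range (n+1), a k * p ^ k * (1 - p) ^ (n - k)) :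
    0 ≤ a j := by
  let g : ℝ → ℝ := fun p => ∑ k ∈ range (n+1), a k * p ^ (k - j) * (1 - p) ^ (n - k)
  have hg : Continuous g := by fun_prop
  have hg0 : g 0 = a j := by
    simp only [g]
    rw [Finset.sum_eq_single j]
    · simp
    · intro k _ hk
      rcases lt_or_gt_of_ne hk with h | h
      · simp [h0 k h]
      · have : k - j ≠ 0 := by omega
        simp [this]
    · intro h; simp at h; omega
  have hpos : ∀ p ∈ Set.Ioo (0:ℝ) 1, 0 ≤ g p := by
    intro p hpp
    have h1 := hp p hpp.1.le hpp.2.le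
    have h2 : ∑ k ∈ range (n+1), a k * p ^ k * (1 - p) ^ (n - k) = p ^ j * g p := by
      simp only [g, Finset.mul_sum]
      refine Finset.sum_congr rfl fun k _ => ?_
      rcases lt_or_ge k j with h | h
      · simp [h0 k h]
      · have : p ^ k = p ^ j * p ^ (k - j) := by rw [← pow_add]; congr 1; omega
        rw [this]; ring
    rw [h2] at h1
    exact nonneg_of_mul_nonneg_right h1 (pow_pos hpp.1 _)
  rw [← hg0]
  have ht : Filter.Tendsto g (nhdsWithin 0 (Set.Ioi 0)) (nhds (g 0)) :=
    (hg.tendsto 0).mono_left nhdsWithin_le_nhds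
  refine ge_of_tendsto ht ?_
  filter_upwards [Ioo_mem_nhdsGT (zero_lt_one' ℝ)] with p hpp using hpos p hpp

open Finset in
lemma high_coeff (n j : ℕ) (a : ℕ → ℝ) (hj : j ≤ n) (h0 : ∀ k, j < k → k ≤ n → a k = 0)
    (hp : ∀ p : ℝ, 0 ≤ p → p ≤ 1 → 0 ≤ ∑ k ∈ range (n+1), a k * p ^ k * (1 - p) ^ (n - k)) :
    0 ≤ a j := by
  have := low_coeff n (n - j) (fun k => a (n - k)) (by omega)
    (fun k hk => h0 _ (by omega) (by omega)) (by
      intro p h1 h2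
      have := hp (1 - p) (by linarith) (by linarith)
      rw [← Finset.sum_range_reflect] at this
      convert this using 1
      refine Finset.sum_congr rfl fun k hk => ?_
      simp at hk
      have e1 : n + 1 - 1 - k = n - k := by omega
      have e2 : n - (n - k) = k := by omega
      rw [e1, e2]; simp; ring)
  simpa [show n - (n - j) = j by omega] using this

open Classical in
lemma connCount_eq_s17 {n : ℕ} (G : SimpleGraph (Fin n)) (k : ℕ) :
    connCount G k = ((Finset.univ.powersetCard k).filter
      fun S : Finset (Fin n) => (G.induce (S : Set (Fin n))).Connected).card := by
  unfold connCount
  rw [Nat.card_eq_fintype_card, Fintype.card_subtype]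
  congr 1
  ext S; simp [Finset.mem_powersetCard]

lemma connCount_le {n : ℕ} (G : SimpleGraph (Fin n)) (k : ℕ) (T : Finset (Finset (Fin n)))
    (h : ∀ S : Finset (Fin n), S.card = k → (G.induce (S : Set (Fin n))).Connected → S ∈ T) :
    connCount G k ≤ T.card := by
  classical
  rw [connCount_eq_s17]
  refine Finset.card_le_card (Finset.subset_iff.2 fun S hS => ?_)
  have h1 := Finset.mem_filter.1 hS
  exact h S (Finset.mem_powersetCard.1 h1.1).2 h1.2

lemma le_connCount {n : ℕ} (G : SimpleGraph (Fin n)) (k : ℕ) (T : Finset (Finset (Fin n)))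
    (h : ∀ S ∈ T, S.card = k ∧ (G.induce (S : Set (Fin n))).Connected) :
    T.card ≤ connCount G k := by
  classical
  rw [connCount_eq_s17]
  refine Finset.card_le_card (Finset.subset_iff.2 fun S hS => ?_)
  exact Finset.mem_filter.2 ⟨Finset.mem_powersetCard.2 ⟨Finset.subset_univ _, (h S hS).1⟩,
    (h S hS).2⟩

lemma connCount_zero {n : ℕ} (G : SimpleGraph (Fin n)) : connCount G 0 = 0 := by
  classical
  rw [connCount_eq_s17, Finset.card_eq_zero, Finset.filter_eq_empty_iff]
  intro S hS h
  simp at hS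
  subst hS
  obtain ⟨x, hx⟩ := h.nonempty
  simp at hx

lemma connCount_one {n : ℕ} (G : SimpleGraph (Fin n)) : connCount G 1 = n := by
  classical
  rw [connCount_eq_s17, Finset.filter_true_of_mem]
  · simp
  · intro S hS
    rw [Finset.mem_powersetCard] at hS
    obtain ⟨a, rfl⟩ := Finset.card_eq_one.1 hS.2
    rw [SimpleGraph.connected_iff_exists_forall_reachable]
    refine ⟨⟨a, by simp⟩, ?_⟩
    rintro ⟨w, hw⟩
    simp at hw
    subst hw
    exact SimpleGraph.Reachable.refl _

lemma exists_nbr {n : ℕ} (G : SimpleGraph (Fin n)) (S : Finset (Fin n))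
    (h : (G.induce (S : Set (Fin n))).Connected) (x y : Fin n) (hx : x ∈ S) (hy : y ∈ S)
    (hxy : x ≠ y) : ∃ z ∈ S, G.Adj x z := by
  have : Nontrivial (S : Set (Fin n)) := ⟨⟨x, hx⟩, ⟨y, hy⟩, by simpa using hxy⟩
  obtain ⟨z, hz⟩ := h.preconnected.exists_adj_of_nontrivial ⟨x, hx⟩
  exact ⟨z.1, z.2, hz⟩

lemma conn_star {n : ℕ} (G : SimpleGraph (Fin n)) (S : Finset (Fin n)) (c : Fin n) (hc : c ∈ S)
    (h : ∀ x ∈ S, x ≠ c → G.Adj c x) : (G.induce (S : Set (Fin n))).Connected := by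
  rw [SimpleGraph.connected_iff_exists_forall_reachable]
  refine ⟨⟨c, hc⟩, ?_⟩
  rintro ⟨w, hw⟩
  by_cases e : w = c
  · subst e; exact SimpleGraph.Reachable.refl _
  · exact SimpleGraph.Adj.reachable (h w hw e)

lemma connCount_two {n : ℕ} (G : SimpleGraph (Fin n)) : connCount G 2 = G.edgeSet.ncard := by
  classical
  have hinj : Function.Injective (Sym2.toFinset : Sym2 (Fin n) → Finset (Fin n)) := by
    intro a b h
    apply Sym2.ext
    intro x
    rw [← Sym2.mem_toFinset, h, Sym2.mem_toFinset]
  rw [connCount_eq_s17, ← Set.ncard_coe_finset, ← Set.ncard_image_of_injective _ hinj]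
  congr 1
  ext S
  simp only [Finset.coe_filter, Finset.mem_powersetCard, Set.mem_ofPred_eq, Set.mem_image]
  constructor
  · rintro ⟨⟨-, h2⟩, hc⟩
    obtain ⟨a, b, hab, rfl⟩ := Finset.card_eq_two.1 h2
    refine ⟨s(a, b), ?_, Sym2.toFinset_mk_eq⟩
    obtain ⟨z, hz, haz⟩ := exists_nbr G _ hc a b (by simp) (by simp) hab
    simp at hz
    rcases hz with rfl | rfl
    · exact absurd haz (G.irrefl)
    · exact haz
  · rintro ⟨e, he, rfl⟩
    induction e with
    | h a b =>
      have hab : G.Adj a b := he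
      rw [Sym2.toFinset_mk_eq]
      refine ⟨⟨Finset.subset_univ _, Finset.card_pair hab.ne⟩, ?_⟩
      apply conn_star G _ a (by simp)
      intro x hx hxa
      simp at hx
      rcases hx with rfl | rfl
      · exact absurd rfl hxa
      · exact hab

lemma connCount_top {n : ℕ} (G : SimpleGraph (Fin n)) (hG : G.Connected) : connCount G n = 1 := by
  classical
  rw [connCount_eq_s17, Finset.filter_true_of_mem]
  · simp
  · intro S hS
    rw [Finset.mem_powersetCard] at hS
    have : S = Finset.univ := Finset.eq_univ_of_card _ (by simp [hS.2])
    subst this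
    rw [Finset.coe_univ]
    exact (SimpleGraph.induceUnivIso G).connected_iff.2 hG

lemma NRel_eq {n : ℕ} (G : SimpleGraph (Fin n)) (p : ℝ) :
    NRel G p = ∑ k ∈ Finset.range (n+1), (connCount G k : ℝ) * p ^ k * (1 - p) ^ (n - k) := by
  unfold NRel
  rw [Nat.card_eq_fintype_card, Fintype.card_fin]
  apply Finset.sum_subset
  · intro k hk; simp at hk ⊢; omega
  · intro k hk hk'
    simp at hk hk'
    have : k = 0 := by by_contra h; have := hk' (by omega); omega
    subst this
    simp [connCount_zero]

lemma conn_all {n : ℕ} (hn : 1 ≤ n) (G : SimpleGraph (Fin n)) :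
    n ≤ connCount G (n-1) ↔
      ∀ v : Fin n, (G.induce ((Finset.univ.erase v : Finset (Fin n)) : Set (Fin n))).Connected := by
  classical
  have hcard : (Finset.powersetCard (n-1) (Finset.univ : Finset (Fin n))).card = n := by
    rw [Finset.card_powersetCard, Finset.card_univ, Fintype.card_fin]
    obtain ⟨m, rfl⟩ : ∃ m, n = m + 1 := ⟨n - 1, by omega⟩
    simp
  rw [connCount_eq_s17]
  constructor
  · intro h v
    have := Finset.eq_of_subset_of_card_le (Finset.filter_subset
      (fun S : Finset (Fin n) => (G.induce (S : Set (Fin n))).Connected)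
      (Finset.univ.powersetCard (n-1))) (by rw [hcard]; exact h)
    rw [Finset.filter_eq_self] at this
    apply this
    simp [Finset.mem_powersetCard]
  · intro h
    rw [Finset.filter_true_of_mem]
    · rw [hcard]
    · intro S hS
      rw [Finset.mem_powersetCard] at hS
      have hc : Sᶜ.card = 1 := by rw [Finset.card_compl, hS.2, Fintype.card_fin]; omega
      obtain ⟨v, hv⟩ := Finset.card_eq_one.1 hc
      have : S = Finset.univ.erase v := by
        rw [← compl_compl S, hv]; ext; simp
      rw [this]; exact h v

lemma three_le {n : ℕ} (H : SimpleGraph (Fin n)) [DecidableRel H.Adj] :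
    connCount H 3 ≤ ∑ v, (H.degree v).choose 2 := by
  classical
  calc _ ≤ (Finset.univ.biUnion fun v : Fin n =>
        ((H.neighborFinset v).powersetCard 2).image (insert v)).card := by
        apply connCount_le
        intro S h3 hc
        obtain ⟨a, b, c, hab, hac, hbc, rfl⟩ := Finset.card_eq_three.1 h3
        have key : ∀ x y z : Fin n, y ≠ z → H.Adj x y → H.Adj x z →
            ({x, y, z} : Finset (Fin n)) ∈ (Finset.univ.biUnion fun v : Fin n =>
              ((H.neighborFinset v).powersetCard 2).image (insert v)) := by
          intro x y z hyz h1 h2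
          simp only [Finset.mem_biUnion, Finset.mem_image, Finset.mem_powersetCard]
          refine ⟨x, Finset.mem_univ _, {y, z}, ⟨?_, Finset.card_pair hyz⟩, rfl⟩
          intro w hw
          simp at hw
          rcases hw with rfl | rfl <;> simpa
        have Ka := key a b c hbc
        have Kb := key b a c hac
        have Kc := key c a b hab
        have eb : ({b, a, c} : Finset (Fin n)) = {a, b, c} := Finset.insert_comm b a _
        have ec : ({c, a, b} : Finset (Fin n)) = {a, b, c} := by
          rw [Finset.insert_comm c a, Finset.pair_comm c b]
        rw [eb] at Kb
        rw [ec] at Kc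
        obtain ⟨x, hx, hax⟩ := exists_nbr H _ hc a b (by simp) (by simp) hab
        obtain ⟨y, hy, hby⟩ := exists_nbr H _ hc b a (by simp) (by simp) hab.symm
        obtain ⟨z, hz, hcz⟩ := exists_nbr H _ hc c a (by simp) (by simp) hac.symm
        have ha : H.Adj a b ∨ H.Adj a c := by
          simp only [Finset.mem_insert, Finset.mem_singleton] at hx
          rcases hx with rfl | rfl | rfl
          · exact absurd hax H.irrefl
          · exact Or.inl hax
          · exact Or.inr hax
        have hb : H.Adj b a ∨ H.Adj b c := by
          simp only [Finset.mem_insert, Finset.mem_singleton] at hy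
          rcases hy with rfl | rfl | rfl
          · exact Or.inl hby
          · exact absurd hby H.irrefl
          · exact Or.inr hby
        have hc' : H.Adj c a ∨ H.Adj c b := by
          simp only [Finset.mem_insert, Finset.mem_singleton] at hz
          rcases hz with rfl | rfl | rfl
          · exact Or.inl hcz
          · exact Or.inr hcz
          · exact absurd hcz H.irrefl
        rcases ha with h | h
        · rcases hc' with h' | h'
          · exact Ka h h'.symm
          · exact Kb h.symm h'.symm
        · rcases hb with h' | h'
          · exact Ka h'.symm h
          · exact Kc h.symm h'.symm
    _ ≤ ∑ v, (((H.neighborFinset v).powersetCard 2).image (insert v)).card :=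
        Finset.card_biUnion_le
    _ ≤ _ := by
        apply Finset.sum_le_sum
        intro v _
        refine Finset.card_image_le.trans ?_
        rw [Finset.card_powersetCard, SimpleGraph.card_neighborFinset_eq_degree]

lemma three_bound {n : ℕ} (hn : 8 ≤ n) (H : SimpleGraph (Fin n)) (hH : H.Connected)
    (he : H.edgeSet.ncard = n + 1) (hall : n ≤ connCount H (n-1)) : connCount H 3 ≤ n + 5 := by
  classical
  rw [conn_all (by omega)] at hall
  have : Nontrivial (Fin n) := Fin.nontrivial_iff_two_le.2 (by omega)
  have hd : ∀ v, 2 ≤ H.degree v := by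
    intro v
    obtain ⟨y, hy⟩ := hH.preconnected.exists_adj_of_nontrivial v
    have h3 : 2 < Fintype.card (Fin n) := by simp; omega
    obtain ⟨w, hw1, hw2⟩ : ∃ w : Fin n, w ≠ v ∧ w ≠ y := by
      obtain ⟨w, hw⟩ : ∃ w, w ∉ ({v, y} : Finset (Fin n)) := by
        by_contra! hcon
        have : (Finset.univ : Finset (Fin n)).card ≤ ({v, y} : Finset (Fin n)).card :=
          Finset.card_le_card (fun x _ => hcon x)
        have := Finset.card_le_two (a := v) (b := y)
        rw [Finset.card_univ] at *
        omega
      simp at hw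
      exact ⟨w, hw⟩
    obtain ⟨z, hz, hvz⟩ := exists_nbr H _ (hall y) v w (by simp [hy.ne]) (by simp [hw2]) hw1.symm
    simp at hz
    rw [← SimpleGraph.card_neighborFinset_eq_degree]
    rw [← Finset.card_pair hz]
    apply Finset.card_le_card
    intro x hx
    simp at hx
    rcases hx with rfl | rfl <;> simpa
  have hs := H.sum_degrees_eq_twice_card_edges
  have he' : H.edgeFinset.card = n + 1 := by
    rw [← he, ← SimpleGraph.coe_edgeFinset, Set.ncard_coe_finset]
  rw [he'] at hs
  have hs2 : ∑ v, (H.degree v - 2) = 2 := by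
    have : ∑ v, (H.degree v - 2) + ∑ v : Fin n, 2 = ∑ v, H.degree v := by
      rw [← Finset.sum_add_distrib]
      exact Finset.sum_congr rfl fun v _ => by have := hd v; omega
    simp at this
    omega
  have hd4 : ∀ v, H.degree v ≤ 4 := by
    intro v
    have := Finset.single_le_sum (f := fun v => H.degree v - 2) (fun _ _ => Nat.zero_le _)
      (Finset.mem_univ v)
    simp only [hs2] at this
    omega
  have hb : ∑ v, 2 * (H.degree v).choose 2 ≤ ∑ v, (2 + 5 * (H.degree v - 2)) := by
    apply Finset.sum_le_sum
    intro v _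
    have h1 := hd v
    have h2 := hd4 v
    interval_cases H.degree v <;> decide
  rw [Finset.sum_add_distrib, ← Finset.mul_sum, ← Finset.mul_sum, hs2] at hb
  simp at hb
  have := three_le H
  omega

lemma theta_exists (n : ℕ) (hn : 8 ≤ n) : ∃ G : SimpleGraph (Fin n), G.Connected ∧
    G.edgeSet.ncard = n + 1 ∧ n ≤ connCount G (n-1) := by
  classical
  obtain ⟨m, rfl⟩ : ∃ m, n = m + 3 := ⟨n - 3, by omega⟩
  refine ⟨cycleGraph (m+3) ⊔ edge ⟨0, by omega⟩ ⟨2, by omega⟩, cycleGraph_connected.mono le_sup_left, ?_, ?_⟩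
  · have h02 : (⟨0, by omega⟩ : Fin (m+3)) ≠ ⟨2, by omega⟩ := by
      simp
    rw [edgeSet_sup, edgeSet_edge_of_ne h02, Set.union_singleton, Set.ncard_insert_of_notMem]
    · congr 1
      have hs := (cycleGraph (m+3)).sum_degrees_eq_twice_card_edges
      simp only [cycleGraph_degree_three_le] at hs
      rw [← SimpleGraph.coe_edgeFinset, Set.ncard_coe_finset]
      simp at hs
      omega
    · rw [mem_edgeSet, cycleGraph_adj']
      rw [Fin.val_sub, Fin.val_sub]
      simp only
      have h1 : (m + 3 - 2 + 0) % (m + 3) = m + 1 := Nat.mod_eq_of_lt (by omega)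
      have h2 : (m + 3 - 0 + 2) % (m + 3) = 2 := by
        rw [Nat.sub_zero, Nat.add_mod_left]; exact Nat.mod_eq_of_lt (by omega)
      rw [h1, h2]
      omega
  · rw [conn_all (by omega)]
    intro v
    rw [SimpleGraph.connected_iff_exists_forall_reachable]
    refine ⟨⟨v + 1, by simp⟩, ?_⟩
    suffices h : ∀ i : ℕ, ∀ hi : i + 1 < m + 3, ∀ hw, SimpleGraph.Reachable
        (((cycleGraph (m+3) ⊔ edge ⟨0, by omega⟩ ⟨2, by omega⟩).induce
          ((Finset.univ.erase v : Finset (Fin (m+3))) : Set (Fin (m+3)))))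
        ⟨v + 1, by simp⟩ ⟨v + ⟨i+1, hi⟩, hw⟩ by
      rintro ⟨w, hw⟩
      have hwv : w ≠ v := by simpa using hw
      have h0 : (w - v).val ≠ 0 := by
        intro h
        apply hwv
        have : w - v = 0 := Fin.ext h
        exact sub_eq_zero.1 this
      have hlt := (w - v).isLt
      have e : v + ⟨(w - v).val - 1 + 1, by omega⟩ = w := by
        have : (⟨(w - v).val - 1 + 1, by omega⟩ : Fin (m+3)) = w - v := by
          apply Fin.ext; simp; omega
        rw [this]; abel
      have := h ((w - v).val - 1) (by omega) (by rw [e]; exact hw)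
      simpa only [e] using this
    intro i
    induction i with
    | zero =>
      intro hi hw
      exact SimpleGraph.Reachable.refl _
    | succ i ih =>
      intro hi hw
      have hw' : v + ⟨i+1, by omega⟩ ∈ ((Finset.univ.erase v : Finset (Fin (m+3))) : Set (Fin (m+3))) := by
        simp [Fin.ext_iff]
      refine (ih (by omega) hw').trans (SimpleGraph.Adj.reachable ?_)
      refine Or.inl ?_
      change (cycleGraph (m+3)).Adj _ _
      rw [cycleGraph_adj']
      right
      have e : (v + ⟨i + 1 + 1, hi⟩) - (v + ⟨i + 1, by omega⟩) =
          (⟨i + 1 + 1, hi⟩ : Fin (m+3)) - ⟨i + 1, by omega⟩ := add_sub_add_left_eq_sub _ _ _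
      refine (congrArg Fin.val e).trans ?_
      rw [Fin.sub_val_of_le (by simp [Fin.le_def])]
      simp

lemma star_exists (n : ℕ) (hn : 8 ≤ n) : ∃ G : SimpleGraph (Fin n), G.Connected ∧
    G.edgeSet.ncard = n + 1 ∧ (n-1).choose 2 ≤ connCount G 3 := by
  classical
  let c : Fin n := ⟨0, by omega⟩
  let E : Finset (Sym2 (Fin n)) := (Finset.univ.erase c).image (fun v => s(c, v))
  let e1 : Sym2 (Fin n) := s(⟨1, by omega⟩, ⟨2, by omega⟩)
  let e2 : Sym2 (Fin n) := s(⟨3, by omega⟩, ⟨4, by omega⟩)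
  let G : SimpleGraph (Fin n) := fromEdgeSet ((insert e1 (insert e2 E) : Finset _) : Set (Sym2 (Fin n)))
  have hadj : ∀ x, x ≠ c → G.Adj c x := by
    intro x hx
    simp only [G, fromEdgeSet_adj]
    refine ⟨?_, hx.symm⟩
    simp only [Finset.coe_insert, Set.mem_insert_iff]
    right; right
    simp only [E, Finset.mem_coe, Finset.mem_image]
    exact ⟨x, by simp [hx], rfl⟩
  refine ⟨G, ?_, ?_, ?_⟩
  · rw [SimpleGraph.connected_iff_exists_forall_reachable]
    refine ⟨c, fun w => ?_⟩
    by_cases e : w = c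
    · subst e; exact SimpleGraph.Reachable.refl _
    · exact SimpleGraph.Adj.reachable (hadj w e)
  · have hE : E.card = n - 1 := by
      rw [Finset.card_image_of_injective, Finset.card_erase_of_mem (Finset.mem_univ _)]
      · simp
      · intro a b h
        exact Sym2.congr_right.1 h
    have h1 : e2 ∉ E := by
      simp [E, e2, c]
    have h2 : e1 ∉ insert e2 E := by
      simp [E, e1, e2, c]
    have h3 : G.edgeSet = ((insert e1 (insert e2 E) : Finset _) : Set (Sym2 (Fin n))) := by
      simp only [G, edgeSet_fromEdgeSet]
      rw [sdiff_eq_left, Set.disjoint_left]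
      intro e he
      simp only [Finset.mem_coe, Finset.mem_insert] at he
      rcases he with rfl | rfl | he
      · simp [e1]
      · simp [e2]
      · simp only [E, Finset.mem_image] at he
        obtain ⟨v, hv, rfl⟩ := he
        simp at hv
        simpa using Ne.symm hv
    rw [h3, Set.ncard_coe_finset, Finset.card_insert_of_notMem h2, Finset.card_insert_of_notMem h1, hE]
    omega
  · have : (n-1).choose 2 = (((Finset.univ.erase c).powersetCard 2).image (insert c)).card := by
      rw [Finset.card_image_of_injOn, Finset.card_powersetCard,
        Finset.card_erase_of_mem (Finset.mem_univ _), Finset.card_univ, Fintype.card_fin]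
      intro a ha b hb hab
      simp only [Finset.mem_coe, Finset.mem_powersetCard] at ha hb
      have ca : c ∉ a := fun h => by simpa using ha.1 h
      have cb : c ∉ b := fun h => by simpa using hb.1 h
      rw [← Finset.erase_insert ca, ← Finset.erase_insert cb]
      exact congrArg (fun s => Finset.erase s c) hab
    rw [this]
    apply le_connCount
    intro S hS
    simp only [Finset.mem_image, Finset.mem_powersetCard] at hS
    obtain ⟨T, ⟨hT, hT2⟩, rfl⟩ := hS
    have ca : c ∉ T := fun h => by simpa using hT h
    refine ⟨by rw [Finset.card_insert_of_notMem ca, hT2], ?_⟩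
    exact conn_star G _ c (by simp) fun x _ hx => hadj x hx

/-- There is no uniformly most reliable bicyclic graph with respect to node reliability:
for every `n ≥ 8` there is no bicyclic graph `H` of order `n` such that
`NRel(G,p) ≤ NRel(H,p)` for every bicyclic graph `G` of order `n` and every `p ∈ [0,1]`. -/
theorem no_umr_bicyclic (n : ℕ) (hn : 8 ≤ n) :
    ¬ ∃ H : SimpleGraph (Fin n), (H.Connected ∧ H.edgeSet.ncard = n + 1) ∧
        ∀ G : SimpleGraph (Fin n), G.Connected → G.edgeSet.ncard = n + 1 →
          ∀ p : ℝ, 0 ≤ p → p ≤ 1 → NRel G p ≤ NRel H p := by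
  rintro ⟨H, ⟨hH, he⟩, hmax⟩
  have hdiff : ∀ G : SimpleGraph (Fin n), G.Connected → G.edgeSet.ncard = n + 1 →
      ∀ p : ℝ, 0 ≤ p → p ≤ 1 → 0 ≤ ∑ k ∈ Finset.range (n+1),
        ((connCount H k : ℝ) - connCount G k) * p ^ k * (1 - p) ^ (n - k) := by
    intro G h1 h2 p h3 h4
    have := hmax G h1 h2 p h3 h4
    rw [NRel_eq, NRel_eq, ← sub_nonneg, ← Finset.sum_sub_distrib] at this
    convert this using 2
    ring
  have hall : n ≤ connCount H (n-1) := by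
    obtain ⟨G, h1, h2, h3⟩ := theta_exists n hn
    have := high_coeff n (n-1) (fun k => (connCount H k : ℝ) - connCount G k) (by omega) (by
      intro k hk1 hk2
      have : k = n := by omega
      subst this
      simp [connCount_top, h1, hH]) (hdiff G h1 h2)
    rw [sub_nonneg] at this
    exact h3.trans (by exact_mod_cast this)
  have hub := three_bound hn H hH he hall
  obtain ⟨G, h1, h2, h3⟩ := star_exists n hn
  have := low_coeff n 3 (fun k => (connCount H k : ℝ) - connCount G k) (by omega) (by
    intro k hk
    interval_cases k
    · simp [connCount_zero]
    · simp [connCount_one]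
    · simp [connCount_two, h2, he]) (hdiff G h1 h2)
  rw [sub_nonneg] at this
  have h4 : connCount G 3 ≤ connCount H 3 := by exact_mod_cast this
  have h5 : n + 5 < (n-1).choose 2 := by
    obtain ⟨m, rfl⟩ : ∃ m, n = m + 8 := ⟨n - 8, by omega⟩
    rw [Nat.choose_two_right, Nat.lt_div_iff_mul_lt (by norm_num)]
    have : m + 8 - 1 - 1 = m + 6 := by omega
    rw [this]
    have : m + 8 - 1 = m + 7 := by omega
    rw [this]
    have : (m+7)*(m+6) = m*m + 13*m + 42 := by ring
    omega
  omega
end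

section
/- Let a, b ≥ 3 with n = a + b − 1 ≥ 7, and let G_1(a,b) be the bicyclic graph obtained by identifying one vertex of a cycle C_a with one vertex of a cycle C_b. Then S_k(G_1(a,b)) ≤ S_k(B_n) for every k ≥ 1. -/
open SimpleGraph

/-- `G₁(a,b)`: the bicyclic graph on `{0,…,a+b−2}` obtained by identifying one vertex of
`C_a` with one vertex of `C_b`: its edges form the cycle `0,1,…,a−1,0` together with the
cycle `0,a,a+1,…,a+b−2,0`. -/
def G1graph (a b : ℕ) : SimpleGraph (Fin (a + b - 1)) :=
  SimpleGraph.fromRel (fun x y =>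
    (y.val = x.val + 1 ∧ y.val ≤ a - 1) ∨ (x.val = a - 1 ∧ y.val = 0) ∨
      (x.val = 0 ∧ y.val = a) ∨ (y.val = x.val + 1 ∧ a ≤ x.val) ∨
      (x.val = a + b - 2 ∧ y.val = 0))

def FF (n : ℕ) (s : Finset ℕ) : Finset (Fin n) := Finset.univ.filter (fun y => y.val ∈ s)

lemma mem_FF {n : ℕ} {s : Finset ℕ} {y : Fin n} : y ∈ FF n s ↔ y.val ∈ s := by simp [FF]

lemma card_FF {n : ℕ} {s : Finset ℕ} (h : ∀ y ∈ s, y < n) : (FF n s).card = s.card := by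
  rw [← Finset.card_map Fin.valEmbedding]
  congr 1
  ext y
  simp only [Finset.mem_map, mem_FF, Fin.valEmbedding_apply]
  constructor
  · rintro ⟨z, hz, rfl⟩; exact hz
  · intro hy; exact ⟨⟨y, h y hy⟩, hy, rfl⟩

lemma FF_inj {n : ℕ} {s t : Finset ℕ} (hs : ∀ y ∈ s, y < n) (ht : ∀ y ∈ t, y < n)
    (h : FF n s = FF n t) : s = t := by
  ext y
  constructor
  · intro hy
    have : (⟨y, hs y hy⟩ : Fin n) ∈ FF n t := by rw [← h]; exact mem_FF.2 hy
    exact mem_FF.1 this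
  · intro hy
    have : (⟨y, ht y hy⟩ : Fin n) ∈ FF n s := by rw [h]; exact mem_FF.2 hy
    exact mem_FF.1 this

lemma conn_boundary {V : Type} {G : SimpleGraph V} {S : Finset V}
    (h : (G.induce (S : Set V)).Connected) (p : V → Prop) {u v : V} (hu : u ∈ S) (hv : v ∈ S)
    (pu : p u) (pv : ¬ p v) : ∃ s ∈ S, ∃ t ∈ S, p s ∧ ¬ p t ∧ G.Adj s t := by
  obtain ⟨w⟩ := h.preconnected ⟨u, hu⟩ ⟨v, hv⟩
  obtain ⟨d, -, h1, h2⟩ := w.exists_boundary_dart {x | p x.1} pu pv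
  exact ⟨d.fst.1, d.fst.2, d.snd.1, d.snd.2, h1, h2, d.adj⟩

lemma conn_center {V : Type} {G : SimpleGraph V} {S : Finset V} (c : V) (hc : c ∈ S)
    (h : ∀ v ∈ S, v ≠ c → G.Adj c v) : (G.induce (S : Set V)).Connected := by
  have key : ∀ v : (S : Set V), (G.induce (S : Set V)).Reachable ⟨c, hc⟩ v := by
    rintro ⟨v, hv⟩
    by_cases e : v = c
    · subst e; exact Reachable.refl _
    · exact SimpleGraph.Adj.reachable (h v hv e)
  have : Nonempty (S : Set V) := ⟨⟨c, hc⟩⟩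
  exact ⟨fun u v => (key u).symm.trans (key v)⟩

lemma B_conn {n : ℕ} {s : Finset ℕ} (c : ℕ) (hc : c ∈ s) (hn : c < n)
    (h : ∀ v ∈ s, v < n → v ≠ c → (c = 0 ∨ (c = 1 ∧ v = 2) ∨ (c = 1 ∧ v = n - 1))) :
    ((Bgraph n).induce (FF n s : Set (Fin n))).Connected := by
  refine conn_center ⟨c, hn⟩ (mem_FF.2 hc) ?_
  intro v hv hne
  rw [mem_FF] at hv
  have hne' : v.val ≠ c := fun e => hne (Fin.ext e)
  have := h v.val hv v.2 hne'
  simp only [Bgraph, SimpleGraph.fromRel_adj]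
  refine ⟨Ne.symm hne, ?_⟩
  omega

lemma G_not_conn {a b : ℕ} {s : Finset ℕ} (hs : ∀ y ∈ s, y < a + b - 1)
    (p : ℕ → Prop) {u v : ℕ} (hu : u ∈ s) (hv : v ∈ s) (pu : p u) (pv : ¬ p v)
    (h : ∀ x ∈ s, ∀ y ∈ s, p x → ¬ p y → x ≠ y →
      ¬ (((y = x + 1 ∧ y ≤ a - 1) ∨ (x = a - 1 ∧ y = 0) ∨
      (x = 0 ∧ y = a) ∨ (y = x + 1 ∧ a ≤ x) ∨ (x = a + b - 2 ∧ y = 0)) ∨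
      ((x = y + 1 ∧ x ≤ a - 1) ∨ (y = a - 1 ∧ x = 0) ∨
      (y = 0 ∧ x = a) ∨ (x = y + 1 ∧ a ≤ y) ∨ (y = a + b - 2 ∧ x = 0)))) :
    ¬ ((G1graph a b).induce (FF (a + b - 1) s : Set (Fin (a + b - 1)))).Connected := by
  intro hc
  obtain ⟨x, hx, y, hy, px, py, hadj⟩ := conn_boundary hc (fun z => p z.val)
    (u := ⟨u, hs u hu⟩) (v := ⟨v, hs v hv⟩) (mem_FF.2 hu) (mem_FF.2 hv) pu pv
  simp only [G1graph, SimpleGraph.fromRel_adj] at hadj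
  exact h x.val (mem_FF.1 hx) y.val (mem_FF.1 hy) px py
    (fun e => hadj.1 (Fin.ext e)) hadj.2

/-- admissible starting points -/
def PP (a b k : ℕ) : Finset ℕ :=
  (Finset.range (a + b - 1)).filter
    (fun x => 1 ≤ x ∧ (x + k ≤ a ∨ (a ≤ x ∧ x + k ≤ a + b - 1)))

lemma mem_PP {a b k x : ℕ} : x ∈ PP a b k ↔
    x < a + b - 1 ∧ 1 ≤ x ∧ (x + k ≤ a ∨ (a ≤ x ∧ x + k ≤ a + b - 1)) := by simp [PP]

lemma G_conn_interval {a b k : ℕ} (ha : 3 ≤ a) (hb : 3 ≤ b) (S : Finset (Fin (a + b - 1)))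
    (hcard : S.card = k) (hc : ((G1graph a b).induce (S : Set (Fin (a + b - 1)))).Connected)
    (h0 : ∀ y ∈ S, y.val ≠ 0) :
    ∃ x ∈ PP a b k, S = FF (a + b - 1) (Finset.Ico x (x + k)) := by
  have hne : S.Nonempty := by
    obtain ⟨⟨v, hv⟩⟩ := hc.nonempty
    exact ⟨v, hv⟩
  obtain ⟨x, hx, hxm⟩ := S.exists_min_image id hne
  obtain ⟨m, hm, hmm⟩ := S.exists_max_image id hne
  simp only [id] at hxm hmm
  have hfull : ∀ y : Fin (a + b - 1), x ≤ y → y ≤ m → y ∈ S := by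
    intro y h1 h2
    by_contra hy
    have e1 : x ≠ y := fun e => hy (e ▸ hx)
    have e2 : m ≠ y := fun e => hy (e ▸ hm)
    obtain ⟨s, hs, t, ht, ps, pt, hadj⟩ := conn_boundary hc (fun z => z < y) hx hm
      (lt_of_le_of_ne h1 e1) (not_lt.2 h2)
    have e3 : t ≠ y := fun e => hy (e ▸ ht)
    have := h0 s hs
    have := h0 t ht
    simp only [G1graph, SimpleGraph.fromRel_adj] at hadj
    have := hadj.2
    have : t.val ≠ y.val := fun e => e3 (Fin.ext e)
    simp only [Fin.lt_def] at ps pt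
    omega
  have hS : S = FF (a + b - 1) (Finset.Ico x.val (m.val + 1)) := by
    ext y
    rw [mem_FF, Finset.mem_Ico]
    constructor
    · intro hy
      have h1 := hxm y hy
      have h2 := hmm y hy
      simp only [Fin.le_def] at h1 h2
      omega
    · intro hy
      exact hfull y (Fin.le_def.2 (by omega)) (Fin.le_def.2 (by omega))
  have hxm' : x.val ≤ m.val := Fin.le_def.1 (hxm m hm)
  have hk : k = m.val + 1 - x.val := by
    rw [← hcard]
    conv_lhs => rw [hS]
    rw [card_FF, Nat.card_Ico]
    intro y hy
    rw [Finset.mem_Ico] at hy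
    omega
  have hxk : x.val + k = m.val + 1 := by omega
  refine ⟨x.val, ?_, by rw [hxk]; exact hS⟩
  rw [mem_PP]
  have := h0 x hx
  have := x.2
  have := m.2
  refine ⟨x.2, by omega, ?_⟩
  by_contra hcon
  obtain ⟨s, hs, t, ht, ps, pt, hadj⟩ := conn_boundary hc (fun z => z.val < a) hx hm
      (by omega) (by omega)
  have := h0 s hs
  have := h0 t ht
  simp only [G1graph, SimpleGraph.fromRel_adj] at hadj
  have := hadj.2
  omega

lemma main_count {a b k : ℕ} (ha : 3 ≤ a) (hb : 3 ≤ b) (g : ℕ → Finset ℕ)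
    (hlt : ∀ x ∈ PP a b k, ∀ y ∈ g x, y < a + b - 1)
    (hcard : ∀ x ∈ PP a b k, (g x).card = k)
    (hB : ∀ x ∈ PP a b k,
      ((Bgraph (a + b - 1)).induce (FF (a + b - 1) (g x) : Set (Fin (a + b - 1)))).Connected)
    (hG : ∀ x ∈ PP a b k, 0 ∉ g x ∨
      ¬ ((G1graph a b).induce (FF (a + b - 1) (g x) : Set (Fin (a + b - 1)))).Connected)
    (hinj : ∀ x ∈ PP a b k, ∀ y ∈ PP a b k, g x = g y → x = y) :
    connCount (G1graph a b) k ≤ connCount (Bgraph (a + b - 1)) k := by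
  classical
  unfold connCount
  rw [Nat.card_eq_fintype_card, Nat.card_eq_fintype_card, Fintype.card_subtype,
    Fintype.card_subtype]
  let z : Fin (a + b - 1) := ⟨0, by omega⟩
  let A : Finset (Finset (Fin (a + b - 1))) := Finset.univ.filter (fun S =>
    (S.card = k ∧ ((G1graph a b).induce (S : Set (Fin (a + b - 1)))).Connected) ∧ z ∈ S)
  calc _ ≤ (A ∪ (PP a b k).image (fun x => FF (a + b - 1) (Finset.Ico x (x + k)))).card := by
        apply Finset.card_le_card
        intro S hS
        rw [Finset.mem_filter] at hS
        rw [Finset.mem_union]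
        by_cases hz : z ∈ S
        · left
          exact Finset.mem_filter.2 ⟨Finset.mem_univ _, hS.2, hz⟩
        · right
          obtain ⟨x, hx, e⟩ := G_conn_interval ha hb S hS.2.1 hS.2.2
            (fun y hy e => hz (by
              have : y = z := Fin.ext e
              exact this ▸ hy))
          exact Finset.mem_image.2 ⟨x, hx, e.symm⟩
    _ ≤ A.card + (PP a b k).card :=
        (Finset.card_union_le _ _).trans (Nat.add_le_add_left Finset.card_image_le _)
    _ = A.card + ((PP a b k).image (fun x => FF (a + b - 1) (g x))).card := by
        rw [Finset.card_image_of_injOn]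
        intro x hx y hy e
        exact hinj x hx y hy (FF_inj (hlt x hx) (hlt y hy) e)
    _ = (A ∪ (PP a b k).image (fun x => FF (a + b - 1) (g x))).card := by
        rw [Finset.card_union_of_disjoint]
        rw [Finset.disjoint_left]
        intro S hS hS'
        obtain ⟨x, hx, rfl⟩ := Finset.mem_image.1 hS'
        have h := (Finset.mem_filter.1 hS).2
        rcases hG x hx with h1 | h1
        · exact h1 (mem_FF.1 h.2)
        · exact h1 h.1.2
    _ ≤ _ := by
        apply Finset.card_le_card
        intro S hS
        rw [Finset.mem_filter]
        refine ⟨Finset.mem_univ _, ?_⟩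
        rcases Finset.mem_union.1 hS with h | h
        · have h := (Finset.mem_filter.1 h).2
          refine ⟨h.1.1, conn_center z h.2 ?_⟩
          intro v _ hv
          simp only [Bgraph, SimpleGraph.fromRel_adj]
          exact ⟨Ne.symm hv, Or.inl (Or.inl rfl)⟩
        · obtain ⟨x, hx, rfl⟩ := Finset.mem_image.1 h
          exact ⟨(card_FF (hlt x hx)).trans (hcard x hx), hB x hx⟩

lemma case1 {a b : ℕ} (ha : 3 ≤ a) (hb : 3 ≤ b) :
    connCount (G1graph a b) 1 ≤ connCount (Bgraph (a + b - 1)) 1 := by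
  refine main_count ha hb (fun x => {x}) ?_ ?_ ?_ ?_ ?_
  · intro x hx y hy
    rw [mem_PP] at hx
    rw [Finset.mem_singleton] at hy
    omega
  · intro x hx; simp
  · intro x hx
    rw [mem_PP] at hx
    refine B_conn x (by simp) hx.1 ?_
    intro v hv _ hne
    exact absurd (Finset.mem_singleton.1 hv) hne
  · intro x hx
    rw [mem_PP] at hx
    left
    rw [Finset.mem_singleton]
    omega
  · intro x _ y _ h
    exact Finset.singleton_injective h

lemma case2 {a b : ℕ} (ha : 3 ≤ a) (hb : 3 ≤ b) (hn : 7 ≤ a + b - 1) :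
    connCount (G1graph a b) 2 ≤ connCount (Bgraph (a + b - 1)) 2 := by
  refine main_count ha hb
    (fun x => if x = 1 then {1, 2} else if x = a then {1, a + b - 2} else {0, x}) ?_ ?_ ?_ ?_ ?_
  · intro x hx y hy
    rw [mem_PP] at hx
    split_ifs at hy <;> simp only [Finset.mem_insert, Finset.mem_singleton] at hy <;> omega
  · intro x hx
    rw [mem_PP] at hx
    split_ifs <;> apply Finset.card_pair <;> omega
  · intro x hx
    rw [mem_PP] at hx
    rcases (by tauto : x = 1 ∨ (x ≠ 1 ∧ x = a) ∨ (x ≠ 1 ∧ x ≠ a)) with c1 | ⟨c1, c2⟩ | ⟨c1, c2⟩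
    · rw [if_pos c1]
      refine B_conn 1 (by simp) (by omega) ?_
      intro v hv _ _
      simp only [Finset.mem_insert, Finset.mem_singleton] at hv
      omega
    · rw [if_neg c1, if_pos c2]
      refine B_conn 1 (by simp) (by omega) ?_
      intro v hv _ _
      simp only [Finset.mem_insert, Finset.mem_singleton] at hv
      omega
    · rw [if_neg c1, if_neg c2]
      exact B_conn 0 (by simp) (by omega) (fun _ _ _ _ => Or.inl rfl)
  · intro x hx
    rw [mem_PP] at hx
    rcases (by tauto : x = 1 ∨ (x ≠ 1 ∧ x = a) ∨ (x ≠ 1 ∧ x ≠ a)) with c1 | ⟨c1, c2⟩ | ⟨c1, c2⟩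
    · rw [if_pos c1]
      left; simp
    · rw [if_neg c1, if_pos c2]
      left
      simp only [Finset.mem_insert, Finset.mem_singleton]
      omega
    · rw [if_neg c1, if_neg c2]
      right
      refine G_not_conn ?_ (fun y => y = x) (u := x) (v := 0) (by simp) (by simp) rfl (by omega) ?_
      · intro y hy
        simp only [Finset.mem_insert, Finset.mem_singleton] at hy
        omega
      · intro u hu v hv pu pv
        simp only [Finset.mem_insert, Finset.mem_singleton] at hu hv
        omega
  · intro x hx y hy h
    rw [mem_PP] at hx hy
    have h1 := Finset.ext_iff.1 h
    have i1 := h1 1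
    have i2 := h1 2
    have i3 := h1 x
    have i4 := h1 y
    have i5 := h1 0
    clear h h1
    by_cases x1 : x = 1 <;> by_cases xa : x = a <;> by_cases y1 : y = 1 <;> by_cases ya : y = a <;>
      simp only [x1, xa, y1, ya, if_true, if_false, Finset.mem_insert, Finset.mem_singleton,
        Finset.mem_Ico] at i1 i2 i3 i4 i5 <;> grind

lemma case3 {a b k : ℕ} (ha : 3 ≤ a) (hb : 3 ≤ b) (hk : 3 ≤ k) :
    connCount (G1graph a b) k ≤ connCount (Bgraph (a + b - 1)) k := by
  refine main_count ha hb
    (fun x => if x = 1 then insert 0 (insert a (Finset.Ico 2 k))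
      else if x = a then insert 0 (insert 1 (Finset.Ico (a + 1) (a + k - 1)))
      else insert 0 (Finset.Ico x (x + k - 1))) ?_ ?_ ?_ ?_ ?_
  · intro x hx y hy
    rw [mem_PP] at hx
    split_ifs at hy <;> simp only [Finset.mem_insert, Finset.mem_Ico] at hy <;> omega
  · intro x hx
    rw [mem_PP] at hx
    rcases (by tauto : x = 1 ∨ (x ≠ 1 ∧ x = a) ∨ (x ≠ 1 ∧ x ≠ a)) with c1 | ⟨c1, c2⟩ | ⟨c1, c2⟩
    · rw [if_pos c1]
      rw [Finset.card_insert_of_notMem, Finset.card_insert_of_notMem, Nat.card_Ico]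
      · omega
      all_goals simp only [Finset.mem_insert, Finset.mem_Ico]; omega
    · rw [if_neg c1, if_pos c2]
      rw [Finset.card_insert_of_notMem, Finset.card_insert_of_notMem, Nat.card_Ico]
      · omega
      all_goals simp only [Finset.mem_insert, Finset.mem_Ico]; omega
    · rw [if_neg c1, if_neg c2]
      rw [Finset.card_insert_of_notMem, Nat.card_Ico]
      · omega
      all_goals simp only [Finset.mem_Ico]; omega
  · intro x hx
    rw [mem_PP] at hx
    exact B_conn 0 (by split_ifs <;> simp) (by omega) (fun _ _ _ _ => Or.inl rfl)
  · intro x hx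
    rw [mem_PP] at hx
    right
    rcases (by tauto : x = 1 ∨ (x ≠ 1 ∧ x = a) ∨ (x ≠ 1 ∧ x ≠ a)) with c1 | ⟨c1, c2⟩ | ⟨c1, c2⟩
    · rw [if_pos c1]
      refine G_not_conn ?_ (fun y => 2 ≤ y ∧ y < k) (u := 2) (v := 0) ?_ (by simp)
        (by omega) (by omega) ?_
      · intro y hy
        simp only [Finset.mem_insert, Finset.mem_Ico] at hy
        omega
      · simp only [Finset.mem_insert, Finset.mem_Ico]; omega
      · intro u hu v hv pu pv
        simp only [Finset.mem_insert, Finset.mem_Ico] at hu hv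
        omega
    · rw [if_neg c1, if_pos c2]
      refine G_not_conn ?_ (fun y => a + 1 ≤ y) (u := a + 1) (v := 0) ?_ (by simp)
        (by omega) (by omega) ?_
      · intro y hy
        simp only [Finset.mem_insert, Finset.mem_Ico] at hy
        omega
      · simp only [Finset.mem_insert, Finset.mem_Ico]; omega
      · intro u hu v hv pu pv
        simp only [Finset.mem_insert, Finset.mem_Ico] at hu hv
        omega
    · rw [if_neg c1, if_neg c2]
      refine G_not_conn ?_ (fun y => x ≤ y) (u := x) (v := 0) ?_ (by simp)
        (by omega) (by omega) ?_
      · intro y hy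
        simp only [Finset.mem_insert, Finset.mem_Ico] at hy
        omega
      · simp only [Finset.mem_insert, Finset.mem_Ico]; omega
      · intro u hu v hv pu pv
        simp only [Finset.mem_insert, Finset.mem_Ico] at hu hv
        omega
  · intro x hx y hy h
    rw [mem_PP] at hx hy
    have h1 := Finset.ext_iff.1 h
    have i1 := h1 1
    have i2 := h1 a
    have i3 := h1 x
    have i4 := h1 y
    clear h h1
    by_cases x1 : x = 1 <;> by_cases xa : x = a <;> by_cases y1 : y = 1 <;> by_cases ya : y = a <;>
      simp only [x1, xa, y1, ya, if_true, if_false, Finset.mem_insert, Finset.mem_singleton,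
        Finset.mem_Ico] at i1 i2 i3 i4 <;> grind

/-- For `a, b ≥ 3` with `n = a + b − 1 ≥ 7`, `S_k(G₁(a,b)) ≤ S_k(B_n)` for every
`k ≥ 1`. -/
theorem connCount_G1_le_Bgraph (a b : ℕ) (ha : 3 ≤ a) (hb : 3 ≤ b)
    (hn : 7 ≤ a + b - 1) :
    ∀ k, 1 ≤ k → connCount (G1graph a b) k ≤ connCount (Bgraph (a + b - 1)) k := by
  intro k hk
  rcases Nat.lt_or_ge k 3 with h | h
  · interval_cases k
    · exact case1 ha hb
    · exact case2 ha hb hn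
  · exact case3 ha hb h
end
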